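/- The Riemann zeta-function has no zeros in the region σ > 1 − 1/(5.573412·log|t|) for |t| ≥ 2. That is, for every complex number s = σ + it with |t| ≥ 2 and σ > 1 − 1/(5.573412·log|t|), one has ζ(s) ≠ 0. -/

import Mathlib

open MeasureTheory

theorem analyticOrderAt_ne_top_of_differentiable {f : ℂ → ℂ} (hf : Differentiable ℂ f) {s : ℂ}
    (hs : f s ≠ 0) (z : ℂ) : analyticOrderAt f z ≠ ⊤ := by
  intro h
  rw [analyticOrderAt_eq_top] at h
  have h1 : AnalyticOnNhd ℂ f Set.univ := fun x _ => hf.analyticAt x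
  have h2 := h1.eqOn_zero_of_preconnected_of_eventuallyEq_zero isPreconnected_univ
    (Set.mem_univ z) h
  exact hs (h2 (Set.mem_univ s))

theorem finite_zeros_closedBall {f : ℂ → ℂ} (hf : Differentiable ℂ f) {s : ℂ}
    (hs : f s ≠ 0) (c : ℂ) (N : ℝ) : {ρ : ℂ | f ρ = 0 ∧ ‖ρ - c‖ ≤ N}.Finite := by
  by_contra h
  have h' : {ρ : ℂ | f ρ = 0 ∧ ‖ρ - c‖ ≤ N}.Infinite := h
  obtain ⟨x, hx, hacc⟩ := h'.exists_accPt_of_subset_isCompact (isCompact_closedBall c N)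
    (fun ρ hρ => mem_closedBall_iff_norm.2 hρ.2)
  rw [accPt_iff_frequently_nhdsNE] at hacc
  have h1 : AnalyticOnNhd ℂ f Set.univ := fun x _ => hf.analyticAt x
  have h2 := h1.eqOn_zero_of_preconnected_of_frequently_eq_zero isPreconnected_univ
    (Set.mem_univ x) (hacc.mono fun y hy => hy.1)
  exact hs (h2 (Set.mem_univ s))

/-- Dividing out finitely many zeros of an entire function. -/
theorem exists_factor_zeros {f : ℂ → ℂ} (hf : Differentiable ℂ f) {s : ℂ}
    (hs : f s ≠ 0) (S : Finset ℂ) :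
    ∃ g : ℂ → ℂ, Differentiable ℂ g ∧ (∀ ρ ∈ S, g ρ ≠ 0) ∧
      ∀ z, f z = (∏ ρ ∈ S, (z - ρ) ^ analyticOrderNatAt f ρ) * g z := by
  classical
  induction S using Finset.induction_on with
  | empty => exact ⟨f, hf, by simp, by simp⟩
  | insert a S ha ih =>
    obtain ⟨g, hg, hgne, hfg⟩ := ih
    set p : ℂ → ℂ := fun z => ∏ ρ ∈ S, (z - ρ) ^ analyticOrderNatAt f ρ with hp
    have hpd : Differentiable ℂ p := by
      rw [hp]; fun_prop
    have hpa : p a ≠ 0 := by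
      rw [hp]
      refine Finset.prod_ne_zero_iff.2 fun ρ hρ => pow_ne_zero _ (sub_ne_zero.2 ?_)
      rintro rfl; exact ha hρ
    have hgs : g s ≠ 0 := by
      intro h; apply hs; rw [hfg, h, mul_zero]
    have hps : p s ≠ 0 := by
      intro h; apply hs; rw [hfg]; simp only [hp] at h; rw [h, zero_mul]
    have hgt := analyticOrderAt_ne_top_of_differentiable hg hgs a
    have hord : analyticOrderNatAt f a = analyticOrderNatAt g a := by
      have h1 : f = p * g := funext hfg
      rw [h1, analyticOrderNatAt_mul (hpd.analyticAt a) (hg.analyticAt a)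
        (analyticOrderAt_ne_top_of_differentiable hpd hps a) hgt]
      have : analyticOrderNatAt p a = 0 := by
        rw [analyticOrderNatAt, (hpd.analyticAt a).analyticOrderAt_eq_zero.2 hpa]; rfl
      rw [this, zero_add]
    obtain ⟨h, hha, hhne, heq⟩ := (hg.analyticAt a).analyticOrderAt_ne_top.1 hgt
    set n := analyticOrderNatAt g a with hn
    let k : ℂ → ℂ := fun z => if z = a then h a else g z / (z - a) ^ n
    have hk : ∀ z, g z = (z - a) ^ n * k z := by
      intro z
      by_cases hz : z = a
      · subst hz
        have := heq.self_of_nhds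
        simpa [k] using this
      · have : (z - a) ^ n ≠ 0 := pow_ne_zero _ (sub_ne_zero.2 hz)
        simp only [k, if_neg hz]; field_simp
    have hkd : Differentiable ℂ k := by
      intro z
      by_cases hz : z = a
      · subst hz
        refine hha.differentiableAt.congr_of_eventuallyEq ?_
        filter_upwards [heq] with y hy
        by_cases hyz : y = z
        · simp [k, hyz]
        · have : (y - z) ^ n ≠ 0 := pow_ne_zero _ (sub_ne_zero.2 hyz)
          simp only [k, if_neg hyz]
          rw [hy, smul_eq_mul]; field_simp
      · have h1 : DifferentiableAt ℂ (fun y => g y / (y - a) ^ n) z := by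
          have : (z - a) ^ n ≠ 0 := pow_ne_zero _ (sub_ne_zero.2 hz)
          exact (hg z).div (by fun_prop) this
        refine h1.congr_of_eventuallyEq ?_
        filter_upwards [isOpen_ne.mem_nhds hz] with y hy
        simp only [k, if_neg hy]
    refine ⟨k, hkd, ?_, ?_⟩
    · intro ρ hρ
      rcases Finset.mem_insert.1 hρ with rfl | hρ
      · simpa [k] using hhne
      · intro h0; apply hgne ρ hρ; rw [hk, h0, mul_zero]
    · intro z
      rw [Finset.prod_insert ha, hord, hfg z, hk z]; ring

/-- Distance of the logarithmic derivative from its partial sum over the zeros in a disc. -/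
theorem norm_logDeriv_sub_sum_le {f : ℂ → ℂ} (hf : Differentiable ℂ f)
    (hsymm : ∀ z, f (1 - z) = f z) {s : ℂ} (hs : f s ≠ 0) {N M : ℝ} (hM : 0 < M)
    (hN : 32 * (‖s - 1 / 2‖ + 1) ≤ N)
    (hfM : ∀ z : ℂ, ‖z - 1 / 2‖ = 4 * N → ‖f z‖ ≤ Real.exp M * ‖f s‖)
    (S : Finset ℂ) (hS : ∀ ρ, ρ ∈ S ↔ f ρ = 0 ∧ ‖ρ - 1 / 2‖ ≤ N) :
    ‖logDeriv f s - ∑ ρ ∈ S, (analyticOrderNatAt f ρ : ℂ) / (s - ρ)‖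
      ≤ 128 * M / N ^ 2 * ‖2 * s - 1‖ := by
  obtain ⟨g, hg, hgne, hfg⟩ := exists_factor_zeros hf hs S
  have hn0 := norm_nonneg (s - 1 / 2)
  have hNpos : 0 < N := by linarith
  have hgnz : ∀ z, ‖z - 1 / 2‖ ≤ N → g z ≠ 0 := by
    intro z hz h0
    have : z ∈ S := (hS z).2 ⟨by rw [hfg, h0, mul_zero], hz⟩
    exact hgne z this h0
  -- bound on the outer circle
  have hcirc : ∀ z : ℂ, ‖z - 1 / 2‖ = 4 * N → ‖g z‖ ≤ Real.exp M * ‖g s‖ := by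
    intro z hz
    have hf1 := hfM z hz
    rw [hfg z, hfg s, norm_mul, norm_mul] at hf1
    have hps : 0 < ‖∏ ρ ∈ S, (s - ρ) ^ analyticOrderNatAt f ρ‖ := by
      rw [norm_pos_iff]; intro h; apply hs; rw [hfg, h, zero_mul]
    have hpz : ‖∏ ρ ∈ S, (s - ρ) ^ analyticOrderNatAt f ρ‖ ≤
        ‖∏ ρ ∈ S, (z - ρ) ^ analyticOrderNatAt f ρ‖ := by
      rw [norm_prod, norm_prod]
      refine Finset.prod_le_prod (fun _ _ => norm_nonneg _) fun ρ hρ => ?_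
      rw [norm_pow, norm_pow]
      have h2 := ((hS ρ).1 hρ).2
      refine pow_le_pow_left₀ (norm_nonneg _) ?_ _
      have h3 : ‖s - ρ‖ ≤ ‖s - 1 / 2‖ + ‖ρ - 1 / 2‖ := by
        have := norm_sub_le (s - 1 / 2) (ρ - 1 / 2); simpa using this
      have h4 : ‖z - 1 / 2‖ ≤ ‖z - ρ‖ + ‖ρ - 1 / 2‖ := by
        have := norm_add_le (z - ρ) (ρ - 1 / 2); simpa using this
      linarith
    have h5 : ‖∏ ρ ∈ S, (s - ρ) ^ analyticOrderNatAt f ρ‖ * ‖g z‖ ≤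
        ‖∏ ρ ∈ S, (s - ρ) ^ analyticOrderNatAt f ρ‖ * (Real.exp M * ‖g s‖) := by
      calc _ ≤ ‖∏ ρ ∈ S, (z - ρ) ^ analyticOrderNatAt f ρ‖ * ‖g z‖ := by gcongr
        _ ≤ _ := by linarith
    exact le_of_mul_le_mul_left h5 hps
  have hball : ∀ z : ℂ, ‖z - 1 / 2‖ ≤ 4 * N → ‖g z‖ ≤ Real.exp M * ‖g s‖ := by
    intro z hz
    have h4N : (4 * N) ≠ 0 := by positivity
    refine Complex.norm_le_of_forall_mem_frontier_norm_le (U := Metric.ball (1 / 2 : ℂ) (4 * N))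
      Metric.isBounded_ball hg.diffContOnCl (fun y hy => ?_) ?_
    · rw [frontier_ball _ h4N, mem_sphere_iff_norm] at hy
      exact hcirc y hy
    · rw [closure_ball _ h4N, mem_closedBall_iff_norm]; exact hz
  have hgs : g s ≠ 0 := hgnz s (by linarith)
  have hin : ∀ z ∈ Metric.ball s (N / 2), g z ≠ 0 := by
    intro z hz
    rw [mem_ball_iff_norm] at hz
    refine hgnz z ?_
    have : ‖z - 1 / 2‖ ≤ ‖z - s‖ + ‖s - 1 / 2‖ := by
      have := norm_add_le (z - s) (s - 1 / 2); simpa using this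
    linarith
  have hLd : DifferentiableOn ℂ (logDeriv g) (Metric.ball s (N / 2)) := by
    intro z hz
    have h1 : DifferentiableAt ℂ (deriv g) z :=
      ((hg.analyticAt z).deriv).differentiableAt
    exact (h1.div (hg z) (hin z hz)).differentiableWithinAt
  obtain ⟨φ, hφs, hφ⟩ := hLd.isExactOn_ball.with_val_at s 0
  -- `g = g s * exp φ`
  have hgexp : ∀ z ∈ Metric.ball s (N / 2), g z = g s * Complex.exp (φ z) := by
    intro z hz
    have hcst : ∀ y ∈ Metric.ball s (N / 2), HasDerivWithinAt
        (fun y => g y * Complex.exp (-φ y)) 0 (Metric.ball s (N / 2)) y := by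
      intro y hy
      have h1 : HasDerivAt (fun y => g y * Complex.exp (-φ y))
        (deriv g y * Complex.exp (-φ y) + g y * (Complex.exp (-φ y) * (-logDeriv g y))) y :=
        (hg y).hasDerivAt.mul ((hφ y hy).neg.cexp)
      have h2 : deriv g y * Complex.exp (-φ y) + g y * (Complex.exp (-φ y) * (-logDeriv g y))
          = 0 := by
        have := hin y hy
        rw [logDeriv_apply]; field_simp; ring
      rw [h2] at h1
      exact h1.hasDerivWithinAt
    have h3 := (convex_ball s (N / 2)).norm_image_sub_le_of_norm_hasDerivWithin_le (C := 0)
      hcst (by simp) (Metric.mem_ball_self (by positivity)) hz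
    rw [zero_mul, norm_le_zero_iff, sub_eq_zero, hφs, neg_zero, Complex.exp_zero, mul_one] at h3
    rw [← h3, mul_assoc, ← Complex.exp_add]; simp
  have hre : ∀ z ∈ Metric.ball s (N / 2), (φ z).re ≤ M := by
    intro z hz
    have h1 : ‖z - 1 / 2‖ ≤ ‖z - s‖ + ‖s - 1 / 2‖ := by
      have := norm_add_le (z - s) (s - 1 / 2); simpa using this
    have h0 := mem_ball_iff_norm.1 hz
    have h2 := hball z (by linarith)
    rw [hgexp z hz, norm_mul, Complex.norm_exp, mul_comm] at h2
    have h3 := le_of_mul_le_mul_right h2 (norm_pos_iff.2 hgs)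
    exact Real.exp_le_exp.1 h3
  have hφb : ∀ z, ‖z - s‖ ≤ N / 4 → ‖φ z‖ ≤ 2 * M := by
    intro z hz
    have h1 := Complex.borelCaratheodory_zero (f := fun w => φ (w + s)) (z := z - s)
      (R := N / 2) hM ?_ ?_ (by positivity) ?_ (by simp [hφs])
    · simp only [sub_add_cancel] at h1
      refine h1.trans ?_
      rw [div_le_iff₀ (by linarith)]
      nlinarith
    · intro w hw
      have hw' : w + s ∈ Metric.ball s (N / 2) := by
        rw [mem_ball_iff_norm]; simpa using hw
      have := (hφ _ hw').comp_add_const w s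
      exact this.differentiableAt.differentiableWithinAt
    · intro w hw
      have hw' : w + s ∈ Metric.ball s (N / 2) := by
        rw [mem_ball_iff_norm]; simpa using hw
      exact hre _ hw'
    · simp only [Metric.mem_ball, dist_zero_right]; linarith
  have hmem : ∀ z, ‖z - s‖ < N / 2 → z ∈ Metric.ball s (N / 2) := fun z hz =>
    mem_ball_iff_norm.2 hz
  have hLb : ∀ z, ‖z - s‖ ≤ N / 8 → ‖logDeriv g z‖ ≤ 16 * M / N := by
    intro z hz
    have h1 := Complex.norm_deriv_le_of_forall_mem_sphere_norm_le (f := φ) (c := z) (R := N / 8)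
      (C := 2 * M) (by positivity) ?_ ?_
    · rw [(hφ z (hmem z (by linarith))).deriv] at h1
      refine h1.trans (le_of_eq ?_)
      field_simp; ring
    · refine DifferentiableOn.diffContOnCl fun y hy => ?_
      rw [closure_ball _ (by positivity), mem_closedBall_iff_norm] at hy
      refine (hφ y (hmem y ?_)).differentiableAt.differentiableWithinAt
      have := norm_add_le (y - z) (z - s)
      simp only [sub_add_sub_cancel] at this
      linarith
    · intro y hy
      rw [mem_sphere_iff_norm] at hy
      apply hφb
      have := norm_add_le (y - z) (z - s)
      simp only [sub_add_sub_cancel] at this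
      linarith
  have hLat : ∀ z, ‖z - s‖ < N / 2 → DifferentiableAt ℂ (logDeriv g) z := fun z hz =>
    (hLd z (hmem z hz)).differentiableAt (Metric.isOpen_ball.mem_nhds (hmem z hz))
  have hL2 : ∀ z ∈ Metric.closedBall s (N / 16), ‖deriv (logDeriv g) z‖ ≤ 256 * M / N ^ 2 := by
    intro z hz
    rw [mem_closedBall_iff_norm] at hz
    have h1 := Complex.norm_deriv_le_of_forall_mem_sphere_norm_le (f := logDeriv g) (c := z)
      (R := N / 16) (C := 16 * M / N) (by positivity) ?_ ?_
    · refine h1.trans (le_of_eq ?_)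
      field_simp; ring
    · refine DifferentiableOn.diffContOnCl fun y hy => ?_
      rw [closure_ball _ (by positivity), mem_closedBall_iff_norm] at hy
      refine (hLat y ?_).differentiableWithinAt
      have := norm_add_le (y - z) (z - s)
      simp only [sub_add_sub_cancel] at this
      linarith
    · intro y hy
      rw [mem_sphere_iff_norm] at hy
      apply hLb
      have := norm_add_le (y - z) (z - s)
      simp only [sub_add_sub_cancel] at this
      linarith
  have h2s : ‖2 * s - 1‖ = 2 * ‖s - 1 / 2‖ := by
    rw [show 2 * s - 1 = 2 * (s - 1 / 2) by ring, norm_mul]; simp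
  have hMV : ‖logDeriv g s - logDeriv g (1 - s)‖ ≤ 256 * M / N ^ 2 * ‖2 * s - 1‖ := by
    have := (convex_closedBall s (N / 16)).norm_image_sub_le_of_norm_deriv_le
      (f := logDeriv g) (x := 1 - s) (y := s) (C := 256 * M / N ^ 2)
      (fun z hz => hLat z (by rw [mem_closedBall_iff_norm] at hz; linarith)) hL2
      (by
        rw [mem_closedBall_iff_norm, show 1 - s - s = -(2 * s - 1) by ring, norm_neg, h2s]
        linarith)
      (Metric.mem_closedBall_self (by positivity))
    rwa [show s - (1 - s) = 2 * s - 1 by ring] at this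
  -- the logarithmic derivative of the factorisation
  have hlog : ∀ z, f z ≠ 0 → logDeriv f z =
      (∑ ρ ∈ S, (analyticOrderNatAt f ρ : ℂ) / (z - ρ)) + logDeriv g z := by
    intro z hz
    have hpz : ∏ ρ ∈ S, (z - ρ) ^ analyticOrderNatAt f ρ ≠ 0 := by
      intro h; apply hz; rw [hfg, h, zero_mul]
    have hgz : g z ≠ 0 := by
      intro h; apply hz; rw [hfg, h, mul_zero]
    have h1 : f = fun z => (∏ ρ ∈ S, (z - ρ) ^ analyticOrderNatAt f ρ) * g z := funext hfg
    conv_lhs => rw [h1]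
    rw [logDeriv_mul (f := fun z => ∏ ρ ∈ S, (z - ρ) ^ analyticOrderNatAt f ρ) z hpz hgz
      (by fun_prop) (hg z)]
    congr 1
    rw [logDeriv_prod (f := fun ρ z => (z - ρ) ^ analyticOrderNatAt f ρ)]
    · refine Finset.sum_congr rfl fun ρ hρ => ?_
      have hzρ : z - ρ ≠ 0 := by
        intro h0
        apply hz
        rw [sub_eq_zero.1 h0]; exact ((hS ρ).1 hρ).1
      rw [logDeriv_fun_pow (f := fun z => z - ρ) (by fun_prop)]
      simp [logDeriv_apply, div_eq_mul_inv]
    · intro ρ hρ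
      exact (Finset.prod_ne_zero_iff.1 hpz) ρ hρ
    · intro ρ _; fun_prop
  have hfs' : f (1 - s) ≠ 0 := by rwa [hsymm]
  have hlogsymm : logDeriv f (1 - s) = -logDeriv f s := by
    have h1 : deriv f s = -deriv f (1 - s) := by
      conv_lhs => rw [show f = fun z => f (1 - z) from funext fun z => (hsymm z).symm]
      rw [deriv_comp_const_sub]
    rw [logDeriv_apply, logDeriv_apply, h1, hsymm]; ring
  have hord : ∀ ρ, analyticOrderNatAt f (1 - ρ) = analyticOrderNatAt f ρ := by
    intro ρ
    have h1 := analyticOrderAt_comp_of_deriv_ne_zero (f := f) (g := fun z : ℂ => 1 - z) (z₀ := ρ)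
      (by fun_prop) (by simp)
    have h2 : f ∘ (fun z : ℂ => 1 - z) = f := funext hsymm
    rw [h2] at h1
    simp only [analyticOrderNatAt, h1]
  have hsumsymm : ∑ ρ ∈ S, (analyticOrderNatAt f ρ : ℂ) / (1 - s - ρ) =
      -∑ ρ ∈ S, (analyticOrderNatAt f ρ : ℂ) / (s - ρ) := by
    rw [← Finset.sum_neg_distrib]
    have hmap : ∀ ρ ∈ S, 1 - ρ ∈ S := by
      intro ρ hρ
      have := (hS ρ).1 hρ
      refine (hS _).2 ⟨by rw [hsymm]; exact this.1, ?_⟩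
      rw [show 1 - ρ - 1 / 2 = -(ρ - 1 / 2) by ring, norm_neg]; exact this.2
    refine Finset.sum_nbij' (fun ρ => 1 - ρ) (fun ρ => 1 - ρ) hmap hmap (by simp) (by simp) ?_
    intro ρ _
    rw [hord, ← div_neg]; congr 1; ring
  have e1 := hlog s hs
  have e2 := hlog (1 - s) hfs'
  rw [hlogsymm, hsumsymm] at e2
  have e3 : logDeriv f s - ∑ ρ ∈ S, (analyticOrderNatAt f ρ : ℂ) / (s - ρ) =
      (1 / 2) * (logDeriv g s - logDeriv g (1 - s)) := by
    linear_combination (1 / 2) * e1 - (1 / 2) * e2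
  rw [e3, norm_mul]
  have : ‖(1 / 2 : ℂ)‖ = 1 / 2 := by simp
  rw [this]
  calc _ ≤ 1 / 2 * (256 * M / N ^ 2 * ‖2 * s - 1‖) := by gcongr
    _ = _ := by ring

/-- The entire function `s (s - 1) π ^ (-s / 2) Γ (s / 2) ζ s`. -/
noncomputable def entireXi (s : ℂ) : ℂ := s * (s - 1) * completedRiemannZeta₀ s + 1

theorem differentiable_entireXi : Differentiable ℂ entireXi := by
  have := differentiable_completedZeta₀
  unfold entireXi; fun_prop

theorem entireXi_one_sub (s : ℂ) : entireXi (1 - s) = entireXi s := by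
  rw [entireXi, entireXi, completedRiemannZeta₀_one_sub]; ring

theorem entireXi_eq {s : ℂ} (h0 : s ≠ 0) (h1 : s ≠ 1) :
    entireXi s = s * (s - 1) * completedRiemannZeta s := by
  have h2 : s - 1 ≠ 0 := sub_ne_zero.2 h1
  have h3 : 1 - s ≠ 0 := sub_ne_zero.2 h1.symm
  rw [entireXi, completedRiemannZeta_eq]
  field_simp
  ring

theorem entireXi_eq_mul_zeta {s : ℂ} (hs : 0 < s.re) (h1 : s ≠ 1) :
    entireXi s = s * (s - 1) * (Complex.Gammaℝ s * riemannZeta s) := by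
  have h0 : s ≠ 0 := by rintro rfl; simp at hs
  rw [entireXi_eq h0 h1, riemannZeta_def_of_ne_zero h0,
    mul_div_cancel₀ _ (Complex.Gammaℝ_ne_zero_of_re_pos hs)]

theorem entireXi_ne_zero_of_one_le_re {s : ℂ} (hs : 1 ≤ s.re) : entireXi s ≠ 0 := by
  by_cases h1 : s = 1
  · subst h1; simp [entireXi]
  · have h0 : s ≠ 0 := by rintro rfl; simp at hs; linarith
    rw [entireXi_eq_mul_zeta (by linarith) h1]
    exact mul_ne_zero (mul_ne_zero h0 (sub_ne_zero.2 h1)) (mul_ne_zero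
      (Complex.Gammaℝ_ne_zero_of_re_pos (by linarith)) (riemannZeta_ne_zero_of_one_le_re hs))

theorem re_mem_of_entireXi_eq_zero {s : ℂ} (hs : entireXi s = 0) : 0 < s.re ∧ s.re < 1 := by
  constructor
  · by_contra h
    push Not at h
    refine entireXi_ne_zero_of_one_le_re (s := 1 - s) ?_ (by rw [entireXi_one_sub, hs])
    simp; exact h
  · by_contra h
    push Not at h
    exact entireXi_ne_zero_of_one_le_re h hs

theorem entireXi_eq_zero_of_riemannZeta_eq_zero {s : ℂ} (h0 : 0 < s.re) (h1 : s.re < 1)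
    (hs : riemannZeta s = 0) : entireXi s = 0 := by
  have hs1 : s ≠ 1 := by rintro rfl; simp at h1
  rw [entireXi_eq_mul_zeta h0 hs1, hs]; simp

theorem rpow_le_rpow_add_rpow {x a b r : ℝ} (hx : 0 < x) (ha : a ≤ r) (hb : r ≤ b) :
    x ^ r ≤ x ^ a + x ^ b := by
  rcases le_total 1 x with h | h
  · have := Real.rpow_le_rpow_of_exponent_le h hb
    have := Real.rpow_nonneg hx.le a
    linarith
  · have := Real.rpow_le_rpow_of_exponent_ge hx h ha
    have := Real.rpow_nonneg hx.le b
    linarith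

theorem exists_norm_completedRiemannZeta₀_le : ∃ C : ℝ, 0 ≤ C ∧ ∀ s : ℂ, 1 / 2 ≤ s.re → s.re ≤ 4 →
    ‖completedRiemannZeta₀ s‖ ≤ C := by
  set P := HurwitzZeta.hurwitzEvenFEPair 0 with hP
  have hmc : ∀ s : ℂ, MellinConvergent P.f_modif s := fun s =>
    (P.isStrongFEPair_toStrongFEPair.hasMellin s).1
  have hint : ∀ r : ℝ, IntegrableOn (fun t : ℝ => t ^ (r - 1) * ‖P.f_modif t‖) (Set.Ioi 0) := by
    intro r
    have h1 := (hmc (r : ℂ)).norm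
    refine (integrableOn_congr_fun (fun t ht => ?_) measurableSet_Ioi).1 h1
    simp only [norm_smul]
    rw [Complex.norm_cpow_eq_rpow_re_of_pos ht]; simp
  refine ⟨∫ t in Set.Ioi (0 : ℝ), (t ^ ((1 / 4 : ℝ) - 1) * ‖P.f_modif t‖ +
    t ^ ((2 : ℝ) - 1) * ‖P.f_modif t‖), ?_, ?_⟩
  · refine setIntegral_nonneg measurableSet_Ioi fun t ht => ?_
    have ht' : (0 : ℝ) < t := ht
    positivity
  · intro s h1 h2
    have e : completedRiemannZeta₀ s = mellin P.f_modif (s / 2) / 2 := rfl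
    rw [e, norm_div]
    have h3 : ‖mellin P.f_modif (s / 2)‖ ≤ ∫ t in Set.Ioi (0 : ℝ),
        (t ^ ((1 / 4 : ℝ) - 1) * ‖P.f_modif t‖ + t ^ ((2 : ℝ) - 1) * ‖P.f_modif t‖) := by
      refine norm_integral_le_of_norm_le ((hint _).add (hint _)) ?_
      refine (ae_restrict_iff' measurableSet_Ioi).2 (ae_of_all _ fun t ht => ?_)
      have ht' : (0 : ℝ) < t := ht
      rw [norm_smul, Complex.norm_cpow_eq_rpow_re_of_pos ht', ← add_mul]
      gcongr
      have hre : (s / 2 - 1).re = s.re / 2 - 1 := by simp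
      rw [hre]
      exact rpow_le_rpow_add_rpow ht' (by linarith) (by linarith)
    have h4 : ‖(2 : ℂ)‖ = 2 := by simp
    rw [h4]
    have := norm_nonneg (mellin P.f_modif (s / 2))
    linarith

theorem exists_norm_riemannZeta_le : ∃ C : ℝ, 0 ≤ C ∧ ∀ s : ℂ, 2 ≤ s.re →
    ‖riemannZeta s‖ ≤ C := by
  have hs2 : Summable fun n : ℕ => 1 / ((n : ℝ) + 1) ^ (2 : ℝ) := by
    have := (summable_nat_add_iff 1).2 (Real.summable_one_div_nat_rpow.2 (by norm_num : (1:ℝ) < 2))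
    simpa using this
  refine ⟨∑' n : ℕ, 1 / ((n : ℝ) + 1) ^ (2 : ℝ), tsum_nonneg fun n => by positivity, ?_⟩
  intro s hs
  rw [zeta_eq_tsum_one_div_nat_add_one_cpow (by linarith)]
  refine tsum_of_norm_bounded hs2.hasSum fun n => ?_
  rw [norm_div, norm_one]
  have : ‖((n : ℂ) + 1) ^ s‖ = ((n : ℝ) + 1) ^ s.re := by
    rw [← Complex.norm_cpow_eq_rpow_re_of_pos (by positivity)]; push_cast; rfl
  rw [this]
  gcongr
  linarith [Nat.cast_nonneg (α := ℝ) n]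

theorem norm_Gamma_le_Gamma_re {s : ℂ} (hs : 0 < s.re) : ‖Complex.Gamma s‖ ≤ Real.Gamma s.re := by
  rw [Complex.Gamma_eq_integral hs, Real.Gamma_eq_integral hs, Complex.GammaIntegral]
  refine norm_integral_le_of_norm_le (Real.GammaIntegral_convergent hs) ?_
  refine (ae_restrict_iff' measurableSet_Ioi).2 (ae_of_all _ fun t ht => ?_)
  have ht' : (0 : ℝ) < t := ht
  rw [norm_mul, Complex.norm_cpow_eq_rpow_re_of_pos ht', Complex.norm_real, Real.norm_eq_abs,
    abs_of_pos (Real.exp_pos _)]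
  simp

theorem norm_entireXi_le_of_half_le_re : ∃ C : ℝ, 0 ≤ C ∧ ∀ s : ℂ, 1 / 2 ≤ s.re → ∀ R : ℝ, 1 ≤ R →
    ‖s‖ ≤ R → ‖entireXi s‖ ≤ C * (R + 1) ^ (R + 4) := by
  obtain ⟨C1, hC1, h1⟩ := exists_norm_completedRiemannZeta₀_le
  obtain ⟨C2, hC2, h2⟩ := exists_norm_riemannZeta_le
  refine ⟨C1 + 1 + C2, by positivity, ?_⟩
  intro s hs R hR hsR
  have hn0 : ‖s - 1‖ ≤ R + 1 := (norm_sub_le _ _).trans (by simpa using hsR)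
  have hbase : (R + 1) ^ (2 : ℝ) ≤ (R + 1) ^ (R + 4) :=
    Real.rpow_le_rpow_of_exponent_le (by linarith) (by linarith)
  rcases le_total s.re 4 with h | h
  · have hA : ‖entireXi s‖ ≤ R * (R + 1) * C1 + 1 := by
      rw [entireXi]
      refine (norm_add_le _ _).trans ?_
      rw [norm_mul, norm_mul, norm_one]
      gcongr
      exact h1 s hs h
    have hB : 1 ≤ (R + 1) ^ (2 : ℝ) := Real.one_le_rpow (by linarith) (by norm_num)
    have hC : R * (R + 1) ≤ (R + 1) ^ (2 : ℝ) := by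
      rw [Real.rpow_two]; nlinarith
    calc ‖entireXi s‖ ≤ R * (R + 1) * C1 + 1 := hA
      _ ≤ (R + 1) ^ (2 : ℝ) * C1 + (R + 1) ^ (2 : ℝ) * 1 := by
          gcongr; linarith
      _ = (C1 + 1 + 0) * (R + 1) ^ (2 : ℝ) := by ring
      _ ≤ _ := by gcongr
  · have hs1 : s ≠ 1 := by rintro rfl; norm_num at h
    rw [entireXi_eq_mul_zeta (by linarith) hs1, Complex.Gammaℝ]
    have hre : (s / 2).re = s.re / 2 := by simp
    have hG : ‖Complex.Gamma (s / 2)‖ ≤ (R + 1) ^ (R + 2) := by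
      refine (norm_Gamma_le_Gamma_re (by rw [hre]; linarith)).trans ?_
      rw [hre]
      set n := ⌈s.re / 2⌉₊ with hn
      have hn1 : s.re / 2 ≤ n := Nat.le_ceil _
      have hn2 : (n : ℝ) < s.re / 2 + 1 := Nat.ceil_lt_add_one (by linarith)
      have hsre : s.re ≤ R := (Complex.re_le_norm s).trans hsR
      calc Real.Gamma (s.re / 2) ≤ Real.Gamma ((n : ℝ) + 1) :=
            Real.Gamma_strictMonoOn_Ici.monotoneOn (by simp; linarith) (by simp; linarith)
              (by linarith)
        _ = (n.factorial : ℝ) := Real.Gamma_nat_eq_factorial n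
        _ ≤ (n : ℝ) ^ n := by exact_mod_cast Nat.factorial_le_pow n
        _ ≤ (R + 1) ^ n := by gcongr; linarith
        _ = (R + 1) ^ (n : ℝ) := (Real.rpow_natCast _ _).symm
        _ ≤ (R + 1) ^ (R + 2) := Real.rpow_le_rpow_of_exponent_le (by linarith) (by linarith)
    have hpi : ‖(Real.pi : ℂ) ^ (-s / 2)‖ ≤ 1 := by
      rw [Complex.norm_cpow_eq_rpow_re_of_pos Real.pi_pos]
      refine Real.rpow_le_one_of_one_le_of_nonpos (by linarith [Real.pi_gt_three]) ?_
      simp; linarith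
    have hz := h2 s (by linarith)
    rw [norm_mul, norm_mul, norm_mul, norm_mul]
    calc _ ≤ (R + 1) * (R + 1) * (1 * (R + 1) ^ (R + 2) * C2) := by
          gcongr; linarith
      _ = C2 * ((R + 1) ^ (2 : ℝ) * (R + 1) ^ (R + 2)) := by rw [Real.rpow_two]; ring
      _ = C2 * (R + 1) ^ (R + 4) := by
          rw [← Real.rpow_add (by linarith)]; congr 2; ring
      _ ≤ _ := by gcongr; linarith

theorem norm_entireXi_le : ∃ C : ℝ, 0 ≤ C ∧ ∀ s : ℂ, ∀ R : ℝ, 1 ≤ R →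
    ‖s - 1 / 2‖ ≤ R → ‖entireXi s‖ ≤ C * (R + 2) ^ (R + 5) := by
  obtain ⟨C, hC, h⟩ := norm_entireXi_le_of_half_le_re
  have key : ∀ s : ℂ, 1 / 2 ≤ s.re → ∀ R : ℝ, 1 ≤ R →
    ‖s - 1 / 2‖ ≤ R → ‖entireXi s‖ ≤ C * (R + 2) ^ (R + 5) := by
    intro s hs R hR hsR
    have h1 : ‖s‖ ≤ R + 1 := by
      have := norm_add_le (s - 1 / 2) (1 / 2 : ℂ)
      have h2 : ‖(1 / 2 : ℂ)‖ = 1 / 2 := by simp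
      rw [sub_add_cancel, h2] at this; linarith
    have := h s hs (R + 1) (by linarith) h1
    convert this using 3 <;> ring
  refine ⟨C, hC, fun s R hR hsR => ?_⟩
  rcases le_total (1 / 2) s.re with hs | hs
  · exact key s hs R hR hsR
  · rw [← entireXi_one_sub]
    refine key (1 - s) (by simp; linarith) R hR ?_
    rw [show 1 - s - 1 / 2 = -(s - 1 / 2) by ring, norm_neg]; exact hsR

theorem eventually_norm_entireXi_le {ε A : ℝ} (hε : 0 < ε) (hA : 0 < A) : ∀ᶠ N : ℝ in Filter.atTop,
    ∀ z : ℂ, ‖z - 1 / 2‖ = 4 * N → ‖entireXi z‖ ≤ Real.exp (ε * N ^ 2) * A := by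
  obtain ⟨C, hC, h⟩ := norm_entireXi_le
  -- `log (4N+2) * (4N+5) + log ((C+1)/A) ≤ ε N²` eventually
  have h1 : (fun N : ℝ => Real.log (4 * N + 2) * (4 * N + 5) + Real.log ((C + 1) / A))
      =o[Filter.atTop] fun N : ℝ => N ^ 2 := by
    have hlin : Filter.Tendsto (fun N : ℝ => 4 * N + 2) Filter.atTop Filter.atTop :=
      Filter.tendsto_atTop_add_const_right _ _ (Filter.tendsto_id.const_mul_atTop (by norm_num))
    have hid : ∀ c d : ℝ, (fun N : ℝ => c * N + d) =O[Filter.atTop] fun N : ℝ => N := by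
      intro c d
      refine ((Asymptotics.isBigO_refl _ _).const_mul_left c).add ?_
      exact (Asymptotics.isLittleO_const_id_atTop d).isBigO
    have hl : (fun N : ℝ => Real.log (4 * N + 2)) =o[Filter.atTop] fun N : ℝ => N :=
      ((Real.isLittleO_log_id_atTop.comp_tendsto hlin)).trans_isBigO (hid 4 2)
    have h2 := hl.mul_isBigO (hid 4 5)
    refine Asymptotics.IsLittleO.add ?_ ?_
    · simpa only [pow_two] using h2
    · rw [Asymptotics.isLittleO_const_left]
      right
      have : Filter.Tendsto (fun N : ℝ => N ^ 2) Filter.atTop Filter.atTop :=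
        Filter.tendsto_pow_atTop (by norm_num)
      exact tendsto_norm_atTop_atTop.comp this
  have h2 := h1.def hε
  filter_upwards [h2, Filter.eventually_ge_atTop 1] with N hN hN1 z hz
  have h3 := h z (4 * N) (by linarith) hz.le
  have hpos : (0 : ℝ) < 4 * N + 2 := by linarith
  rw [Real.norm_of_nonneg (by positivity : (0 : ℝ) ≤ N ^ 2)] at hN
  have h4 := (le_abs_self _).trans hN
  calc ‖entireXi z‖ ≤ C * (4 * N + 2) ^ (4 * N + 5) := h3
    _ ≤ (C + 1) * (4 * N + 2) ^ (4 * N + 5) := by gcongr; linarith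
    _ = Real.exp (Real.log (4 * N + 2) * (4 * N + 5) + Real.log ((C + 1) / A)) * A := by
        rw [Real.exp_add, Real.exp_log (by positivity), Real.rpow_def_of_pos hpos]
        field_simp
    _ ≤ _ := by gcongr

/-- The zeros of `entireXi` in the disc of radius `N` around `1 / 2`. -/
noncomputable def xiZeros (N : ℝ) : Finset ℂ :=
  (finite_zeros_closedBall differentiable_entireXi
    (entireXi_ne_zero_of_one_le_re (s := 1) (by simp)) (1 / 2) N).toFinset

theorem mem_xiZeros {N : ℝ} {ρ : ℂ} : ρ ∈ xiZeros N ↔ entireXi ρ = 0 ∧ ‖ρ - 1 / 2‖ ≤ N := by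
  simp [xiZeros]

/-- The multiplicity of a zero of `entireXi`. -/
noncomputable def xiOrder (ρ : ℂ) : ℕ := analyticOrderNatAt entireXi ρ

theorem one_le_xiOrder {ρ : ℂ} (h : entireXi ρ = 0) : 1 ≤ xiOrder ρ := by
  have h1 := analyticOrderAt_ne_top_of_differentiable differentiable_entireXi
    (entireXi_ne_zero_of_one_le_re (s := 1) (by simp)) ρ
  have h2 := ((differentiable_entireXi.analyticAt ρ).analyticOrderAt_ne_zero).2 h
  rw [Nat.one_le_iff_ne_zero]
  intro h3
  apply h2
  rw [← Nat.cast_analyticOrderNatAt h1]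
  simpa [xiOrder] using h3

/-- Partial fractions of the logarithmic derivative, summed over symmetric discs. -/
theorem tendsto_sum_xiZeros {s : ℂ} (hs : entireXi s ≠ 0) :
    Filter.Tendsto (fun N : ℝ => ∑ ρ ∈ xiZeros N, (xiOrder ρ : ℂ) / (s - ρ)) Filter.atTop
      (nhds (logDeriv entireXi s)) := by
  rw [Metric.tendsto_nhds]
  intro ε hε
  have hδ : 0 < ε / (128 * (‖2 * s - 1‖ + 1)) := by positivity
  filter_upwards [eventually_norm_entireXi_le hδ (norm_pos_iff.2 hs),
    Filter.eventually_ge_atTop (32 * (‖s - 1 / 2‖ + 1))] with N h1 h2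
  have hN : 0 < N := by
    have := norm_nonneg (s - 1 / 2); linarith
  have h3 := norm_logDeriv_sub_sum_le differentiable_entireXi entireXi_one_sub hs
    (M := ε / (128 * (‖2 * s - 1‖ + 1)) * N ^ 2) (by positivity) h2 h1 (xiZeros N)
    (fun ρ => mem_xiZeros)
  rw [dist_comm, dist_eq_norm]
  refine h3.trans_lt ?_
  have : 128 * (ε / (128 * (‖2 * s - 1‖ + 1)) * N ^ 2) / N ^ 2 * ‖2 * s - 1‖ =
      ε * (‖2 * s - 1‖ / (‖2 * s - 1‖ + 1)) := by field_simp
  rw [this]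
  have h5 : ‖2 * s - 1‖ / (‖2 * s - 1‖ + 1) < 1 := by
    rw [div_lt_one (by positivity)]; linarith
  nlinarith

theorem norm_GammaSeq_le {s : ℂ} (hs : 0 < s.re) {n : ℕ} (hn : n ≠ 0) :
    ‖Complex.GammaSeq s n‖ ≤ Real.Gamma s.re := by
  rw [Complex.GammaSeq_eq_approx_Gamma_integral hs hn, Real.Gamma_eq_integral hs]
  have hn0 : (0 : ℝ) ≤ n := Nat.cast_nonneg n
  have hnpos : (0 : ℝ) < n := by positivity
  rw [intervalIntegral.integral_of_le hn0]
  have hint := Real.GammaIntegral_convergent hs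
  calc ‖∫ x : ℝ in Set.Ioc 0 (n : ℝ), ((((1 - x / n : ℝ) ^ n : ℝ)) : ℂ) * (x : ℂ) ^ (s - 1)‖
      ≤ ∫ x : ℝ in Set.Ioc 0 (n : ℝ), Real.exp (-x) * x ^ (s.re - 1) := by
        refine norm_integral_le_of_norm_le (hint.mono_set Set.Ioc_subset_Ioi_self) ?_
        refine (ae_restrict_iff' measurableSet_Ioc).2 (ae_of_all _ fun x hx => ?_)
        rw [norm_mul, Complex.norm_cpow_eq_rpow_re_of_pos hx.1, Complex.norm_real]
        have h1 : 0 ≤ 1 - x / n := by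
          rw [sub_nonneg, div_le_one hnpos]; exact hx.2
        rw [Real.norm_of_nonneg (pow_nonneg h1 _)]
        have h2 : (1 - x / n) ^ n ≤ Real.exp (-x) := by
          calc (1 - x / n) ^ n ≤ Real.exp (-(x / n)) ^ n := by
                gcongr; exact Real.one_sub_le_exp_neg _
            _ = Real.exp (-x) := by
                rw [← Real.exp_nat_mul]; congr 1; field_simp
        simp only [Complex.sub_re, Complex.one_re]
        have := Real.rpow_nonneg hx.1.le (s.re - 1)
        gcongr
    _ ≤ _ := by
        refine setIntegral_mono_set hint ?_ (Set.Ioc_subset_Ioi_self.eventuallyLE)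
        refine (ae_restrict_iff' measurableSet_Ioi).2 (ae_of_all _ fun x hx => ?_)
        have hx' : (0 : ℝ) < x := hx
        simp only [Pi.zero_apply]
        positivity

theorem tendsto_deriv_GammaSeq {z : ℂ} (hz : 0 < z.re) :
    Filter.Tendsto (fun n : ℕ => deriv (fun s => Complex.GammaSeq s n) z) Filter.atTop
      (nhds (deriv Complex.Gamma z)) := by
  set r := z.re / 2 with hr
  have hrpos : 0 < r := by positivity
  set U : Set ℂ := {s | 0 < s.re} with hU
  have hUo : IsOpen U := isOpen_lt continuous_const Complex.continuous_re
  have hsub : Metric.closedBall z r ⊆ U := by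
    intro w hw
    rw [mem_closedBall_iff_norm] at hw
    have := (Complex.abs_re_le_norm (w - z)).trans hw
    rw [Complex.sub_re, abs_le] at this
    simp only [hU, Set.mem_ofPred_eq]; linarith
  have hnz : ∀ s ∈ U, ∀ m : ℕ, s ≠ -m := by
    rintro s hs m rfl
    simp only [hU, Set.mem_ofPred_eq, Complex.neg_re, Complex.natCast_re] at hs
    linarith [Nat.cast_nonneg (α := ℝ) m]
  have hGd : DifferentiableOn ℂ Complex.Gamma U := fun s hs =>
    (Complex.differentiableAt_Gamma s (hnz s hs)).differentiableWithinAt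
  have hFd : ∀ n : ℕ, n ≠ 0 → DifferentiableOn ℂ (fun s => Complex.GammaSeq s n) U := by
    intro n hn s hs
    unfold Complex.GammaSeq
    have hn' : (n : ℂ) ≠ 0 := by exact_mod_cast hn
    refine DifferentiableAt.differentiableWithinAt ?_
    refine DifferentiableAt.div ?_ (by fun_prop) ?_
    · exact (DifferentiableAt.const_cpow differentiableAt_id (Or.inl hn')).mul_const _
    · refine Finset.prod_ne_zero_iff.2 fun j _ => ?_
      intro h0; exact hnz s hs j (eq_neg_of_add_eq_zero_left h0)
  have hcauchy : ∀ f : ℂ → ℂ, DifferentiableOn ℂ f U → deriv f z =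
      (2 * Real.pi * Complex.I : ℂ)⁻¹ • ∮ w in C(z, r), ((w - z) ^ 2)⁻¹ • f w := by
    intro f hf
    rw [Complex.two_pi_I_inv_smul_circleIntegral_sub_sq_inv_smul_of_differentiable hUo hsub hf
      (Metric.mem_ball_self hrpos)]
  rw [hcauchy _ hGd]
  have hev : ∀ᶠ n : ℕ in Filter.atTop, (2 * Real.pi * Complex.I : ℂ)⁻¹ •
      (∮ w in C(z, r), ((w - z) ^ 2)⁻¹ • Complex.GammaSeq w n) =
      deriv (fun s => Complex.GammaSeq s n) z := by
    filter_upwards [Filter.eventually_ne_atTop 0] with n hn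
    rw [hcauchy _ (hFd n hn)]
  refine Filter.Tendsto.congr' hev (Filter.Tendsto.const_smul ?_ _)
  have hmem : ∀ θ : ℝ, circleMap z r θ ∈ U := fun θ =>
    hsub (circleMap_mem_closedBall z hrpos.le θ)
  obtain ⟨M, hM⟩ : ∃ M, ∀ θ : ℝ, Real.Gamma (circleMap z r θ).re ≤ M := by
    have hc : ContinuousOn (fun w : ℂ => Real.Gamma w.re) (Metric.closedBall z r) := by
      intro w hw
      have hw' : 0 < w.re := hsub hw
      have h1 : ContinuousAt Real.Gamma w.re := by
        refine (Real.differentiableAt_Gamma fun m h => ?_).continuousAt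
        rw [h] at hw'; linarith [Nat.cast_nonneg (α := ℝ) m]
      exact (h1.comp (f := Complex.re) Complex.continuous_re.continuousAt).continuousWithinAt
    obtain ⟨M, hM⟩ := (isCompact_closedBall z r).bddAbove_image hc
    exact ⟨M, fun θ => hM ⟨_, circleMap_mem_closedBall z hrpos.le θ, rfl⟩⟩
  unfold circleIntegral
  have hd : ∀ θ : ℝ, ‖deriv (circleMap z r) θ‖ = r := by
    intro θ
    simp [deriv_circleMap, abs_of_pos hrpos]
  have hsq : ∀ θ : ℝ, ‖((circleMap z r θ - z) ^ 2)⁻¹‖ = (r ^ 2)⁻¹ := by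
    intro θ; simp [circleMap]
  refine intervalIntegral.tendsto_integral_filter_of_dominated_convergence
    (fun _ => r * ((r ^ 2)⁻¹ * M)) ?_ ?_ ?_ ?_
  · filter_upwards [Filter.eventually_ne_atTop 0] with n hn
    refine Continuous.aestronglyMeasurable ?_
    have hcm := continuous_circleMap z r
    have h1 : Continuous fun θ => deriv (circleMap z r) θ := by
      simp only [deriv_circleMap]; fun_prop
    have h2 : Continuous fun θ : ℝ => Complex.GammaSeq (circleMap z r θ) n :=
      (hFd n hn).continuousOn.comp_continuous hcm hmem
    have h3 : Continuous fun θ : ℝ => ((circleMap z r θ - z) ^ 2)⁻¹ := by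
      refine Continuous.inv₀ (by fun_prop) fun θ h0 => ?_
      have := hsq θ
      rw [h0] at this
      rw [inv_zero, norm_zero] at this
      exact (by positivity : (r ^ 2)⁻¹ ≠ 0) this.symm
    exact h1.smul (h3.smul h2)
  · filter_upwards [Filter.eventually_ne_atTop 0] with n hn
    refine ae_of_all _ fun θ _ => ?_
    rw [norm_smul, norm_smul, hd, hsq]
    gcongr
    exact (norm_GammaSeq_le (hmem θ) hn).trans (hM θ)
  · exact intervalIntegrable_const
  · refine ae_of_all _ fun θ _ => ?_
    exact ((Complex.GammaSeq_tendsto_Gamma _).const_smul _).const_smul _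

theorem tendsto_log_sub_sum_digamma {z : ℂ} (hz : 0 < z.re) :
    Filter.Tendsto (fun n : ℕ => Complex.log n - ∑ j ∈ Finset.range (n + 1), 1 / (z + j))
      Filter.atTop (nhds (Complex.digamma z)) := by
  have h1 := (tendsto_deriv_GammaSeq hz).div (Complex.GammaSeq_tendsto_Gamma z)
    (Complex.Gamma_ne_zero_of_re_pos hz)
  rw [Complex.digamma_def, logDeriv_apply]
  refine Filter.Tendsto.congr' ?_ h1
  filter_upwards [Filter.eventually_ne_atTop 0] with n hn
  have hn' : (n : ℂ) ≠ 0 := by exact_mod_cast hn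
  have hzj : ∀ j : ℕ, z + j ≠ 0 := by
    intro j h0
    have := congrArg Complex.re h0
    simp at this
    linarith [Nat.cast_nonneg (α := ℝ) j]
  have hP : ∏ j ∈ Finset.range (n + 1), (z + j) ≠ 0 := Finset.prod_ne_zero_iff.2 fun j _ => hzj j
  have hA : (n : ℂ) ^ z * (n.factorial : ℂ) ≠ 0 :=
    mul_ne_zero (by simp [Complex.cpow_eq_zero_iff, hn']) (by exact_mod_cast n.factorial_ne_zero)
  have hdn : DifferentiableAt ℂ (fun s : ℂ => (n : ℂ) ^ s * (n.factorial : ℂ)) z :=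
    (DifferentiableAt.const_cpow differentiableAt_id (Or.inl hn')).mul_const _
  have h2 : logDeriv (fun s => Complex.GammaSeq s n) z =
      Complex.log n - ∑ j ∈ Finset.range (n + 1), 1 / (z + j) := by
    unfold Complex.GammaSeq
    rw [logDeriv_div (f := fun s : ℂ => (n : ℂ) ^ s * (n.factorial : ℂ)) z hA hP hdn
      (by fun_prop)]
    congr 1
    · rw [logDeriv_apply]
      have : HasDerivAt (fun s : ℂ => (n : ℂ) ^ s * (n.factorial : ℂ))
          ((n : ℂ) ^ z * Complex.log n * 1 * (n.factorial : ℂ)) z :=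
        ((hasDerivAt_id z).const_cpow (Or.inl hn')).mul_const _
      rw [this.deriv, div_eq_iff hA]
      ring
    · rw [logDeriv_prod (f := fun (j : ℕ) (s : ℂ) => s + j)]
      · refine Finset.sum_congr rfl fun j _ => ?_
        simp [logDeriv_apply]
      · intro j _; exact hzj j
      · intro j _; fun_prop
  rw [← h2, logDeriv_apply]; rfl

theorem log_mul_of_re_pos {a b : ℂ} (ha : 0 < a.re) (hb : 0 < b.re) :
    Complex.log (a * b) = Complex.log a + Complex.log b := by
  have ha0 : a ≠ 0 := by rintro rfl; simp at ha
  have hb0 : b ≠ 0 := by rintro rfl; simp at hb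
  have h1 := Complex.abs_arg_lt_pi_div_two_iff.2 (Or.inl ha)
  have h2 := Complex.abs_arg_lt_pi_div_two_iff.2 (Or.inl hb)
  rw [abs_lt] at h1 h2
  exact Complex.log_mul ha0 hb0 ⟨by linarith, by linarith⟩

theorem norm_log_add_half_sub_log_sub_half_le {w : ℂ} (hw : 3 / 2 ≤ w.re) :
    ‖Complex.log (w + 1 / 2) - Complex.log (w - 1 / 2) - 1 / w‖ ≤ 1 / (8 * ‖w‖ ^ 3) := by
  have hn : 3 / 2 ≤ ‖w‖ := hw.trans (Complex.re_le_norm w)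
  have hw0 : w ≠ 0 := by rintro rfl; norm_num at hn
  set u : ℂ := 1 / (2 * w) with hu
  have hun : ‖u‖ = 1 / (2 * ‖w‖) := by rw [hu]; simp
  have hu3 : ‖u‖ ≤ 1 / 3 := by
    rw [hun]; apply one_div_le_one_div_of_le <;> linarith
  have hre : ∀ v : ℂ, ‖v‖ ≤ 1 / 3 → 0 < (1 + v).re := by
    intro v hv
    have := (abs_le.1 ((Complex.abs_re_le_norm v).trans hv)).1
    simp; linarith
  have e1 : Complex.log (w + 1 / 2) = Complex.log w + Complex.log (1 + u) := by
    rw [← log_mul_of_re_pos (by linarith) (hre u hu3)]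
    congr 1; rw [hu]; field_simp
  have e2 : Complex.log (w - 1 / 2) = Complex.log w + Complex.log (1 + -u) := by
    rw [← log_mul_of_re_pos (by linarith) (hre (-u) (by rwa [norm_neg]))]
    congr 1; rw [hu]; field_simp; ring
  have hT : ∀ v : ℂ, Complex.logTaylor (2 + 1) v = v - v ^ 2 / 2 := by
    intro v
    simp [Complex.logTaylor_succ, Complex.logTaylor_zero]
    ring
  have b1 := Complex.norm_log_sub_logTaylor_le 2 (z := u) (by linarith)
  have b2 := Complex.norm_log_sub_logTaylor_le 2 (z := -u) (by rw [norm_neg]; linarith)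
  rw [hT] at b1 b2
  rw [norm_neg] at b2
  have e3 : Complex.log (w + 1 / 2) - Complex.log (w - 1 / 2) - 1 / w =
      (Complex.log (1 + u) - (u - u ^ 2 / 2)) - (Complex.log (1 + -u) - (-u - (-u) ^ 2 / 2)) := by
    rw [e1, e2]
    have : 1 / w = 2 * u := by rw [hu]; field_simp
    rw [this]; ring
  rw [e3]
  refine (norm_sub_le _ _).trans ((add_le_add b1 b2).trans ?_)
  have h4 : (1 - ‖u‖)⁻¹ ≤ 3 / 2 := by
    rw [inv_le_comm₀ (by linarith) (by norm_num)]; norm_num; linarith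
  have h5 : 1 / (8 * ‖w‖ ^ 3) = ‖u‖ ^ 3 := by rw [hun]; field_simp; norm_num
  rw [h5]
  have h6 : 0 ≤ ‖u‖ ^ 3 := by positivity
  push_cast
  nlinarith [mul_le_mul_of_nonneg_left h4 h6]

theorem norm_digamma_sub_log_le {z : ℂ} (hz : 3 / 2 ≤ z.re) {B : ℝ}
    (hB : ∀ n : ℕ, ∑ j ∈ Finset.range n, 1 / (8 * ‖z + j‖ ^ 3) ≤ B) :
    ‖Complex.digamma z - Complex.log (z - 1 / 2)‖ ≤ B := by
  have h1 := tendsto_log_sub_sum_digamma (z := z) (by linarith)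
  have h2 : Filter.Tendsto (fun n : ℕ => Complex.log n - Complex.log (z + n + 1 / 2))
      Filter.atTop (nhds 0) := by
    have h3 : Filter.Tendsto (fun n : ℕ => -Complex.log (1 + (z + 1 / 2) / n)) Filter.atTop
        (nhds 0) := by
      have h4 : Filter.Tendsto (fun n : ℕ => 1 + (z + 1 / 2) / (n : ℂ)) Filter.atTop
          (nhds (1 + 0)) :=
        tendsto_const_nhds.add (tendsto_const_div_atTop_nhds_zero_nat _)
      rw [add_zero] at h4
      have h5 := (h4.clog (by simp [Complex.slitPlane])).neg
      simpa using h5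
    refine Filter.Tendsto.congr' ?_ h3
    filter_upwards [Filter.eventually_ne_atTop 0] with n hn
    have hnpos : (0 : ℝ) < n := by positivity
    have hn' : (n : ℂ) ≠ 0 := by exact_mod_cast hn
    have hre : 0 < (1 + (z + 1 / 2) / (n : ℂ)).re := by
      rw [show (n : ℂ) = ((n : ℝ) : ℂ) by simp, Complex.add_re, Complex.div_ofReal_re]
      have : 0 < (z + 1 / 2).re := by simp; linarith
      simp only [Complex.one_re]
      positivity
    have : z + n + 1 / 2 = (n : ℂ) * (1 + (z + 1 / 2) / n) := by field_simp; ring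
    rw [this, log_mul_of_re_pos (by simpa using hnpos) hre]; ring
  have h3 := (h1.sub h2).sub_const (Complex.log (z - 1 / 2))
  rw [sub_zero] at h3
  refine le_of_tendsto h3.norm (Filter.Eventually.of_forall fun n => ?_)
  have htel : Complex.log (z + n + 1 / 2) - Complex.log (z - 1 / 2) =
      ∑ j ∈ Finset.range (n + 1), (Complex.log (z + j + 1 / 2) - Complex.log (z + j - 1 / 2)) := by
    have := Finset.sum_range_sub (fun j : ℕ => Complex.log (z + j - 1 / 2)) (n + 1)
    push_cast at this
    rw [show z + (n : ℂ) + 1 / 2 = z + (n + 1) - 1 / 2 by ring]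
    simp only [add_zero] at this
    rw [← this]
    refine Finset.sum_congr rfl fun j _ => ?_
    congr 2; ring
  have e : Complex.log n - ∑ j ∈ Finset.range (n + 1), 1 / (z + j) -
      (Complex.log n - Complex.log (z + n + 1 / 2)) - Complex.log (z - 1 / 2) =
      ∑ j ∈ Finset.range (n + 1),
        (Complex.log (z + j + 1 / 2) - Complex.log (z + j - 1 / 2) - 1 / (z + j)) := by
    rw [Finset.sum_sub_distrib, ← htel]; ring
  rw [e]
  refine (norm_sum_le _ _).trans ((Finset.sum_le_sum fun j _ => ?_).trans (hB (n + 1)))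
  exact norm_log_add_half_sub_log_sub_half_le (by simp; linarith [Nat.cast_nonneg (α := ℝ) j])

theorem norm_digamma_sub_log_le_re {z : ℂ} (hz : 3 / 2 ≤ z.re) :
    ‖Complex.digamma z - Complex.log (z - 1 / 2)‖ ≤ 1 / (16 * (z.re - 1 / 2) ^ 2) := by
  refine norm_digamma_sub_log_le hz fun n => ?_
  have key : ∀ x : ℝ, 3 / 2 ≤ x → 1 / (8 * x ^ 3) ≤
      1 / (16 * (x - 1 / 2) ^ 2) - 1 / (16 * (x + 1 / 2) ^ 2) := by
    intro x hx
    have h1 : 0 < x - 1 / 2 := by linarith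
    have h2 : 0 < x + 1 / 2 := by linarith
    rw [div_sub_div _ _ (by positivity) (by positivity), div_le_div_iff₀ (by positivity)
      (by positivity)]
    have : 0 ≤ x ^ 2 - 1 / 4 := by nlinarith
    have h3 : (x - 1 / 2) ^ 2 * (x + 1 / 2) ^ 2 ≤ x ^ 4 := by
      have : (x - 1 / 2) ^ 2 * (x + 1 / 2) ^ 2 = (x ^ 2 - 1 / 4) ^ 2 := by ring
      rw [this]; nlinarith
    nlinarith
  have h := Finset.sum_le_sum (s := Finset.range n) (f := fun j : ℕ => 1 / (8 * ‖z + j‖ ^ 3))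
    (g := fun j : ℕ => 1 / (16 * (z.re + j - 1 / 2) ^ 2) -
      1 / (16 * (z.re + (j + 1 : ℕ) - 1 / 2) ^ 2)) (fun j _ => by
      have h1 : z.re + j ≤ ‖z + j‖ := by
        have := Complex.re_le_norm (z + j); simpa using this
      have h0 := Nat.cast_nonneg (α := ℝ) j
      calc 1 / (8 * ‖z + j‖ ^ 3) ≤ 1 / (8 * (z.re + j) ^ 3) := by gcongr
        _ ≤ _ := by
          refine (key (z.re + j) (by linarith)).trans (le_of_eq ?_)
          push_cast; ring_nf)
  refine h.trans ?_
  rw [Finset.sum_range_sub' (fun j : ℕ => 1 / (16 * (z.re + j - 1 / 2) ^ 2))]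
  have : 0 ≤ 1 / (16 * (z.re + n - 1 / 2) ^ 2) := by positivity
  simp only [Nat.cast_zero, add_zero]
  linarith

theorem norm_digamma_sub_log_le_im {z : ℂ} (hz : 3 / 2 ≤ z.re) (hy : z.im ≠ 0) :
    ‖Complex.digamma z - Complex.log (z - 1 / 2)‖ ≤ 1 / (4 * |z.im| * (|z.im| + 1)) := by
  have hY : 0 < |z.im| := abs_pos.2 hy
  set Y := |z.im| with hYdef
  have hbound : ∀ n : ℕ, ∑ j ∈ Finset.range n, 1 / (8 * ‖z + j‖ ^ 3) ≤
      1 / (4 * Y * (z.re + Y - 1 / 2)) := by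
    intro n
    have h := Finset.sum_le_sum (s := Finset.range n) (f := fun j : ℕ => 1 / (8 * ‖z + j‖ ^ 3))
      (g := fun j : ℕ => 1 / (4 * Y * (z.re + j + Y - 1 / 2)) -
        1 / (4 * Y * (z.re + (j + 1 : ℕ) + Y - 1 / 2))) (fun j _ => by
        have h0 := Nat.cast_nonneg (α := ℝ) j
        set x := z.re + j with hx
        have hxpos : 3 / 2 ≤ x := by linarith
        have h1 : ‖z + j‖ ^ 2 = x ^ 2 + Y ^ 2 := by
          rw [Complex.sq_norm, Complex.normSq_apply, hYdef, sq_abs]; simp [hx]; ring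
        have h2 : Y ≤ ‖z + j‖ := by
          have := Complex.abs_im_le_norm (z + j); simpa using this
        have h3 : Y * (x ^ 2 + Y ^ 2) ≤ ‖z + j‖ ^ 3 := by
          rw [show ‖z + j‖ ^ 3 = ‖z + j‖ * ‖z + j‖ ^ 2 by ring, h1]; gcongr
        have e : 1 / (4 * Y * (x + Y - 1 / 2)) - 1 / (4 * Y * (z.re + (j + 1 : ℕ) + Y - 1 / 2)) =
            1 / (4 * Y * ((x + Y) ^ 2 - 1 / 4)) := by
          have q1 : x + Y - 1 / 2 ≠ 0 := by linarith
          have q2 : x + Y + 1 / 2 ≠ 0 := by linarith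
          have : z.re + (j + 1 : ℕ) + Y - 1 / 2 = x + Y + 1 / 2 := by push_cast; rw [hx]; ring
          rw [this, show (x + Y) ^ 2 - 1 / 4 = (x + Y - 1 / 2) * (x + Y + 1 / 2) by ring,
            div_sub_div _ _ (by positivity) (by positivity), div_eq_div_iff (by positivity) (by positivity)]
          ring
        rw [e]
        have h5 : 0 < (x + Y) ^ 2 - 1 / 4 := by nlinarith
        apply one_div_le_one_div_of_le (by positivity)
        have h6 : (x + Y) ^ 2 ≤ 2 * (x ^ 2 + Y ^ 2) := by nlinarith [sq_nonneg (x - Y)]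
        nlinarith [mul_le_mul_of_nonneg_left h6 hY.le])
    refine h.trans ?_
    rw [Finset.sum_range_sub' (fun j : ℕ => 1 / (4 * Y * (z.re + j + Y - 1 / 2)))]
    have h7 : 0 ≤ 1 / (4 * Y * (z.re + n + Y - 1 / 2)) := by
      have := Nat.cast_nonneg (α := ℝ) n
      have : 0 < z.re + n + Y - 1 / 2 := by linarith
      positivity
    simp only [Nat.cast_zero, add_zero]
    linarith
  refine (norm_digamma_sub_log_le hz hbound).trans ?_
  apply one_div_le_one_div_of_le (by positivity)
  gcongr
  linarith

open ComplexConjugate in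
theorem Gammaℝ_conj (s : ℂ) : Complex.Gammaℝ (conj s) = conj (Complex.Gammaℝ s) := by
  rw [Complex.Gammaℝ_def, Complex.Gammaℝ_def, map_mul, ← Complex.Gamma_conj]
  congr 1
  · have := Complex.cpow_conj (Real.pi : ℂ) (-s / 2)
      (by rw [Complex.arg_ofReal_of_nonneg Real.pi_pos.le]; exact Real.pi_pos.ne)
    rw [Complex.conj_ofReal] at this
    rw [← this, map_div₀, map_neg, map_ofNat]
  · rw [map_div₀, map_ofNat]

open ComplexConjugate in
theorem entireXi_conj (s : ℂ) : entireXi (conj s) = conj (entireXi s) := by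
  have key : ∀ s : ℂ, 0 < s.re → entireXi (conj s) = conj (entireXi s) := by
    intro s hs
    rcases eq_or_ne s 1 with rfl | h1
    · simp [entireXi]
    · have h1' : conj s ≠ 1 := fun h => h1 (by simpa using congrArg conj h)
      rw [entireXi_eq_mul_zeta (by simpa using hs) h1', entireXi_eq_mul_zeta hs h1, Gammaℝ_conj,
        riemannZeta_conj]
      simp
  rcases lt_or_ge 0 s.re with hs | hs
  · exact key s hs
  · have := key (1 - s) (by simp; linarith)
    rw [entireXi_one_sub] at this
    rw [← this, ← entireXi_one_sub]
    simp

open ComplexConjugate in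
theorem logDeriv_entireXi_conj (s : ℂ) :
    logDeriv entireXi (conj s) = conj (logDeriv entireXi s) := by
  have h : conj ∘ entireXi ∘ conj = entireXi := by
    ext s; simp [entireXi_conj]
  have h2 := congrFun (deriv_conj_conj (f := entireXi)) (conj s)
  rw [h] at h2
  simp only [Function.comp_apply, Complex.conj_conj] at h2
  rw [logDeriv_apply, logDeriv_apply, h2, entireXi_conj, map_div₀]

theorem logDeriv_entireXi_one_sub (s : ℂ) :
    logDeriv entireXi (1 - s) = -logDeriv entireXi s := by
  have h : (fun s => entireXi (1 - s)) = entireXi := funext entireXi_one_sub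
  have h2 : deriv entireXi s = -deriv entireXi (1 - s) := by
    conv_lhs => rw [← h]
    rw [deriv_comp_const_sub]
  rw [logDeriv_apply, logDeriv_apply, h2, entireXi_one_sub]; ring

open ComplexConjugate in
theorem tendsto_sum_xiZeros_mirror {s : ℂ} (hs : entireXi s ≠ 0) :
    Filter.Tendsto (fun N : ℝ => ∑ ρ ∈ xiZeros N, (xiOrder ρ : ℂ) / (s - (1 - conj ρ)))
      Filter.atTop (nhds (logDeriv entireXi s)) := by
  have h1 : entireXi (1 - conj s) ≠ 0 := by
    rw [entireXi_one_sub, entireXi_conj]; simpa using hs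
  have h2 := ((Complex.continuous_conj.tendsto _).comp (tendsto_sum_xiZeros h1)).neg
  rw [logDeriv_entireXi_one_sub, logDeriv_entireXi_conj, map_neg, Complex.conj_conj, neg_neg] at h2
  refine h2.congr fun N => ?_
  simp only [Function.comp_apply, map_sum, map_div₀, map_sub, map_one, map_natCast,
    Complex.conj_conj]
  rw [← Finset.sum_neg_distrib]
  refine Finset.sum_congr rfl fun ρ _ => ?_
  rw [← div_neg]; congr 1; ring

open ComplexConjugate in
theorem mirror_mem_xiZeros {N : ℝ} {ρ : ℂ} (h : ρ ∈ xiZeros N) : 1 - conj ρ ∈ xiZeros N := by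
  rw [mem_xiZeros] at h ⊢
  refine ⟨by rw [entireXi_one_sub, entireXi_conj, h.1, map_zero], ?_⟩
  have : 1 - conj ρ - 1 / 2 = -conj (ρ - 1 / 2) := by
    simp only [map_sub, map_div₀, map_one, map_ofNat]; ring
  rw [this, norm_neg, Complex.norm_conj]; exact h.2

/-- The error in Stirling's formula for the digamma function. -/
noncomputable def stirlingError (s : ℂ) : ℂ :=
  Complex.digamma (s / 2 + 1) - Complex.log (s / 2 + 1 - 1 / 2)

/-- The contribution of the pole and of the Gamma factor to the negative
logarithmic derivative of `ζ`. -/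
noncomputable def poleGamma (s : ℂ) : ℂ :=
  1 / (s - 1) + Complex.log ((s + 1) / (2 * Real.pi)) / 2 + stirlingError s / 2

theorem logDeriv_entireXi {s : ℂ} (hs : 1 < s.re) :
    logDeriv entireXi s = poleGamma s + logDeriv riemannZeta s := by
  have h1 : s ≠ 1 := by rintro rfl; simp at hs
  have h0 : s ≠ 0 := by rintro rfl; simp at hs; linarith
  have h1' : s - 1 ≠ 0 := sub_ne_zero.2 h1
  have hpi : (Real.pi : ℂ) ≠ 0 := by exact_mod_cast Real.pi_ne_zero
  have hG : Complex.Gamma (s / 2) ≠ 0 :=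
    Complex.Gamma_ne_zero_of_re_pos (by simp; linarith)
  have hz : riemannZeta s ≠ 0 := riemannZeta_ne_zero_of_one_lt_re hs
  have hev : entireXi =ᶠ[nhds s] fun s => s * (s - 1) *
      ((Real.pi : ℂ) ^ (-s / 2) * Complex.Gamma (s / 2) * riemannZeta s) := by
    have : {z : ℂ | 1 < z.re} ∈ nhds s :=
      (isOpen_lt continuous_const Complex.continuous_re).mem_nhds hs
    filter_upwards [this] with z hz
    have hz' : 1 < z.re := hz
    rw [entireXi_eq_mul_zeta (by linarith) (by rintro rfl; simp at hz'), Complex.Gammaℝ_def]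
  have hpow : HasDerivAt (fun s : ℂ => (Real.pi : ℂ) ^ (-s / 2))
      ((Real.pi : ℂ) ^ (-s / 2) * Complex.log Real.pi * (-1 / 2)) s :=
    ((hasDerivAt_id s).neg.div_const 2).const_cpow (Or.inl hpi)
  have hnz : ∀ m : ℕ, s / 2 ≠ -m := by
    intro m h
    have := congrArg Complex.re h
    simp at this
    linarith [Nat.cast_nonneg (α := ℝ) m]
  have hGd := Complex.differentiableAt_Gamma _ hnz
  have hGd' : HasDerivAt (fun s : ℂ => Complex.Gamma (s / 2))
      (deriv Complex.Gamma (s / 2) * (1 / 2)) s :=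
    hGd.hasDerivAt.comp s ((hasDerivAt_id s).div_const 2)
  have hzd := (differentiableAt_riemannZeta h1).hasDerivAt
  have hd := ((hasDerivAt_id s).mul ((hasDerivAt_id s).sub_const 1)).mul ((hpow.mul hGd').mul hzd)
  have hp0 : (Real.pi : ℂ) ^ (-s / 2) ≠ 0 := by simp [Complex.cpow_eq_zero_iff, hpi]
  have e1 : logDeriv entireXi s = 1 / s + 1 / (s - 1) - Complex.log Real.pi / 2 +
      Complex.digamma (s / 2) / 2 + logDeriv riemannZeta s := by
    rw [logDeriv_apply, hev.deriv_eq, hev.self_of_nhds, Complex.digamma_def, logDeriv_apply,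
      logDeriv_apply]
    have := hd.deriv
    simp only [Pi.mul_def, id] at this
    rw [this]
    field_simp
    ring
  have e2 := Complex.digamma_apply_add_one (s / 2) hnz
  have e3 : Complex.log ((s + 1) / (2 * Real.pi)) =
      Complex.log (s / 2 + 1 - 1 / 2) - Complex.log Real.pi := by
    have : (s + 1) / 2 = (Real.pi : ℂ) * ((s + 1) / (2 * Real.pi)) := by field_simp
    rw [show s / 2 + 1 - 1 / 2 = (Real.pi : ℂ) * ((s + 1) / (2 * Real.pi)) by
      rw [← this]; ring, log_mul_of_re_pos (by simpa using Real.pi_pos)]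
    · ring
    · have : (s + 1) / (2 * Real.pi) = (s + 1) / ((2 * Real.pi : ℝ) : ℂ) := by push_cast; rfl
      rw [this, Complex.div_ofReal_re]
      have : 0 < (s + 1).re := by simp; linarith
      positivity
  rw [e1, poleGamma, stirlingError, e2, e3]
  field_simp
  ring

theorem neg_logDeriv_riemannZeta {s : ℂ} (hs : 1 < s.re) :
    -logDeriv riemannZeta s = poleGamma s - logDeriv entireXi s := by
  rw [logDeriv_entireXi hs]; ring

theorem norm_stirlingError_le_re {s : ℂ} (hs : 1 ≤ s.re) :
    ‖stirlingError s‖ ≤ 1 / (4 * (s.re + 1) ^ 2) := by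
  refine (norm_digamma_sub_log_le_re (z := s / 2 + 1) (by simp; linarith)).trans (le_of_eq ?_)
  congr 1
  simp
  ring

theorem norm_stirlingError_le_im {s : ℂ} (hs : 1 ≤ s.re) (h : s.im ≠ 0) :
    ‖stirlingError s‖ ≤ 1 / s.im ^ 2 := by
  refine (norm_digamma_sub_log_le_im (z := s / 2 + 1) (by simp; linarith) (by simpa using h)).trans ?_
  have h0 : 0 < |s.im| := abs_pos.2 h
  rw [← sq_abs]
  apply one_div_le_one_div_of_le (by positivity)
  simp [abs_div]
  rw [← sq_abs]
  nlinarith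

open ComplexConjugate in
/-- The superposition of three translates attached to the kernel
`1 / (z + B) + w / (z + B - iC) + conj w / (z + B + iC)`. -/
noncomputable def poleKernel (w : ℂ) (B C : ℝ) (g : ℂ → ℂ) (s : ℂ) : ℂ :=
  g (s + B) + w * g (s + B - C * Complex.I) + conj w * g (s + B + C * Complex.I)

/-- A superposition of translates by `0`, `0.97 m` and `1.4 m`. -/
noncomputable def mixKernel (m : ℝ) (g : ℂ → ℂ) (s : ℂ) : ℂ :=
  g s - 27 / 25 * g (s + (97 / 100 * m : ℝ)) + 59 / 100 * g (s + (7 / 5 * m : ℝ))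

/-- The kernel used to detect zeros. -/
noncomputable def zeroKernel (m : ℝ) (w : ℂ) (B C : ℝ) (g : ℂ → ℂ) (s : ℂ) : ℂ :=
  mixKernel m (poleKernel w B C g) s

/-- The cosine polynomial `(0.9 + cos θ)² (0.3 + cos θ)²` with `cos (k θ)` replaced by `f k`. -/
noncomputable def trigSum (f : ℝ → ℝ) : ℝ :=
  1.4379 * f 0 + 2.448 * f 1 + 1.49 * f 2 + 0.6 * f 3 + 0.125 * f 4

theorem trigSum_cos_nonneg (θ : ℝ) : 0 ≤ trigSum fun k => Real.cos (k * θ) := by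
  have h3 : Real.cos (3 * θ) = 4 * Real.cos θ ^ 3 - 3 * Real.cos θ := Real.cos_three_mul θ
  have h2 : Real.cos (2 * θ) = 2 * Real.cos θ ^ 2 - 1 := Real.cos_two_mul θ
  have h4 : Real.cos (4 * θ) = 2 * Real.cos (2 * θ) ^ 2 - 1 := by
    rw [← Real.cos_two_mul]; ring_nf
  have : trigSum (fun k => Real.cos (k * θ)) =
      ((0.9 + Real.cos θ) * (0.3 + Real.cos θ)) ^ 2 := by
    simp only [trigSum]
    rw [h4, h3, h2, zero_mul, Real.cos_zero, one_mul]
    ring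
  rw [this]; positivity

theorem one_sub_mul_exp_add_mul_exp_nonneg {u : ℝ} (hu : 0 ≤ u) :
    0 ≤ 1 - 27 / 25 * Real.exp (-(97 / 100 * u)) + 59 / 100 * Real.exp (-(7 / 5 * u)) := by
  have h1 : Real.exp (-(97 / 100 * u)) ^ 2 ≤ Real.exp (-(7 / 5 * u)) := by
    rw [← Real.exp_nat_mul]; apply Real.exp_le_exp.2; push_cast; linarith
  nlinarith [sq_nonneg (Real.exp (-(97 / 100 * u)) - 54 / 59)]

theorem HasSum.mixKernel {f : ℕ → ℂ → ℂ} {g : ℂ → ℂ} {m : ℝ} {s : ℂ}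
    (h : ∀ r : ℝ, 0 ≤ r → HasSum (fun n => f n (s + r)) (g (s + r))) (hm : 0 ≤ m) :
    HasSum (fun n => mixKernel m (f n) s) (mixKernel m g s) := by
  have h0 := h 0 le_rfl
  simp only [Complex.ofReal_zero, add_zero] at h0
  exact (h0.sub ((h _ (by positivity)).mul_left _)).add ((h _ (by positivity)).mul_left _)

theorem hasSum_zeroKernel {f : ℕ → ℂ → ℂ} {g : ℂ → ℂ} {m B C : ℝ} {w s : ℂ}
    (h : ∀ z : ℂ, 1 < z.re → HasSum (fun n => f n z) (g z)) (hm : 0 ≤ m) (hs : 1 < s.re + B) :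
    HasSum (fun n => zeroKernel m w B C (f n) s) (zeroKernel m w B C g s) := by
  refine HasSum.mixKernel (fun r hr => ?_) hm
  refine ((h _ ?_).add ((h _ ?_).mul_left _)).add ((h _ ?_).mul_left _) <;> simp <;> linarith

open ComplexConjugate in
theorem zeroKernel_exp (m : ℝ) (w : ℂ) (B C x : ℝ) (s : ℂ) :
    zeroKernel m w B C (fun z => Complex.exp (-z * x)) s = Complex.exp (-s * x) *
      (((1 - 27 / 25 * Real.exp (-(97 / 100 * (m * x))) + 59 / 100 * Real.exp (-(7 / 5 * (m * x)))) *
        (Real.exp (-B * x) * (1 + 2 * (w * Complex.exp (C * x * Complex.I)).re)) : ℝ) : ℂ) := by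
  have h1 : ((2 * (w * Complex.exp (C * x * Complex.I)).re : ℝ) : ℂ) =
      w * Complex.exp (C * x * Complex.I) + conj w * Complex.exp (-(C * x * Complex.I)) := by
    push_cast
    rw [Complex.re_eq_add_conj, map_mul, ← Complex.exp_conj]
    simp only [map_mul, Complex.conj_ofReal, Complex.conj_I]
    ring_nf
  have h2 : ∀ s : ℂ, poleKernel w B C (fun z => Complex.exp (-z * x)) s = Complex.exp (-s * x) *
      (Complex.exp (-B * x) * (1 + (2 * (w * Complex.exp (C * x * Complex.I)).re : ℝ))) := by
    intro s
    rw [h1, poleKernel]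
    have e1 : Complex.exp (-(s + B) * x) = Complex.exp (-s * x) * Complex.exp (-B * x) := by
      rw [← Complex.exp_add]; ring_nf
    have e2 : Complex.exp (-(s + B - C * Complex.I) * x) =
        Complex.exp (-s * x) * Complex.exp (-B * x) * Complex.exp (C * x * Complex.I) := by
      rw [← Complex.exp_add, ← Complex.exp_add]; ring_nf
    have e3 : Complex.exp (-(s + B + C * Complex.I) * x) =
        Complex.exp (-s * x) * Complex.exp (-B * x) * Complex.exp (-(C * x * Complex.I)) := by
      rw [← Complex.exp_add, ← Complex.exp_add]; ring_nf
    simp only [e1, e2, e3]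
    ring
  simp only [zeroKernel, mixKernel, h2]
  have e4 : ∀ r : ℝ, Complex.exp (-(s + (r * m : ℝ)) * x) =
      Complex.exp (-s * x) * (Real.exp (-(r * (m * x))) : ℝ) := by
    intro r; push_cast; rw [← Complex.exp_add]; ring_nf
  rw [e4, e4]
  push_cast
  ring

theorem zeroKernel_const_mul (m : ℝ) (w : ℂ) (B C : ℝ) (c : ℂ) (g : ℂ → ℂ) (s : ℂ) :
    zeroKernel m w B C (fun z => c * g z) s = c * zeroKernel m w B C g s := by
  simp only [zeroKernel, mixKernel, poleKernel]; ring

theorem hasSum_neg_logDeriv_riemannZeta {z : ℂ} (hz : 1 < z.re) :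
    HasSum (fun n : ℕ => (ArithmeticFunction.vonMangoldt n : ℂ) *
      Complex.exp (-z * Real.log n)) (-logDeriv riemannZeta z) := by
  have h := (ArithmeticFunction.LSeriesSummable_vonMangoldt hz).LSeriesHasSum
  rw [ArithmeticFunction.LSeries_vonMangoldt_eq_deriv_riemannZeta_div hz, neg_div,
    ← logDeriv_apply] at h
  refine h.congr_fun fun n => ?_
  rcases eq_or_ne n 0 with rfl | hn
  · simp
  · rw [LSeries.term_of_ne_zero hn, div_eq_mul_inv, ← Complex.cpow_neg,
      Complex.cpow_def_of_ne_zero (by exact_mod_cast hn), ← Complex.natCast_log, mul_comm (-z)]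

theorem trigSum_zeroKernel_neg_logDeriv_nonneg {m B C σ t : ℝ} {w : ℂ} (hm : 0 ≤ m)
    (hσ : 1 < σ + B) (hw : ‖w‖ ≤ 1 / 2) :
    0 ≤ trigSum fun k => (zeroKernel m w B C (fun z => -logDeriv riemannZeta z)
      (σ + (k * t : ℝ) * Complex.I)).re := by
  have hK : ∀ k : ℝ, HasSum (fun n : ℕ => ArithmeticFunction.vonMangoldt n *
      (Real.exp (-σ * Real.log n) *
      ((1 - 27 / 25 * Real.exp (-(97 / 100 * (m * Real.log n))) +
        59 / 100 * Real.exp (-(7 / 5 * (m * Real.log n)))) *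
        (Real.exp (-B * Real.log n) *
          (1 + 2 * (w * Complex.exp (C * Real.log n * Complex.I)).re)))) *
      Real.cos (k * (t * Real.log n)))
      (zeroKernel m w B C (fun z => -logDeriv riemannZeta z) (σ + (k * t : ℝ) * Complex.I)).re := by
    intro k
    have h := Complex.hasSum_re (hasSum_zeroKernel (w := w) (C := C) (B := B)
      (fun _ => hasSum_neg_logDeriv_riemannZeta) hm
      (s := σ + (k * t : ℝ) * Complex.I) (by simpa using hσ))
    refine h.congr_fun fun n => ?_
    rw [zeroKernel_const_mul, zeroKernel_exp, Complex.re_ofReal_mul,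
      Complex.re_mul_ofReal, Complex.exp_re]
    have e1 : (-(σ + (k * t : ℝ) * Complex.I) * Real.log n : ℂ).re = -σ * Real.log n := by
      rw [Complex.re_mul_ofReal]; simp
    have e2 : (-(σ + (k * t : ℝ) * Complex.I) * Real.log n : ℂ).im =
        -(k * (t * Real.log n)) := by
      rw [Complex.im_mul_ofReal]; simp; ring
    rw [e1, e2, Real.cos_neg]
    ring
  have h := ((((hK 0).mul_left 1.4379).add ((hK 1).mul_left 2.448)).add
    ((hK 2).mul_left 1.49)).add ((hK 3).mul_left 0.6) |>.add ((hK 4).mul_left 0.125)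
  refine h.nonneg fun n => ?_
  have hc := trigSum_cos_nonneg (t * Real.log n)
  have hlog : 0 ≤ Real.log n := Real.log_natCast_nonneg n
  have h1 := one_sub_mul_exp_add_mul_exp_nonneg (u := m * Real.log n) (by positivity)
  have h2 : 0 ≤ 1 + 2 * (w * Complex.exp (C * Real.log n * Complex.I)).re := by
    have h3 := (Complex.abs_re_le_norm (w * Complex.exp (C * Real.log n * Complex.I)))
    rw [norm_mul, ← Complex.ofReal_mul, Complex.norm_exp_ofReal_mul_I, mul_one] at h3
    have := (abs_le.1 (h3.trans hw)).1
    rw [Complex.ofReal_mul] at this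
    linarith
  have h4 := mul_nonneg (mul_nonneg (ArithmeticFunction.vonMangoldt_nonneg (n := n))
    (mul_nonneg (Real.exp_pos (-σ * Real.log n)).le (mul_nonneg h1
      (mul_nonneg (Real.exp_pos (-B * Real.log n)).le h2)))) hc
  refine h4.trans (le_of_eq ?_)
  simp only [trigSum]
  ring

theorem tendsto_log_add_sub_log_sub {A : ℂ} :
    Filter.Tendsto (fun v : ℝ => Complex.log (A + v * Complex.I) - Complex.log (A - v * Complex.I))
      Filter.atTop (nhds (Real.pi * Complex.I)) := by
  have h0 : Filter.Tendsto (fun v : ℝ => A / (v : ℂ)) Filter.atTop (nhds 0) := by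
    have : Filter.Tendsto (fun v : ℝ => ((v⁻¹ : ℝ) : ℂ)) Filter.atTop (nhds ((0 : ℝ) : ℂ)) :=
      (Complex.continuous_ofReal.tendsto 0).comp tendsto_inv_atTop_zero
    have h := this.const_mul A
    simpa [div_eq_mul_inv] using h
  have h1 : Filter.Tendsto (fun v : ℝ => Complex.log (A / v + Complex.I) -
      Complex.log (A / v - Complex.I)) Filter.atTop
      (nhds (Complex.log (0 + Complex.I) - Complex.log (0 - Complex.I))) :=
    ((h0.add_const _).clog (by simp [Complex.slitPlane])).sub
      ((h0.sub_const _).clog (by simp [Complex.slitPlane]))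
  have h2 : Complex.log (0 + Complex.I) - Complex.log (0 - Complex.I) = Real.pi * Complex.I := by
    rw [zero_add, zero_sub, Complex.log_I, Complex.log_neg_I]; ring
  rw [h2] at h1
  have hI : ∀ᶠ v : ℝ in Filter.atTop, A / v + Complex.I ≠ 0 := by
    have := h0.add_const Complex.I
    rw [zero_add] at this
    exact this.eventually_ne Complex.I_ne_zero
  have hI' : ∀ᶠ v : ℝ in Filter.atTop, A / v - Complex.I ≠ 0 := by
    have := h0.sub_const Complex.I
    rw [zero_sub] at this
    exact this.eventually_ne (neg_ne_zero.2 Complex.I_ne_zero)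
  refine h1.congr' ?_
  filter_upwards [Filter.eventually_gt_atTop 0, hI, hI'] with v hv ha hb
  have hv' : (v : ℂ) ≠ 0 := by exact_mod_cast hv.ne'
  rw [show A + v * Complex.I = (v : ℂ) * (A / v + Complex.I) by field_simp,
    show A - v * Complex.I = (v : ℂ) * (A / v - Complex.I) by field_simp,
    Complex.log_ofReal_mul hv ha, Complex.log_ofReal_mul hv hb]
  ring

theorem add_mul_I_ne_zero_of_re_pos {A : ℂ} (hA : 0 < A.re) (v : ℝ) : A + v * Complex.I ≠ 0 := by
  intro h
  have := congrArg Complex.re h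
  simp at this
  exact hA.ne' this

theorem sq_add_sq_ne_zero_of_re_pos {A : ℂ} (hA : 0 < A.re) (v : ℝ) : A ^ 2 + (v : ℂ) ^ 2 ≠ 0 := by
  have h1 := add_mul_I_ne_zero_of_re_pos hA v
  have h2 := add_mul_I_ne_zero_of_re_pos hA (-v)
  have : A ^ 2 + (v : ℂ) ^ 2 = (A + v * Complex.I) * (A + (-v : ℝ) * Complex.I) := by
    push_cast
    linear_combination (v : ℂ) ^ 2 * Complex.I_sq
  rw [this]; exact mul_ne_zero h1 h2

theorem integrable_div_sq_add_sq {A : ℂ} (hA : 0 < A.re) :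
    Integrable (fun v : ℝ => A / (A ^ 2 + (v : ℂ) ^ 2)) := by
  set c := 1 + (1 + ‖A‖) / A.re with hc
  have hcpos : 0 < c := by positivity
  have key : ∀ v : ℝ, 1 + |v| ≤ c * ‖A + v * Complex.I‖ := by
    intro v
    have h1 : A.re ≤ ‖A + v * Complex.I‖ := by
      have := Complex.re_le_norm (A + v * Complex.I); simpa using this
    have h2 : |v| ≤ ‖A + v * Complex.I‖ + ‖A‖ := by
      have := norm_sub_le (A + v * Complex.I) A
      simpa using this
    have h3 : 1 + ‖A‖ ≤ (1 + ‖A‖) / A.re * ‖A + v * Complex.I‖ := by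
      rw [div_mul_eq_mul_div, le_div_iff₀ hA]
      gcongr
    rw [hc, add_mul]; linarith
  have hint := (integrable_inv_one_add_sq).const_mul (‖A‖ * c ^ 2)
  refine hint.mono' ?_ (ae_of_all _ fun v => ?_)
  · refine Continuous.aestronglyMeasurable ?_
    exact Continuous.div continuous_const (by fun_prop) (sq_add_sq_ne_zero_of_re_pos hA)
  · have h1 := key v
    have h2 := key (-v)
    rw [abs_neg] at h2
    have e : A ^ 2 + (v : ℂ) ^ 2 = (A + v * Complex.I) * (A + (-v : ℝ) * Complex.I) := by
      push_cast
      linear_combination (v : ℂ) ^ 2 * Complex.I_sq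
    have h3 : 1 + v ^ 2 ≤ c ^ 2 * ‖A ^ 2 + (v : ℂ) ^ 2‖ := by
      rw [e, norm_mul]
      have := mul_le_mul h1 h2 (by positivity) (by positivity)
      nlinarith [abs_nonneg v, sq_abs v]
    rw [norm_div, div_eq_mul_inv, mul_assoc]
    have h4 : 0 < ‖A ^ 2 + (v : ℂ) ^ 2‖ := norm_pos_iff.2 (sq_add_sq_ne_zero_of_re_pos hA v)
    gcongr
    rw [inv_eq_one_div, div_le_iff₀ h4, mul_right_comm, ← div_eq_mul_inv, le_div_iff₀ (by positivity)]
    linarith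

theorem integral_div_sq_add_sq_of_re_pos {A : ℂ} (hA : 0 < A.re) :
    ∫ v : ℝ, A / (A ^ 2 + (v : ℂ) ^ 2) = Real.pi := by
  set L : ℝ → ℂ := fun v => (Complex.log (A + v * Complex.I) - Complex.log (A - v * Complex.I)) /
    (2 * Complex.I) with hL
  have hd : ∀ v : ℝ, HasDerivAt L (A / (A ^ 2 + (v : ℂ) ^ 2)) v := by
    intro v
    have h1 := add_mul_I_ne_zero_of_re_pos hA v
    have h2 : A - v * Complex.I ≠ 0 := by
      have := add_mul_I_ne_zero_of_re_pos hA (-v); push_cast at this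
      rwa [neg_mul, ← sub_eq_add_neg] at this
    have hv : HasDerivAt (fun v : ℝ => (v : ℂ) * Complex.I) (1 * Complex.I) v :=
      (Complex.ofRealCLM.hasDerivAt (x := v)).mul_const _
    have d1 := (hv.const_add A).clog_real (by left; simpa using hA)
    have d2 := (hv.const_sub A).clog_real (by left; simpa using hA)
    refine ((d1.sub d2).div_const (2 * Complex.I)).congr_deriv ?_
    have h3 := sq_add_sq_ne_zero_of_re_pos hA v
    have hI := Complex.I_ne_zero
    have e : A ^ 2 + (v : ℂ) ^ 2 = (A + v * Complex.I) * (A - v * Complex.I) := by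
      linear_combination (v : ℂ) ^ 2 * Complex.I_sq
    rw [e, neg_div, sub_neg_eq_add, div_add_div _ _ h1 h2, div_div, div_eq_div_iff
      (mul_ne_zero (mul_ne_zero h1 h2) (mul_ne_zero two_ne_zero hI)) (mul_ne_zero h1 h2)]
    ring
  have hodd : ∀ v, L (-v) = -L v := by
    intro v; simp only [hL]; push_cast; rw [neg_mul, sub_neg_eq_add, ← sub_eq_add_neg]; ring
  have ht : Filter.Tendsto L Filter.atTop (nhds (Real.pi * Complex.I / (2 * Complex.I))) :=
    tendsto_log_add_sub_log_sub.div_const _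
  have hb : Filter.Tendsto L Filter.atBot (nhds (-(Real.pi * Complex.I / (2 * Complex.I)))) := by
    have := (ht.comp Filter.tendsto_neg_atBot_atTop).neg
    refine this.congr fun v => ?_
    simp [hodd]
  rw [integral_of_hasDerivAt_of_tendsto hd (integrable_div_sq_add_sq hA) hb ht]
  have hI := Complex.I_ne_zero
  field_simp
  ring

theorem integrable_and_integral_poisson {A : ℂ} {d : ℝ} (hA : 0 < A.re) (hd : A.re < d) :
    Integrable (fun v : ℝ => ((d / (d ^ 2 + v ^ 2) : ℝ) : ℂ) * (A / (A ^ 2 + (v : ℂ) ^ 2))) ∧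
    ∫ v : ℝ, ((d / (d ^ 2 + v ^ 2) : ℝ) : ℂ) * (A / (A ^ 2 + (v : ℂ) ^ 2)) =
      Real.pi * (A + d)⁻¹ := by
  have hd' : 0 < (d : ℂ).re := by simpa using hA.trans hd
  have h1 : A + d ≠ 0 := by
    intro h; have := congrArg Complex.re h; simp at this; linarith
  have h2 : A - d ≠ 0 := by
    intro h; have := congrArg Complex.re h; simp at this; linarith
  have e : (fun v : ℝ => ((d / (d ^ 2 + v ^ 2) : ℝ) : ℂ) * (A / (A ^ 2 + (v : ℂ) ^ 2))) =
      fun v : ℝ => (A * ((d : ℂ) / ((d : ℂ) ^ 2 + (v : ℂ) ^ 2)) -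
        d * (A / (A ^ 2 + (v : ℂ) ^ 2))) / ((A - d) * (A + d)) := by
    ext v
    have h3 := sq_add_sq_ne_zero_of_re_pos hA v
    have h4 := sq_add_sq_ne_zero_of_re_pos hd' v
    push_cast
    field_simp
    ring
  have i1 := (integrable_div_sq_add_sq hd').const_mul A
  have i2 := (integrable_div_sq_add_sq hA).const_mul (d : ℂ)
  rw [e]
  refine ⟨(i1.sub i2).div_const _, ?_⟩
  rw [integral_div, integral_sub i1 i2, integral_const_mul, integral_const_mul,
    integral_div_sq_add_sq_of_re_pos hd', integral_div_sq_add_sq_of_re_pos hA]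
  field_simp

theorem sum_poleKernel_inv_re_nonneg {ι : Type*} (S : Finset ι) (κ d : ι → ℝ) {w : ℂ} {B C : ℝ}
    (hB : 0 < B) (hd : ∀ i ∈ S, B < d i)
    (hk : ∀ v : ℝ, 0 ≤ ∑ i ∈ S, κ i * (d i / (d i ^ 2 + v ^ 2)))
    (hF : ∀ u : ℝ, 0 ≤ (poleKernel w B C (fun z => z⁻¹) (u * Complex.I)).re) (y : ℝ) :
    0 ≤ ∑ i ∈ S, κ i * (poleKernel w B C (fun z => z⁻¹) (d i + y * Complex.I)).re := by
  set G : ℂ → ℝ → ℂ := fun A v => A / (A ^ 2 + (v : ℂ) ^ 2) with hG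
  set s : ℂ := y * Complex.I with hs
  set T : ℝ → ℂ := fun v => poleKernel w B C (fun A => G A v) s with hT
  have hre : ∀ x : ℝ, (s + B).re = B ∧ (s + B - C * Complex.I).re = B ∧
      (s + B + C * Complex.I).re = B := by intro x; simp [hs]
  have hpos : ∀ v, 0 ≤ (T v).re := by
    intro v
    have e : T v = (poleKernel w B C (fun z => z⁻¹) ((y + v : ℝ) * Complex.I) +
        poleKernel w B C (fun z => z⁻¹) ((y - v : ℝ) * Complex.I)) / 2 := by
      have key : ∀ A : ℂ, 0 < A.re → G A v =
          ((A + v * Complex.I)⁻¹ + (A - v * Complex.I)⁻¹) / 2 := by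
        intro A hA
        have h1 := add_mul_I_ne_zero_of_re_pos hA v
        have h2 : A - v * Complex.I ≠ 0 := by
          have := add_mul_I_ne_zero_of_re_pos hA (-v); push_cast at this
          rwa [neg_mul, ← sub_eq_add_neg] at this
        have e : A ^ 2 + (v : ℂ) ^ 2 = (A + v * Complex.I) * (A - v * Complex.I) := by
          linear_combination (v : ℂ) ^ 2 * Complex.I_sq
        simp only [hG]
        rw [e]; field_simp; ring
      simp only [hT, poleKernel]
      rw [key _ (by simpa [hs] using hB), key _ (by simpa [hs] using hB),
        key _ (by simpa [hs] using hB), hs]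
      push_cast
      ring_nf
    rw [e, show (2 : ℂ) = ((2 : ℝ) : ℂ) by norm_num, Complex.div_ofReal_re, Complex.add_re]
    have h1 := hF (y + v)
    have h2 := hF (y - v)
    positivity
  have hint : ∀ i ∈ S, Integrable (fun v : ℝ => ((d i / (d i ^ 2 + v ^ 2) : ℝ) : ℂ) * T v) ∧
      ∫ v : ℝ, ((d i / (d i ^ 2 + v ^ 2) : ℝ) : ℂ) * T v =
        Real.pi * poleKernel w B C (fun z => z⁻¹) (d i + y * Complex.I) := by
    intro i hi
    have p1 := integrable_and_integral_poisson (A := s + B) (d := d i) (by simpa [hs] using hB)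
      (by simpa [hs] using hd i hi)
    have p2 := integrable_and_integral_poisson (A := s + B - C * Complex.I) (d := d i)
      (by simpa [hs] using hB) (by simpa [hs] using hd i hi)
    have p3 := integrable_and_integral_poisson (A := s + B + C * Complex.I) (d := d i)
      (by simpa [hs] using hB) (by simpa [hs] using hd i hi)
    have e : (fun v : ℝ => ((d i / (d i ^ 2 + v ^ 2) : ℝ) : ℂ) * T v) = fun v : ℝ =>
        ((d i / (d i ^ 2 + v ^ 2) : ℝ) : ℂ) * G (s + B) v +
        w * (((d i / (d i ^ 2 + v ^ 2) : ℝ) : ℂ) * G (s + B - C * Complex.I) v) +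
        (starRingEnd ℂ) w * (((d i / (d i ^ 2 + v ^ 2) : ℝ) : ℂ) * G (s + B + C * Complex.I) v) := by
      ext v; simp only [hT, poleKernel]; ring
    have q1 := p1.1
    have q2 := p2.1.const_mul w
    have q3 := p3.1.const_mul ((starRingEnd ℂ) w)
    rw [e]
    refine ⟨(q1.add q2).add q3, ?_⟩
    have r := integral_add (q1.add q2) q3
    have r' := integral_add q1 q2
    simp only [Pi.add_apply] at r
    simp only [hG]
    rw [r, r', integral_const_mul, integral_const_mul, p1.2, p2.2, p3.2, poleKernel, hs]
    ring_nf
  have hsum : ∫ v : ℝ, (∑ i ∈ S, κ i * (d i / (d i ^ 2 + v ^ 2))) * (T v).re =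
      Real.pi * ∑ i ∈ S, κ i * (poleKernel w B C (fun z => z⁻¹) (d i + y * Complex.I)).re := by
    have e : ∀ v : ℝ, (∑ i ∈ S, κ i * (d i / (d i ^ 2 + v ^ 2))) * (T v).re =
        ∑ i ∈ S, κ i * (((d i / (d i ^ 2 + v ^ 2) : ℝ) : ℂ) * T v).re := by
      intro v
      rw [Finset.sum_mul]
      refine Finset.sum_congr rfl fun i _ => ?_
      rw [Complex.re_ofReal_mul]; ring
    simp_rw [e]
    have hi : ∀ i ∈ S, Integrable fun v : ℝ =>
        κ i * (((d i / (d i ^ 2 + v ^ 2) : ℝ) : ℂ) * T v).re :=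
      fun i hi => ((hint i hi).1.re).const_mul (κ i)
    rw [integral_finsetSum _ hi, Finset.mul_sum]
    refine Finset.sum_congr rfl fun i hi => ?_
    have h1 := integral_re (hint i hi).1
    have h2 : ∫ v : ℝ, κ i * (((d i / (d i ^ 2 + v ^ 2) : ℝ) : ℂ) * T v).re =
        κ i * ∫ v : ℝ, (((d i / (d i ^ 2 + v ^ 2) : ℝ) : ℂ) * T v).re := integral_const_mul _ _
    rw [h2]
    simp only [RCLike.re_to_complex] at h1
    rw [h1, (hint i hi).2, Complex.re_ofReal_mul]; ring
  have h0 : 0 ≤ ∫ v : ℝ, (∑ i ∈ S, κ i * (d i / (d i ^ 2 + v ^ 2))) * (T v).re :=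
    integral_nonneg fun v => mul_nonneg (hk v) (hpos v)
  rw [hsum] at h0
  exact nonneg_of_mul_nonneg_right h0 Real.pi_pos

theorem sum_poisson_kernel_nonneg {m : ℝ} (hm : 0 < m) (v : ℝ) :
    0 ≤ ∑ i : Fin 5, (![1, -(27 / 25), -(27 / 25), 59 / 100, 59 / 100] : Fin 5 → ℝ) i *
      ((![m, 97 / 100 * m, 197 / 100 * m, 7 / 5 * m, 12 / 5 * m] : Fin 5 → ℝ) i /
        ((![m, 97 / 100 * m, 197 / 100 * m, 7 / 5 * m, 12 / 5 * m] : Fin 5 → ℝ) i ^ 2 + v ^ 2)) := by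
  rw [Fin.sum_univ_five]
  simp only [Matrix.cons_val]
  obtain ⟨u, rfl⟩ : ∃ u, v = u * m := ⟨v / m, by field_simp⟩
  have key : ∀ d : ℝ, d * m / ((d * m) ^ 2 + (u * m) ^ 2) = d / (d ^ 2 + u ^ 2) * m⁻¹ := by
    intro d; rw [show (d * m) ^ 2 + (u * m) ^ 2 = (d ^ 2 + u ^ 2) * (m * m) by ring]
    rw [mul_div_mul_comm, div_mul_cancel_left₀ hm.ne']
  have h1 := key 1
  rw [one_mul] at h1
  rw [h1, key, key, key, key]
  set Y := u ^ 2 with hY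
  have hY0 : 0 ≤ Y := by positivity
  have e : 1 * (1 / (1 ^ 2 + Y) * m⁻¹) + -(27 / 25) * (97 / 100 / ((97 / 100) ^ 2 + Y) * m⁻¹) +
      -(27 / 25) * (197 / 100 / ((197 / 100) ^ 2 + Y) * m⁻¹) +
      59 / 100 * (7 / 5 / ((7 / 5) ^ 2 + Y) * m⁻¹) + 59 / 100 * (12 / 5 / ((12 / 5) ^ 2 + Y) * m⁻¹) =
      (232361098435200 / 10 ^ 15 + 3456211220679200 / 10 ^ 15 * Y +
        1751186508420000 / 10 ^ 15 * Y ^ 2 - 62783808 / 10 ^ 8 * Y ^ 3 + 668 / 10 ^ 4 * Y ^ 4) /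
      ((1 ^ 2 + Y) * ((97 / 100) ^ 2 + Y) * ((197 / 100) ^ 2 + Y) * ((7 / 5) ^ 2 + Y) *
        ((12 / 5) ^ 2 + Y)) * m⁻¹ := by
    field_simp
    ring
  rw [e]
  have : 0 ≤ 232361098435200 / 10 ^ 15 + 3456211220679200 / 10 ^ 15 * Y +
        1751186508420000 / 10 ^ 15 * Y ^ 2 - 62783808 / 10 ^ 8 * Y ^ 3 + 668 / 10 ^ 4 * Y ^ 4 := by
    have h2 : 0 ≤ 668 / 10 ^ 4 * Y ^ 2 - 62783808 / 10 ^ 8 * Y + 1751186508420000 / 10 ^ 15 := by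
      nlinarith [sq_nonneg (Y - 47 / 10)]
    nlinarith [mul_nonneg (sq_nonneg Y) h2]
  positivity

/-- The kernel `1 / (z + B) + w / (z + B - iC) + conj w / (z + B + iC)`. -/
noncomputable abbrev poleInv (w : ℂ) (B C : ℝ) (z : ℂ) : ℂ := poleKernel w B C (fun z => z⁻¹) z

/-- The kernel `poleInv` mixed along three translates. -/
noncomputable abbrev zeroInv (m : ℝ) (w : ℂ) (B C : ℝ) (z : ℂ) : ℂ :=
  zeroKernel m w B C (fun z => z⁻¹) z

theorem translates_re_nonneg {m B C : ℝ} {w : ℂ} (hB : 0 < B) (hm : B < 97 / 100 * m)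
    (hF : ∀ u : ℝ, 0 ≤ (poleInv w B C (u * Complex.I)).re) (y : ℝ) :
    0 ≤ (zeroInv m w B C (y * Complex.I)).re + (zeroInv m w B C (m + y * Complex.I)).re -
      (poleInv w B C (y * Complex.I)).re := by
  have hm0 : 0 < m := by linarith
  have h := sum_poleKernel_inv_re_nonneg (w := w) (C := C) (Finset.univ : Finset (Fin 5))
    ![1, -(27 / 25), -(27 / 25), 59 / 100, 59 / 100]
    ![m, 97 / 100 * m, 197 / 100 * m, 7 / 5 * m, 12 / 5 * m] hB
    (by
      intro i _
      fin_cases i <;> simp <;> linarith)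
    (fun v => sum_poisson_kernel_nonneg hm0 v) hF y
  rw [Fin.sum_univ_five] at h
  simp only [Matrix.cons_val] at h
  refine h.trans (le_of_eq ?_)
  have e1 : (m : ℂ) + y * Complex.I + (97 / 100 * m : ℝ) = (197 / 100 * m : ℝ) + y * Complex.I := by
    push_cast; ring
  have e2 : (m : ℂ) + y * Complex.I + (7 / 5 * m : ℝ) = (12 / 5 * m : ℝ) + y * Complex.I := by
    push_cast; ring
  have c1 : (27 / 25 : ℂ) = ((27 / 25 : ℝ) : ℂ) := by norm_num
  have c2 : (59 / 100 : ℂ) = ((59 / 100 : ℝ) : ℂ) := by norm_num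
  simp only [zeroInv, poleInv, zeroKernel, mixKernel, e1, e2]
  rw [add_comm ((y : ℂ) * Complex.I) ((97 / 100 * m : ℝ) : ℂ),
    add_comm ((y : ℂ) * Complex.I) ((7 / 5 * m : ℝ) : ℂ), c1, c2]
  simp only [Complex.add_re, Complex.sub_re, Complex.re_ofReal_mul]
  ring

theorem norm_poleInv_le {w z : ℂ} {B C : ℝ} (hB : 0 < B) (hz : 0 ≤ z.re) :
    ‖poleInv w B C z‖ ≤ (1 + 2 * ‖w‖) / B := by
  have key : ∀ A : ℂ, B ≤ A.re → ‖A⁻¹‖ ≤ B⁻¹ := by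
    intro A hA
    rw [norm_inv]
    exact inv_anti₀ hB (hA.trans (Complex.re_le_norm A))
  have h1 := key (z + B) (by simpa using hz)
  have h2 := key (z + B - C * Complex.I) (by simpa using hz)
  have h3 := key (z + B + C * Complex.I) (by simpa using hz)
  refine (norm_add₃_le).trans ?_
  rw [norm_mul, norm_mul, Complex.norm_conj]
  have := mul_le_mul_of_nonneg_left h2 (norm_nonneg w)
  have := mul_le_mul_of_nonneg_left h3 (norm_nonneg w)
  rw [div_eq_mul_inv]; linarith

theorem norm_zeroInv_le {w z : ℂ} {m B C : ℝ} (hB : 0 < B) (hm : 0 ≤ m) (hz : 0 ≤ z.re) :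
    ‖zeroInv m w B C z‖ ≤ 3 * ((1 + 2 * ‖w‖) / B) := by
  have h1 := norm_poleInv_le (w := w) (C := C) hB hz
  have h2 := norm_poleInv_le (w := w) (C := C) (z := z + (97 / 100 * m : ℝ)) hB
    (by rw [Complex.add_re, Complex.ofReal_re]; positivity)
  have h3 := norm_poleInv_le (w := w) (C := C) (z := z + (7 / 5 * m : ℝ)) hB
    (by rw [Complex.add_re, Complex.ofReal_re]; positivity)
  refine (norm_add_le _ _).trans ((add_le_add (norm_sub_le _ _) le_rfl).trans ?_)
  have c1 : ‖(27 / 25 : ℂ)‖ = 27 / 25 := by norm_num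
  have c2 : ‖(59 / 100 : ℂ)‖ = 59 / 100 := by norm_num
  have h0 : 0 ≤ (1 + 2 * ‖w‖) / B := by positivity
  rw [norm_mul, norm_mul, c1, c2]
  linarith

open ComplexConjugate in
theorem zeroInv_conj (m : ℝ) (w : ℂ) (B C : ℝ) (z : ℂ) :
    zeroInv m w B C (conj z) = conj (zeroInv m w B C z) := by
  have key : ∀ z, poleInv w B C (conj z) = conj (poleInv w B C z) := by
    intro z
    simp only [poleInv, poleKernel, map_add, map_mul, map_inv₀, Complex.conj_conj, map_sub,
      Complex.conj_ofReal, Complex.conj_I]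
    ring_nf
  have e : ∀ r : ℝ, conj z + r = conj (z + r) := by simp
  have c1 : conj (27 / 25 : ℂ) = 27 / 25 := by rw [map_div₀, map_ofNat, map_ofNat]
  have c2 : conj (59 / 100 : ℂ) = 59 / 100 := by rw [map_div₀, map_ofNat, map_ofNat]
  have h : ∀ a b c : ℂ, conj (a - 27 / 25 * b + 59 / 100 * c) =
      conj a - 27 / 25 * conj b + 59 / 100 * conj c := by
    intro a b c
    rw [map_add, map_sub, map_mul, map_mul, c1, c2]
  refine Eq.trans ?_ (h (poleInv w B C z) (poleInv w B C (z + (97 / 100 * m : ℝ)))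
    (poleInv w B C (z + (7 / 5 * m : ℝ)))).symm
  rw [← key, ← key, ← key, ← e, ← e]
  rfl

theorem differentiableAt_poleInv {w z : ℂ} {B C : ℝ} (hz : 0 < z.re + B) :
    DifferentiableAt ℂ (poleInv w B C) z := by
  have key : ∀ A : ℂ, 0 < A.re → A ≠ 0 := by rintro A hA rfl; simp at hA
  have h1 := key (z + B) (by simpa using hz)
  have h2 := key (z + B - C * Complex.I) (by simpa using hz)
  have h3 := key (z + B + C * Complex.I) (by simpa using hz)
  unfold poleInv poleKernel
  fun_prop (disch := assumption)

theorem differentiableAt_zeroInv {w z : ℂ} {m B C : ℝ} (hm : 0 ≤ m) (hz : 0 < z.re + B) :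
    DifferentiableAt ℂ (zeroInv m w B C) z := by
  have key : ∀ r : ℝ, 0 ≤ r → DifferentiableAt ℂ (fun z => poleInv w B C (z + r)) z := by
    intro r hr
    exact DifferentiableAt.comp z (f := fun z : ℂ => z + r) (g := poleInv w B C)
      (differentiableAt_poleInv (by simp; linarith)) (by fun_prop)
  unfold zeroInv zeroKernel mixKernel
  exact ((differentiableAt_poleInv hz).sub ((key _ (by positivity)).const_mul _)).add
    ((key _ (by positivity)).const_mul _)

theorem zeroInv_add_re_nonneg {m B C : ℝ} {w z : ℂ} (hB : 0 < B) (hm : B < 97 / 100 * m)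
    (hF : ∀ u : ℝ, 0 ≤ (poleInv w B C (u * Complex.I)).re) (h0 : 0 ≤ z.re) (h1 : z.re ≤ m) :
    0 ≤ (zeroInv m w B C z + zeroInv m w B C (m - z)).re := by
  have hm0 : 0 < m := by linarith
  set q : ℂ → ℂ := fun z => zeroInv m w B C z + zeroInv m w B C (m - z) with hq
  have hb : ∀ z : ℂ, 0 ≤ z.re → z.re ≤ m → ‖q z‖ ≤ 6 * ((1 + 2 * ‖w‖) / B) := by
    intro z h0 h1
    have b1 := norm_zeroInv_le (w := w) (C := C) hB hm0.le h0
    have b2 := norm_zeroInv_le (w := w) (C := C) (z := m - z) hB hm0.le (by simpa using h1)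
    refine (norm_add_le _ _).trans ?_
    linarith
  have hdiff : ∀ z : ℂ, 0 ≤ z.re → z.re ≤ m → DifferentiableAt ℂ q z := by
    intro z h0 h1
    refine (differentiableAt_zeroInv hm0.le (by linarith)).add ?_
    exact DifferentiableAt.comp z (f := fun z : ℂ => m - z) (g := zeroInv m w B C)
      (differentiableAt_zeroInv hm0.le (by simp; linarith)) (by fun_prop)
  have hbd : ∀ z : ℂ, z.re = 0 → ‖Complex.exp (-q z)‖ ≤ 1 := by
    intro z hz
    have ez : z = z.im * Complex.I := by
      apply Complex.ext <;> simp [hz]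
    have ec : (m : ℂ) - z = (starRingEnd ℂ) (m + z.im * Complex.I) := by
      apply Complex.ext <;> simp [hz]
    rw [Complex.norm_exp, Complex.neg_re, Real.exp_le_one_iff, neg_nonpos]
    have h2 := translates_re_nonneg hB hm hF z.im
    have h3 := hF z.im
    simp only [hq]
    rw [ec, zeroInv_conj, Complex.add_re, Complex.conj_re]
    rw [← ez] at h2 h3
    rw [← ez]
    linarith
  have hle : ‖Complex.exp (-q z)‖ ≤ 1 := by
    refine PhragmenLindelof.vertical_strip (a := 0) (b := m) (f := fun z => Complex.exp (-q z))
      ?_ ?_ hbd ?_ h0 h1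
    · refine DifferentiableOn.diffContOnCl fun z hz => ?_
      have hz' : 0 ≤ z.re ∧ z.re ≤ m := by
        have hsub : closure (Complex.re ⁻¹' Set.Ioo 0 m) ⊆ Complex.re ⁻¹' Set.Icc 0 m :=
          closure_minimal (Set.preimage_mono Set.Ioo_subset_Icc_self)
            (isClosed_Icc.preimage Complex.continuous_re)
        exact hsub hz
      exact (hdiff z hz'.1 hz'.2).neg.cexp.differentiableWithinAt
    · refine ⟨0, by positivity, 6 * ((1 + 2 * ‖w‖) / B), ?_⟩
      refine Asymptotics.IsBigO.of_bound 1 ?_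
      refine Filter.eventually_inf_principal.2 (Filter.Eventually.of_forall fun z hz => ?_)
      rw [zero_mul, Real.exp_zero, mul_one, one_mul, Real.norm_of_nonneg (Real.exp_pos _).le,
        Complex.norm_exp, Real.exp_le_exp]
      refine (Complex.re_le_norm _).trans ?_
      rw [norm_neg]
      exact hb z hz.1.le hz.2.le
    · intro z hz
      have : q z = q (m - z) := by simp only [hq]; rw [sub_sub_cancel, add_comm]
      rw [this]
      exact hbd _ (by simp [hz])
  rw [Complex.norm_exp, Complex.neg_re, Real.exp_le_one_iff] at hle
  linarith

theorem zeroKernel_congr {g h : ℂ → ℂ} {m B C : ℝ} {w s : ℂ}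
    (hgh : ∀ z : ℂ, 1 < z.re → g z = h z) (hm : 0 ≤ m) (hs : 1 < s.re + B) :
    zeroKernel m w B C g s = zeroKernel m w B C h s := by
  have key : ∀ z : ℂ, 1 < z.re + B → poleKernel w B C g z = poleKernel w B C h z := by
    intro z hz
    simp only [poleKernel]
    rw [hgh (z + B), hgh (z + B - C * Complex.I), hgh (z + B + C * Complex.I)] <;> simpa using hz
  simp only [zeroKernel, mixKernel]
  rw [key s hs, key (s + (97 / 100 * m : ℝ)), key (s + (7 / 5 * m : ℝ))] <;>
    rw [Complex.add_re, Complex.ofReal_re] <;> linarith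

theorem zeroKernel_sub (m B C : ℝ) (w s : ℂ) (g h : ℂ → ℂ) :
    zeroKernel m w B C (fun z => g z - h z) s = zeroKernel m w B C g s - zeroKernel m w B C h s := by
  simp only [zeroKernel, mixKernel, poleKernel]; ring

theorem zeroKernel_add (m B C : ℝ) (w s : ℂ) (g h : ℂ → ℂ) :
    zeroKernel m w B C (fun z => g z + h z) s = zeroKernel m w B C g s + zeroKernel m w B C h s := by
  simp only [zeroKernel, mixKernel, poleKernel]; ring

theorem zeroKernel_sum_inv {ι : Type*} (S : Finset ι) (c : ι → ℂ) (ρ : ι → ℂ) (m B C : ℝ) (w s : ℂ) :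
    zeroKernel m w B C (fun z => ∑ i ∈ S, c i / (z - ρ i)) s =
      ∑ i ∈ S, c i * zeroInv m w B C (s - ρ i) := by
  classical
  induction S using Finset.induction_on with
  | empty => simp [zeroKernel, mixKernel, poleKernel]
  | insert i S hi ih =>
    simp only [Finset.sum_insert hi]
    rw [zeroKernel_add, ih]
    congr 1
    rw [show zeroInv m w B C (s - ρ i) = zeroKernel m w B C (fun z => z⁻¹) (s - ρ i) from rfl,
      ← zeroKernel_const_mul]
    simp only [zeroKernel, mixKernel, poleKernel, div_eq_mul_inv]
    ring_nf

theorem Tendsto.zeroKernel {ι : Type*} {l : Filter ι} {G : ι → ℂ → ℂ} {g : ℂ → ℂ} {m B C : ℝ}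
    {w s : ℂ} (h : ∀ z : ℂ, 1 < z.re → Filter.Tendsto (fun n => G n z) l (nhds (g z)))
    (hm : 0 ≤ m) (hs : 1 < s.re + B) :
    Filter.Tendsto (fun n => zeroKernel m w B C (G n) s) l (nhds (zeroKernel m w B C g s)) := by
  have key : ∀ z : ℂ, 1 < z.re + B →
      Filter.Tendsto (fun n => poleKernel w B C (G n) z) l (nhds (poleKernel w B C g z)) := by
    intro z hz
    refine ((h _ ?_).add ((h _ ?_).const_mul _)).add ((h _ ?_).const_mul _) <;> simpa using hz
  refine ((key s hs).sub ((key _ ?_).const_mul _)).add ((key _ ?_).const_mul _) <;>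
    rw [Complex.add_re, Complex.ofReal_re] <;> linarith

open ComplexConjugate in
theorem tendsto_sum_zeroInv {m B C : ℝ} {w s : ℂ} (hm : 0 ≤ m) (hs : 1 < s.re + B) :
    Filter.Tendsto (fun N : ℝ => ∑ ρ ∈ xiZeros N, (xiOrder ρ : ℂ) *
      (zeroInv m w B C (s - ρ) + zeroInv m w B C (s - (1 - conj ρ)))) Filter.atTop
      (nhds (2 * zeroKernel m w B C (logDeriv entireXi) s)) := by
  have hX : ∀ z : ℂ, 1 < z.re → entireXi z ≠ 0 := fun z hz => entireXi_ne_zero_of_one_le_re hz.le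
  have h1 := Tendsto.zeroKernel (w := w) (C := C) (fun z hz => tendsto_sum_xiZeros (hX z hz)) hm hs
  have h2 := Tendsto.zeroKernel (w := w) (C := C)
    (fun z hz => tendsto_sum_xiZeros_mirror (hX z hz)) hm hs
  rw [two_mul]
  refine (h1.add h2).congr fun N => ?_
  rw [zeroKernel_sum_inv, zeroKernel_sum_inv, ← Finset.sum_add_distrib]
  simp only [mul_add]

/-- The contribution of a zero and its mirror image. -/
noncomputable abbrev zeroPair (m : ℝ) (w : ℂ) (B C : ℝ) (z : ℂ) : ℝ :=
  (zeroInv m w B C z + zeroInv m w B C (m - z)).re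

open ComplexConjugate in
theorem zeroPair_eq (m : ℝ) (w : ℂ) (B C : ℝ) {s ρ : ℂ} (hs : 2 * s.re = 1 + m) :
    (zeroInv m w B C (s - ρ) + zeroInv m w B C (s - (1 - conj ρ))).re =
      zeroPair m w B C (s - ρ) := by
  have : s - (1 - conj ρ) = conj (m - (s - ρ)) := by
    apply Complex.ext
    · simp; linarith
    · simp; ring
  rw [this, zeroInv_conj, zeroPair, Complex.add_re, Complex.conj_re, Complex.add_re]

open ComplexConjugate in
theorem zeroPair_mirror (m : ℝ) (w : ℂ) (B C : ℝ) {s ρ : ℂ} (hs : 2 * s.re = 1 + m) :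
    zeroPair m w B C (s - (1 - conj ρ)) = zeroPair m w B C (s - ρ) := by
  rw [← zeroPair_eq m w B C hs, ← zeroPair_eq m w B C hs]
  simp only [map_sub, map_one, Complex.conj_conj, sub_sub_cancel]
  rw [add_comm]

open ComplexConjugate in
theorem sum_zeroPair_re (m : ℝ) (w : ℂ) (B C : ℝ) {s : ℂ} (hs : 2 * s.re = 1 + m) (N : ℝ) :
    (∑ ρ ∈ xiZeros N, (xiOrder ρ : ℂ) *
      (zeroInv m w B C (s - ρ) + zeroInv m w B C (s - (1 - conj ρ)))).re =
      ∑ ρ ∈ xiZeros N, (xiOrder ρ : ℝ) * zeroPair m w B C (s - ρ) := by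
  rw [Complex.re_sum]
  refine Finset.sum_congr rfl fun ρ _ => ?_
  rw [← zeroPair_eq m w B C hs, ← Complex.re_ofReal_mul, Complex.ofReal_natCast]

theorem zeroKernel_logDeriv_entireXi_re_nonneg {m B C : ℝ} {w s : ℂ} (hm : 0 ≤ m)
    (hs : 1 < s.re + B) (hsm : 2 * s.re = 1 + m)
    (h : ∀ ρ, entireXi ρ = 0 → 0 ≤ zeroPair m w B C (s - ρ)) :
    0 ≤ (zeroKernel m w B C (logDeriv entireXi) s).re := by
  have ht := (Complex.continuous_re.tendsto _).comp
    (tendsto_sum_zeroInv (w := w) (C := C) hm hs)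
  have : 0 ≤ (2 * zeroKernel m w B C (logDeriv entireXi) s).re := by
    refine ge_of_tendsto ht (Filter.Eventually.of_forall fun N => ?_)
    rw [Function.comp_apply, sum_zeroPair_re m w B C hsm]
    exact Finset.sum_nonneg fun ρ hρ => mul_nonneg (Nat.cast_nonneg _) (h ρ (mem_xiZeros.1 hρ).1)
  simpa using this

open ComplexConjugate in
theorem zeroPair_le_zeroKernel_logDeriv_entireXi_re {m B C : ℝ} {w s ρ₀ : ℂ} (hm : 0 ≤ m)
    (hs : 1 < s.re + B) (hsm : 2 * s.re = 1 + m)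
    (h : ∀ ρ, entireXi ρ = 0 → 0 ≤ zeroPair m w B C (s - ρ)) (h0 : entireXi ρ₀ = 0)
    (h2 : ρ₀.re ≠ 1 / 2) :
    zeroPair m w B C (s - ρ₀) ≤ (zeroKernel m w B C (logDeriv entireXi) s).re := by
  have ht := (Complex.continuous_re.tendsto _).comp
    (tendsto_sum_zeroInv (w := w) (C := C) hm hs)
  have : 2 * zeroPair m w B C (s - ρ₀) ≤ (2 * zeroKernel m w B C (logDeriv entireXi) s).re := by
    refine ge_of_tendsto ht ?_
    filter_upwards [Filter.eventually_ge_atTop ‖ρ₀ - 1 / 2‖] with N hN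
    rw [Function.comp_apply, sum_zeroPair_re m w B C hsm]
    have m1 : ρ₀ ∈ xiZeros N := mem_xiZeros.2 ⟨h0, hN⟩
    have m2 := mirror_mem_xiZeros m1
    have hne : ρ₀ ≠ 1 - conj ρ₀ := by
      intro he
      have := congrArg Complex.re he
      simp at this
      exact h2 (by linarith)
    have hle : ∀ ρ ∈ xiZeros N, zeroPair m w B C (s - ρ) ≤
        (xiOrder ρ : ℝ) * zeroPair m w B C (s - ρ) := fun ρ hρ =>
      le_mul_of_one_le_left (h ρ (mem_xiZeros.1 hρ).1)
        (by exact_mod_cast one_le_xiOrder (mem_xiZeros.1 hρ).1)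
    calc 2 * zeroPair m w B C (s - ρ₀)
        = ∑ ρ ∈ {ρ₀, 1 - conj ρ₀}, zeroPair m w B C (s - ρ) := by
          rw [Finset.sum_pair hne, zeroPair_mirror m w B C hsm, two_mul]
      _ ≤ ∑ ρ ∈ xiZeros N, zeroPair m w B C (s - ρ) := by
          refine Finset.sum_le_sum_of_subset_of_nonneg ?_ fun ρ hρ _ => h ρ (mem_xiZeros.1 hρ).1
          intro ρ hρ
          rcases Finset.mem_insert.1 hρ with rfl | hρ
          · exact m1
          · rw [Finset.mem_singleton.1 hρ]; exact m2
      _ ≤ _ := Finset.sum_le_sum hle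
  simp only [Complex.mul_re, Complex.re_ofNat, Complex.im_ofNat, zero_mul, sub_zero] at this
  linarith

theorem zeroPair_le_trigSum_poleGamma {m B C σ : ℝ} {w ρ₀ : ℂ} (hm : 0 ≤ m)
    (hσ : 1 < σ + B) (hσm : 2 * σ = 1 + m) (hw : ‖w‖ ≤ 1 / 2)
    (h : ∀ k : ℝ, 0 ≤ k → k ≤ 4 → ∀ ρ, entireXi ρ = 0 →
      0 ≤ zeroPair m w B C (σ + (k * ρ₀.im : ℝ) * Complex.I - ρ)) (h0 : entireXi ρ₀ = 0)
    (h2 : ρ₀.re ≠ 1 / 2) :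
    2.448 * zeroPair m w B C (σ - ρ₀.re : ℝ) ≤
      trigSum fun k => (zeroKernel m w B C poleGamma (σ + (k * ρ₀.im : ℝ) * Complex.I)).re := by
  set s : ℝ → ℂ := fun k => σ + (k * ρ₀.im : ℝ) * Complex.I with hs
  have hre : ∀ k, (s k).re = σ := fun k => by simp [hs]
  have hT := trigSum_zeroKernel_neg_logDeriv_nonneg (C := C) (t := ρ₀.im) hm hσ hw
  have e : ∀ k, (zeroKernel m w B C (fun z => -logDeriv riemannZeta z) (s k)).re =
      (zeroKernel m w B C poleGamma (s k)).re - (zeroKernel m w B C (logDeriv entireXi) (s k)).re := by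
    intro k
    rw [← Complex.sub_re, ← zeroKernel_sub]
    rw [zeroKernel_congr (fun z hz => neg_logDeriv_riemannZeta hz) hm (by rw [hre]; exact hσ)]
  have e0 : ∀ k : ℝ, 0 ≤ k → k ≤ 4 → 0 ≤ (zeroKernel m w B C (logDeriv entireXi) (s k)).re :=
    fun k h0 h4 => zeroKernel_logDeriv_entireXi_re_nonneg hm (by rw [hre]; exact hσ)
      (by rw [hre]; exact hσm) (h k h0 h4)
  have e1 : zeroPair m w B C (σ - ρ₀.re : ℝ) ≤
      (zeroKernel m w B C (logDeriv entireXi) (s 1)).re := by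
    have := zeroPair_le_zeroKernel_logDeriv_entireXi_re hm (s := s 1) (by rw [hre]; exact hσ)
      (by rw [hre]; exact hσm) (h 1 zero_le_one (by norm_num)) h0 h2
    have e3 : s 1 - ρ₀ = (σ - ρ₀.re : ℝ) := by
      apply Complex.ext <;> simp [hs]
    rwa [e3] at this
  simp only [trigSum] at hT ⊢
  change 0 ≤ 1.4379 * (zeroKernel m w B C (fun z => -logDeriv riemannZeta z) (s 0)).re +
    2.448 * (zeroKernel m w B C (fun z => -logDeriv riemannZeta z) (s 1)).re +
    1.49 * (zeroKernel m w B C (fun z => -logDeriv riemannZeta z) (s 2)).re +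
    0.6 * (zeroKernel m w B C (fun z => -logDeriv riemannZeta z) (s 3)).re +
    0.125 * (zeroKernel m w B C (fun z => -logDeriv riemannZeta z) (s 4)).re at hT
  rw [e, e, e, e, e] at hT
  have := e0 0 le_rfl (by norm_num)
  have := e0 2 (by norm_num) (by norm_num)
  have := e0 3 (by norm_num) (by norm_num)
  have := e0 4 (by norm_num) (by norm_num)
  linarith

theorem norm_inv_sub_inv_le {u v B c : ℝ} (hu : 0 < u + B) (huv : u ≤ v) :
    ‖((u : ℂ) + B + c * Complex.I)⁻¹ - ((v : ℂ) + B + c * Complex.I)⁻¹‖ ≤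
      (v - u) / ((u + B) * (v + B)) := by
  have key : ∀ x : ℝ, x + B ≤ ‖(x : ℂ) + B + c * Complex.I‖ := by
    intro x
    have := Complex.re_le_norm ((x : ℂ) + B + c * Complex.I)
    simpa using this
  have hv : 0 < v + B := by linarith
  have h1 := norm_pos_iff.1 (hu.trans_le (key u))
  have h2 := norm_pos_iff.1 (hv.trans_le (key v))
  rw [inv_sub_inv h1 h2, norm_div, norm_mul]
  have : (v : ℂ) + B + c * Complex.I - (u + B + c * Complex.I) = (v - u : ℝ) := by
    push_cast; ring
  rw [this, Complex.norm_real, Real.norm_of_nonneg (by linarith)]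
  have := key u
  have := key v
  have : 0 ≤ v - u := by linarith
  gcongr

theorem poleInv_re_sub {w : ℂ} {u v B C : ℝ} (hw : ‖w‖ ≤ 1 / 2) (hu : 0 < u + B) (huv : u ≤ v) :
    (poleInv w B C v).re ≤ (poleInv w B C u).re ∧
      (poleInv w B C u).re - (poleInv w B C v).re ≤
        (1 + 2 * ‖w‖) * ((v - u) / ((u + B) * (v + B))) := by
  have hv : 0 < v + B := by linarith
  set D := (v - u) / ((u + B) * (v + B)) with hD
  have hD0 : 0 ≤ D := by
    have : 0 ≤ v - u := by linarith
    positivity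
  have h1 : (((u : ℂ) + B)⁻¹ - ((v : ℂ) + B)⁻¹) = (D : ℂ) := by
    have a1 : (u : ℂ) + B ≠ 0 := by exact_mod_cast hu.ne'
    have a2 : (v : ℂ) + B ≠ 0 := by exact_mod_cast hv.ne'
    rw [inv_sub_inv a1 a2, hD]; push_cast; ring
  have h2 := norm_inv_sub_inv_le (c := -C) hu huv
  have h3 := norm_inv_sub_inv_le (c := C) hu huv
  set X := ((u : ℂ) + B + (-C : ℝ) * Complex.I)⁻¹ - ((v : ℂ) + B + (-C : ℝ) * Complex.I)⁻¹ with hX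
  set Y := ((u : ℂ) + B + C * Complex.I)⁻¹ - ((v : ℂ) + B + C * Complex.I)⁻¹ with hY
  have e : poleInv w B C u - poleInv w B C v = D + w * X + (starRingEnd ℂ) w * Y := by
    rw [← h1]
    simp only [poleInv, poleKernel, hX, hY]
    push_cast
    ring
  have e2 : (poleInv w B C u).re - (poleInv w B C v).re =
      D + (w * X).re + ((starRingEnd ℂ) w * Y).re := by
    rw [← Complex.sub_re, e]; simp only [Complex.add_re, Complex.ofReal_re]
  have b1 : |(w * X).re| ≤ ‖w‖ * D := (Complex.abs_re_le_norm _).trans (by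
    rw [norm_mul]; exact mul_le_mul_of_nonneg_left h2 (norm_nonneg w))
  have b2 : |((starRingEnd ℂ) w * Y).re| ≤ ‖w‖ * D := (Complex.abs_re_le_norm _).trans (by
    rw [norm_mul, Complex.norm_conj]; exact mul_le_mul_of_nonneg_left h3 (norm_nonneg w))
  have b3 : ‖w‖ * D ≤ 1 / 2 * D := mul_le_mul_of_nonneg_right hw hD0
  have b4 := abs_le.1 b1
  have b5 := abs_le.1 b2
  constructor <;> linarith

theorem poleInv_re_nonneg {w : ℂ} {u B C : ℝ} (hw : ‖w‖ ≤ 1 / 2) (hu : 0 < u + B) :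
    0 ≤ (poleInv w B C u).re := by
  have key : ∀ c : ℝ, ‖((u : ℂ) + B + c * Complex.I)⁻¹‖ ≤ (u + B)⁻¹ := by
    intro c
    rw [norm_inv]
    refine inv_anti₀ hu ?_
    have := Complex.re_le_norm ((u : ℂ) + B + c * Complex.I)
    simpa using this
  have h2 := key (-C)
  have h3 := key C
  have hD0 : 0 ≤ (u + B)⁻¹ := by positivity
  set X := ((u : ℂ) + B + (-C : ℝ) * Complex.I)⁻¹ with hX
  set Y := ((u : ℂ) + B + C * Complex.I)⁻¹ with hY
  have e : poleInv w B C u = ((u + B)⁻¹ : ℝ) + w * X + (starRingEnd ℂ) w * Y := by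
    simp only [poleInv, poleKernel, hX, hY]
    push_cast
    ring
  have b1 : |(w * X).re| ≤ ‖w‖ * (u + B)⁻¹ := (Complex.abs_re_le_norm _).trans (by
    rw [norm_mul]; exact mul_le_mul_of_nonneg_left h2 (norm_nonneg w))
  have b2 : |((starRingEnd ℂ) w * Y).re| ≤ ‖w‖ * (u + B)⁻¹ := (Complex.abs_re_le_norm _).trans (by
    rw [norm_mul, Complex.norm_conj]; exact mul_le_mul_of_nonneg_left h3 (norm_nonneg w))
  have b3 : ‖w‖ * (u + B)⁻¹ ≤ 1 / 2 * (u + B)⁻¹ := mul_le_mul_of_nonneg_right hw hD0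
  have b4 := abs_le.1 b1
  have b5 := abs_le.1 b2
  rw [e, Complex.add_re, Complex.add_re, Complex.ofReal_re]
  linarith

theorem zeroInv_ofReal_re (m : ℝ) (w : ℂ) (B C x : ℝ) : (zeroInv m w B C x).re =
    (poleInv w B C x).re - 27 / 25 * (poleInv w B C (x + 97 / 100 * m : ℝ)).re +
      59 / 100 * (poleInv w B C (x + 7 / 5 * m : ℝ)).re := by
  have c1 : (27 / 25 : ℂ) = ((27 / 25 : ℝ) : ℂ) := by norm_num
  have c2 : (59 / 100 : ℂ) = ((59 / 100 : ℝ) : ℂ) := by norm_num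
  simp only [zeroInv, zeroKernel, mixKernel, c1, c2, Complex.ofReal_add, Complex.add_re,
    Complex.sub_re, Complex.re_ofReal_mul]

theorem zeroInv_re_le_poleInv {m B C x : ℝ} {w : ℂ} (hm : 0 ≤ m) (hw : ‖w‖ ≤ 1 / 2)
    (hx : 0 < x + 97 / 100 * m + B) : (zeroInv m w B C x).re ≤ (poleInv w B C x).re := by
  rw [zeroInv_ofReal_re]
  have h1 := (poleInv_re_sub (C := C) hw hx (v := x + 7 / 5 * m) (by linarith)).1
  have h2 := poleInv_re_nonneg (C := C) hw hx
  linarith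

theorem poleInv_re_le_zeroPair {m B C x : ℝ} {w : ℂ} (hm : 0 < m) (hw : ‖w‖ ≤ 1 / 2) (hB : 0 < B)
    (hBm : B < 97 / 100 * m) (hF : ∀ u : ℝ, 0 ≤ (poleInv w B C (u * Complex.I)).re)
    (hx : 0 ≤ x) (hxm : x ≤ m / 5) :
    (poleInv w B C x).re - 62 / 100 * (1 + 2 * ‖w‖) * (x / m ^ 2) ≤ zeroPair m w B C x := by
  have h0 := translates_re_nonneg hB hBm hF 0
  simp only [Complex.ofReal_zero, zero_mul, add_zero] at h0
  rw [show (0 : ℂ) = (0 : ℝ) from rfl, zeroInv_ofReal_re, zeroInv_ofReal_re] at h0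
  rw [zeroPair, Complex.add_re, ← Complex.ofReal_sub, zeroInv_ofReal_re, zeroInv_ofReal_re]
  have r1 := (poleInv_re_sub (B := B) (C := C) hw (u := m - x) (v := m) (by linarith) (by linarith)).1
  have r2 := (poleInv_re_sub (B := B) (C := C) hw (u := 0 + 97 / 100 * m) (v := x + 97 / 100 * m)
    (by linarith) (by linarith)).1
  have r3 := (poleInv_re_sub (B := B) (C := C) hw (u := 0 + 7 / 5 * m) (v := x + 7 / 5 * m)
    (by linarith) (by linarith)).2
  have r4 := (poleInv_re_sub (B := B) (C := C) hw (u := m - x + 97 / 100 * m) (v := m + 97 / 100 * m)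
    (by linarith) (by linarith)).2
  have r5 := (poleInv_re_sub (B := B) (C := C) hw (u := m - x + 7 / 5 * m) (v := m + 7 / 5 * m)
    (by linarith) (by linarith)).1
  have b3 : (x + 7 / 5 * m - (0 + 7 / 5 * m)) / ((0 + 7 / 5 * m + B) * (x + 7 / 5 * m + B)) ≤
      25 / 49 * (x / m ^ 2) := by
    have : 25 / 49 * (x / m ^ 2) = x / (7 / 5 * m * (7 / 5 * m)) := by field_simp; ring
    rw [this, show x + 7 / 5 * m - (0 + 7 / 5 * m) = x by ring]
    gcongr <;> linarith
  have b4 : (m + 97 / 100 * m - (m - x + 97 / 100 * m)) /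
      ((m - x + 97 / 100 * m + B) * (m + 97 / 100 * m + B)) ≤
      10000 / (177 * 197) * (x / m ^ 2) := by
    have : 10000 / (177 * 197) * (x / m ^ 2) = x / (177 / 100 * m * (197 / 100 * m)) := by
      field_simp; ring
    rw [this, show m + 97 / 100 * m - (m - x + 97 / 100 * m) = x by ring]
    gcongr <;> linarith
  have hw0 : 0 ≤ 1 + 2 * ‖w‖ := by positivity
  have b3' := mul_le_mul_of_nonneg_left b3 hw0
  have b4' := mul_le_mul_of_nonneg_left b4 hw0
  have hxx : 0 ≤ (1 + 2 * ‖w‖) * (x / m ^ 2) := by positivity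
  linarith

theorem norm_inv_add_mul_I_sub_le {a : ℂ} {y r : ℝ} (ha : ‖a‖ ≤ r) (hr : r < |y|) :
    ‖(a + y * Complex.I)⁻¹ -
      ((y * Complex.I)⁻¹ - a / (y * Complex.I) ^ 2 + a ^ 2 / (y * Complex.I) ^ 3)‖ ≤
      r ^ 3 / (|y| ^ 3 * (|y| - r)) := by
  have hy : 0 < |y| := (norm_nonneg a).trans_lt (ha.trans_lt hr)
  have hn : ‖(y : ℂ) * Complex.I‖ = |y| := by simp
  have hyI : (y : ℂ) * Complex.I ≠ 0 := by rw [← norm_pos_iff, hn]; exact hy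
  have hle : |y| - r ≤ ‖a + y * Complex.I‖ := by
    have := norm_sub_le_norm_add ((y : ℂ) * Complex.I) a
    rw [hn, add_comm] at this
    linarith
  have hpos : 0 < |y| - r := by linarith
  have hne : a + y * Complex.I ≠ 0 := by rw [← norm_pos_iff]; linarith
  have e : (a + y * Complex.I)⁻¹ -
      ((y * Complex.I)⁻¹ - a / (y * Complex.I) ^ 2 + a ^ 2 / (y * Complex.I) ^ 3) =
      -a ^ 3 / ((y * Complex.I) ^ 3 * (a + y * Complex.I)) := by
    generalize (y : ℂ) * Complex.I = v at *
    field_simp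
    ring
  rw [e, norm_div, norm_neg, norm_mul, norm_pow, norm_pow, hn]
  have := norm_nonneg a
  have : 0 ≤ r ^ 3 := pow_nonneg (by linarith) 3
  gcongr

/-- The weight for which `1 / (z + B) + w / (z + B - iC) + conj w / (z + B + iC)` is optimised. -/
noncomputable def tiltWeight : ℂ := -(1 + Complex.I) / 4

theorem norm_tiltWeight_le : ‖tiltWeight‖ ≤ 9 / 25 := by
  have h : ‖tiltWeight‖ ^ 2 = 1 / 8 := by
    rw [← Complex.normSq_eq_norm_sq, tiltWeight, Complex.normSq_apply]
    simp; norm_num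
  nlinarith [norm_nonneg tiltWeight]

theorem poleInv_tiltWeight_re_sub {B C x y r : ℝ} (h : |x + B| + |C| ≤ r) (hr : r < |y|) :
    |(poleInv tiltWeight B C (x + y * Complex.I)).re - (x + B - C) / (2 * y ^ 2)| ≤
      43 / 25 * (r ^ 3 / (|y| ^ 3 * (|y| - r))) := by
  have hn : ∀ c : ℝ, |c| ≤ |C| → ‖((x + B : ℝ) : ℂ) + c * Complex.I‖ ≤ r := by
    intro c hc
    refine (norm_add_le _ _).trans ?_
    rw [norm_mul, Complex.norm_I, Complex.norm_real, Complex.norm_real, Real.norm_eq_abs,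
      Real.norm_eq_abs]
    linarith
  set ε := r ^ 3 / (|y| ^ 3 * (|y| - r)) with hε
  have k0 := norm_inv_add_mul_I_sub_le (hn 0 (by simp)) hr
  have k1 := norm_inv_add_mul_I_sub_le (hn (-C) (by simp)) hr
  have k2 := norm_inv_add_mul_I_sub_le (hn C le_rfl) hr
  have hy0 : y ≠ 0 := by
    rintro rfl
    have := abs_nonneg (x + B)
    have := abs_nonneg C
    simp at hr
    linarith
  set T : ℂ → ℂ := fun a => (y * Complex.I)⁻¹ - a / (y * Complex.I) ^ 2 +
    a ^ 2 / (y * Complex.I) ^ 3 with hT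
  set X : ℝ → ℂ := fun c => (((x + B : ℝ) : ℂ) + c * Complex.I + y * Complex.I)⁻¹ -
    T ((x + B : ℝ) + c * Complex.I) with hX
  have e : poleInv tiltWeight B C (x + y * Complex.I) =
      (X 0 + tiltWeight * X (-C) + (starRingEnd ℂ) tiltWeight * X C) +
      (T ((x + B : ℝ) + (0 : ℝ) * Complex.I) + tiltWeight * T ((x + B : ℝ) + (-C : ℝ) * Complex.I) +
        (starRingEnd ℂ) tiltWeight * T ((x + B : ℝ) + C * Complex.I)) := by
    simp only [poleInv, poleKernel, hX]
    push_cast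
    ring_nf
  have hTform : ∀ u c : ℝ, T (u + c * Complex.I) =
      (u / y ^ 2 - 2 * u * c / y ^ 3 : ℝ) +
        (-1 / y + c / y ^ 2 + (u ^ 2 - c ^ 2) / y ^ 3 : ℝ) * Complex.I := by
    intro u c
    have hyc : (y : ℂ) ≠ 0 := by exact_mod_cast hy0
    have i1 : ((y : ℂ) * Complex.I)⁻¹ = -Complex.I / y := by
      rw [mul_inv, Complex.inv_I]; ring
    have i2 : ((y : ℂ) * Complex.I) ^ 2 = -(y : ℂ) ^ 2 := by rw [mul_pow, Complex.I_sq]; ring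
    have i3 : ((y : ℂ) * Complex.I) ^ 3 = -((y : ℂ) ^ 3 * Complex.I) := by
      rw [mul_pow, Complex.I_pow_three]; ring
    have i4 : ∀ z : ℂ, z / -((y : ℂ) ^ 3 * Complex.I) = z * Complex.I / y ^ 3 := by
      intro z
      rw [div_eq_div_iff (neg_ne_zero.2 (mul_ne_zero (pow_ne_zero _ hyc) Complex.I_ne_zero))
        (pow_ne_zero _ hyc)]
      linear_combination (z * y ^ 3) * Complex.I_sq
    simp only [hT, i1, i2, i3, i4]
    push_cast
    have h2 : ((u : ℂ) + c * Complex.I) ^ 2 * Complex.I =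
      -(2 * u * c) + (u ^ 2 - c ^ 2) * Complex.I := by
      linear_combination (2 * u * c + c ^ 2 * Complex.I) * Complex.I_sq
    rw [h2]
    ring
  have hmain : (T ((x + B : ℝ) + (0 : ℝ) * Complex.I) +
      tiltWeight * T ((x + B : ℝ) + (-C : ℝ) * Complex.I) +
        (starRingEnd ℂ) tiltWeight * T ((x + B : ℝ) + C * Complex.I)).re =
      (x + B - C) / (2 * y ^ 2) := by
    simp only [hTform, Complex.add_re, Complex.mul_re, Complex.ofReal_re, Complex.ofReal_im,
      Complex.add_im, Complex.mul_im, Complex.I_re, Complex.I_im, Complex.conj_re, Complex.conj_im]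
    have w1 : tiltWeight.re = -1 / 4 := by simp [tiltWeight]
    have w2 : tiltWeight.im = -1 / 4 := by simp [tiltWeight]
    rw [w1, w2]
    field_simp
    ring
  rw [e, Complex.add_re, hmain, add_sub_cancel_right]
  refine (Complex.abs_re_le_norm _).trans (norm_add₃_le.trans ?_)
  rw [norm_mul, norm_mul, Complex.norm_conj]
  have hw := norm_tiltWeight_le
  have q1 := mul_le_mul hw k1 (norm_nonneg _) (by norm_num)
  have q2 := mul_le_mul hw k2 (norm_nonneg _) (by norm_num)
  linarith

theorem zeroInv_re (m : ℝ) (w : ℂ) (B C x y : ℝ) : (zeroInv m w B C (x + y * Complex.I)).re =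
    (poleInv w B C (x + y * Complex.I)).re -
      27 / 25 * (poleInv w B C ((x + 97 / 100 * m : ℝ) + y * Complex.I)).re +
      59 / 100 * (poleInv w B C ((x + 7 / 5 * m : ℝ) + y * Complex.I)).re := by
  have c1 : (27 / 25 : ℂ) = ((27 / 25 : ℝ) : ℂ) := by norm_num
  have c2 : (59 / 100 : ℂ) = ((59 / 100 : ℝ) : ℂ) := by norm_num
  have e : ∀ r : ℝ, (x : ℂ) + y * Complex.I + r = (x + r : ℝ) + y * Complex.I := by
    intro r; push_cast; ring
  simp only [zeroInv, zeroKernel, mixKernel, c1, c2, Complex.add_re,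
    Complex.sub_re, Complex.re_ofReal_mul, e]

theorem zeroPair_eq_add (m : ℝ) (w : ℂ) (B C : ℝ) (x y : ℝ) :
    zeroPair m w B C (x + y * Complex.I) = (zeroInv m w B C (x + y * Complex.I)).re +
      (zeroInv m w B C ((m - x : ℝ) + y * Complex.I)).re := by
  have : (m : ℂ) - (x + y * Complex.I) = (starRingEnd ℂ) ((m - x : ℝ) + y * Complex.I) := by
    apply Complex.ext <;> simp
  rw [zeroPair, this, zeroInv_conj, Complex.add_re, Complex.conj_re]

theorem zeroPair_tiltWeight_nonneg_of_large {l x y : ℝ} (hl0 : 0 < l) (hl : l ≤ 33 / 1000)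
    (hx : -l ≤ x) (hxm : x ≤ 1 - l) (hy : 78 ≤ |y|) :
    0 ≤ zeroPair (1 - 2 * l) tiltWeight (5 * l) (23 / 5 * l) (x + y * Complex.I) := by
  have hy0 : 0 < y ^ 2 := by
    rw [← sq_abs]; positivity
  have hε : 43 / 25 * ((13 / 5) ^ 3 / (|y| ^ 3 * (|y| - 13 / 5))) ≤ 52 / 10000 / y ^ 2 := by
    have e : 52 / 10000 / y ^ 2 = 43 / 25 * ((13 / 5) ^ 3 /
        (|y| ^ 3 * (43 / 25 * (13 / 5) ^ 3 * (10000 / 52) / |y|))) := by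
      have : |y| ≠ 0 := by positivity
      rw [← sq_abs]; field_simp
    rw [e]
    have h1 : 0 < |y| := by linarith
    have h2 : 43 / 25 * (13 / 5) ^ 3 * (10000 / 52) / |y| ≤ |y| - 13 / 5 := by
      rw [div_le_iff₀ h1]; nlinarith
    have h3 : 0 < 43 / 25 * (13 / 5 : ℝ) ^ 3 * (10000 / 52) / |y| := by positivity
    gcongr
  have key : ∀ u : ℝ, -l ≤ u → u ≤ 12 / 5 * (1 - 2 * l) + l →
      |(poleInv tiltWeight (5 * l) (23 / 5 * l) (u + y * Complex.I)).re -
        (u + 5 * l - 23 / 5 * l) / 2 * (1 / y ^ 2)| ≤ 52 / 10000 * (1 / y ^ 2) := by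
    intro u h1 h2
    have h := poleInv_tiltWeight_re_sub (B := 5 * l) (C := 23 / 5 * l) (x := u) (y := y)
      (r := 13 / 5) (by rw [abs_of_nonneg (by linarith), abs_of_nonneg (by linarith)]; linarith)
      (by linarith)
    have e1 : (u + 5 * l - 23 / 5 * l) / (2 * y ^ 2) =
      (u + 5 * l - 23 / 5 * l) / 2 * (1 / y ^ 2) := by field_simp
    rw [e1] at h
    exact h.trans (hε.trans (by rw [div_eq_mul_one_div]))
  rw [zeroPair_eq_add, zeroInv_re, zeroInv_re]
  have k1 := (abs_le.1 (key x (by linarith) (by linarith))).1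
  have k2 := (abs_le.1 (key (x + 97 / 100 * (1 - 2 * l)) (by linarith) (by linarith))).2
  have k3 := (abs_le.1 (key (x + 7 / 5 * (1 - 2 * l)) (by linarith) (by linarith))).1
  have k4 := (abs_le.1 (key (1 - 2 * l - x) (by linarith) (by linarith))).1
  have k5 := (abs_le.1 (key (1 - 2 * l - x + 97 / 100 * (1 - 2 * l)) (by linarith)
    (by linarith))).2
  have k6 := (abs_le.1 (key (1 - 2 * l - x + 7 / 5 * (1 - 2 * l)) (by linarith)
    (by linarith))).1
  have hY : 0 < 1 / y ^ 2 := by positivity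
  have hlY : 0 ≤ l * (1 / y ^ 2) := by positivity
  have hlY2 : l * (1 / y ^ 2) ≤ 33 / 1000 * (1 / y ^ 2) := mul_le_mul_of_nonneg_right hl hY.le
  linarith

theorem poleInv_tiltWeight_re {B C x y : ℝ} (ha : 0 < x + B) :
    (poleInv tiltWeight B C (x + y * Complex.I)).re = (x + B) / ((x + B) ^ 2 + y ^ 2) -
      (x + B + (y - C)) / (4 * ((x + B) ^ 2 + (y - C) ^ 2)) -
      (x + B - (y + C)) / (4 * ((x + B) ^ 2 + (y + C) ^ 2)) := by
  have key : ∀ v : ℝ, ((x + B : ℝ) + v * Complex.I : ℂ)⁻¹ =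
      ((x + B) / ((x + B) ^ 2 + v ^ 2) : ℝ) - (v / ((x + B) ^ 2 + v ^ 2) : ℝ) * Complex.I := by
    intro v
    apply Complex.ext <;>
    simp only [Complex.inv_re, Complex.inv_im, Complex.normSq_apply, sq, neg_div, Complex.add_re,
      Complex.add_im, Complex.sub_re, Complex.sub_im, Complex.re_ofReal_mul, Complex.im_ofReal_mul,
      Complex.ofReal_re, Complex.ofReal_im, Complex.I_re, Complex.I_im, mul_zero, mul_one, add_zero,
      zero_add, sub_zero, zero_sub]
  have e0 : (x : ℂ) + y * Complex.I + B = (x + B : ℝ) + y * Complex.I := by push_cast; ring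
  have e1 : ((x + B : ℝ) : ℂ) + y * Complex.I - C * Complex.I =
    (x + B : ℝ) + (y - C : ℝ) * Complex.I := by push_cast; ring
  have e2 : ((x + B : ℝ) : ℂ) + y * Complex.I + C * Complex.I =
    (x + B : ℝ) + (y + C : ℝ) * Complex.I := by push_cast; ring
  have w1 : tiltWeight.re = -1 / 4 := by simp [tiltWeight]
  have w2 : tiltWeight.im = -1 / 4 := by simp [tiltWeight]
  simp only [poleInv, poleKernel]
  rw [e0, e1, e2, key, key, key]
  simp only [Complex.add_re, Complex.sub_re, Complex.mul_re, Complex.sub_im, Complex.mul_im,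
    Complex.ofReal_re, Complex.ofReal_im, Complex.conj_re, Complex.conj_im, Complex.I_re,
    Complex.I_im, w1, w2]
  have p0 : (x + B) ^ 2 + y ^ 2 ≠ 0 := by positivity
  have p1 : (x + B) ^ 2 + (y - C) ^ 2 ≠ 0 := by positivity
  have p2 : (x + B) ^ 2 + (y + C) ^ 2 ≠ 0 := by positivity
  field_simp
  ring

theorem poleInv_tiltWeight_ofReal_re {B C x : ℝ} (ha : 0 < x + B) :
    (poleInv tiltWeight B C x).re = 1 / (x + B) -
      (x + B - C) / (2 * ((x + B) ^ 2 + C ^ 2)) := by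
  have h := poleInv_tiltWeight_re (C := C) (y := 0) ha
  simp only [Complex.ofReal_zero, zero_mul, add_zero] at h
  rw [h, zero_sub, zero_add, neg_sq]
  have p2 : (x + B) ^ 2 + C ^ 2 ≠ 0 := by positivity
  field_simp
  ring

theorem poleInv_tiltWeight_mul_I_re_nonneg {l : ℝ} (hl : 0 < l) (u : ℝ) :
    0 ≤ (poleInv tiltWeight (5 * l) (23 / 5 * l) (u * Complex.I)).re := by
  have h := poleInv_tiltWeight_re (x := 0) (B := 5 * l) (C := 23 / 5 * l) (y := u) (by linarith)
  simp only [Complex.ofReal_zero, zero_add] at h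
  rw [h]
  obtain ⟨v, rfl⟩ : ∃ v, u = v * l := ⟨u / l, by field_simp⟩
  have p1 : 25 + (v - 23 / 5) ^ 2 ≠ 0 := by positivity
  have p2 : 25 + (v + 23 / 5) ^ 2 ≠ 0 := by positivity
  have e : 5 * l / ((5 * l) ^ 2 + (v * l) ^ 2) -
      (5 * l + (v * l - 23 / 5 * l)) / (4 * ((5 * l) ^ 2 + (v * l - 23 / 5 * l) ^ 2)) -
      (5 * l - (v * l + 23 / 5 * l)) / (4 * ((5 * l) ^ 2 + (v * l + 23 / 5 * l) ^ 2)) =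
      (1 / 5 * v ^ 4 - 90832 / 1000 * v ^ 2 + 10422928 / 1000) /
      (l * (25 + v ^ 2) * (25 + (v - 23 / 5) ^ 2) * (25 + (v + 23 / 5) ^ 2)) := by
    have q1 : (5 * l) ^ 2 + (v * l) ^ 2 = l ^ 2 * (25 + v ^ 2) := by ring
    have q2 : (5 * l) ^ 2 + (v * l - 23 / 5 * l) ^ 2 = l ^ 2 * (25 + (v - 23 / 5) ^ 2) := by ring
    have q3 : (5 * l) ^ 2 + (v * l + 23 / 5 * l) ^ 2 = l ^ 2 * (25 + (v + 23 / 5) ^ 2) := by ring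
    rw [q1, q2, q3]
    field_simp
    ring
  rw [e]
  have : 0 ≤ 1 / 5 * v ^ 4 - 90832 / 1000 * v ^ 2 + 10422928 / 1000 := by
    nlinarith [sq_nonneg (v ^ 2 - 22708 / 100)]
  positivity

theorem poleInv_zero_ofReal_re (B x : ℝ) : (poleInv 0 B 0 x).re = 1 / (x + B) := by
  have : poleInv 0 B 0 x = (1 / (x + B) : ℝ) := by
    simp [poleInv, poleKernel]
  rw [this, Complex.ofReal_re]

theorem poleInv_zero_mul_I_re_nonneg {B : ℝ} (hB : 0 < B) (u : ℝ) :
    0 ≤ (poleInv 0 B 0 (u * Complex.I)).re := by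
  simp only [poleInv, poleKernel, zero_mul, map_zero, add_zero, Complex.inv_re]
  refine div_nonneg ?_ (Complex.normSq_nonneg _)
  simp [hB.le]

theorem log_add_mul_I_div {A : ℂ} {y r : ℝ} (hr : 0 < r) (hy : 0 < y) (hA : ‖A‖ < y) :
    Complex.log ((A + y * Complex.I) / r) =
      Real.log (y / r) + (Real.pi / 2 : ℝ) * Complex.I + Complex.log (1 + A / (y * Complex.I)) := by
  have hyc : (y : ℂ) ≠ 0 := by exact_mod_cast hy.ne'
  have hrc : (r : ℂ) ≠ 0 := by exact_mod_cast hr.ne'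
  have hu : ‖A / (y * Complex.I)‖ < 1 := by
    rw [norm_div, norm_mul, Complex.norm_I, mul_one, Complex.norm_real, Real.norm_of_nonneg hy.le,
      div_lt_one hy]
    exact hA
  have hre : 0 < (1 + A / (y * Complex.I)).re := by
    have := (abs_lt.1 ((Complex.abs_re_le_norm _).trans_lt hu)).1
    rw [Complex.add_re, Complex.one_re]; linarith
  have hne : 1 + A / (y * Complex.I) ≠ 0 := by
    intro h; rw [h] at hre; simp at hre
  have e : (A + y * Complex.I) / r = ((y / r : ℝ) : ℂ) * (Complex.I * (1 + A / (y * Complex.I))) := by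
    have := Complex.I_ne_zero
    push_cast
    field_simp
    ring
  rw [e, Complex.log_ofReal_mul (by positivity) (mul_ne_zero Complex.I_ne_zero hne),
    (Complex.log_mul_eq_add_log_iff Complex.I_ne_zero hne).2, Complex.log_I]
  · push_cast; ring
  · rw [Complex.arg_I]
    have h := abs_lt.1 (Complex.abs_arg_lt_pi_div_two_iff.2 (Or.inl hre))
    constructor <;> linarith [Real.pi_pos]

theorem norm_log_add_mul_I_div_sub_le {A : ℂ} {y r : ℝ} (hr : 0 < r) (hy : 39 ≤ y)
    (hA : ‖A‖ ≤ 18 / 5) :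
    ‖Complex.log ((A + y * Complex.I) / r) -
      (Real.log (y / r) + (Real.pi / 2 : ℝ) * Complex.I + A / (y * Complex.I))‖ ≤
      72 / 10 * (1 / y ^ 2) := by
  have hy0 : 0 < y := by linarith
  rw [log_add_mul_I_div hr hy0 (by linarith), add_sub_add_left_eq_sub]
  have hu : ‖A / (y * Complex.I)‖ ≤ 18 / 5 / y := by
    rw [norm_div, norm_mul, Complex.norm_I, mul_one, Complex.norm_real, Real.norm_of_nonneg hy0.le]
    gcongr
  have hu2 : 18 / 5 / y ≤ 18 / 5 / 39 := by gcongr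
  refine (Complex.norm_log_one_add_sub_self_le (by linarith)).trans ?_
  have h3 : (1 - ‖A / (y * Complex.I)‖)⁻¹ ≤ (1 - 18 / 5 / 39 : ℝ)⁻¹ :=
    inv_anti₀ (by norm_num) (by linarith)
  have h4 : ‖A / (y * Complex.I)‖ ^ 2 ≤ (18 / 5 / y) ^ 2 := by gcongr
  have h5 := mul_le_mul h4 h3 (inv_nonneg.2 (by linarith)) (by positivity)
  have e : (18 / 5 / y) ^ 2 = (18 / 5) ^ 2 * (1 / y ^ 2) := by field_simp
  rw [e] at h5
  have : 0 < 1 / y ^ 2 := by positivity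
  have h6 : (18 / 5 : ℝ) ^ 2 * (1 / y ^ 2) * (1 - 18 / 5 / 39)⁻¹ =
    ((18 / 5 : ℝ) ^ 2 * (1 - 18 / 5 / 39)⁻¹) * (1 / y ^ 2) := by ring
  have h7 : (18 / 5 : ℝ) ^ 2 * (1 - 18 / 5 / 39)⁻¹ ≤ 2 * (72 / 10) := by norm_num
  have h8 := mul_le_mul_of_nonneg_right h7 this.le
  linarith

theorem norm_log_add_mul_I_div_sub_log_le {a c r : ℝ} (hr : 0 < r) (ha : 2 ≤ a)
    (hc : |c| ≤ 1518 / 10000) :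
    ‖Complex.log (((a : ℂ) + c * Complex.I) / r) - Real.log (a / r)‖ ≤ 8 / 100 := by
  have ha0 : 0 < a := by linarith
  have hac : (a : ℂ) ≠ 0 := by exact_mod_cast ha0.ne'
  have hrc : (r : ℂ) ≠ 0 := by exact_mod_cast hr.ne'
  have hu : ‖(c : ℂ) * Complex.I / a‖ ≤ 759 / 10000 := by
    rw [norm_div, norm_mul, Complex.norm_I, mul_one, Complex.norm_real, Complex.norm_real,
      Real.norm_of_nonneg ha0.le, Real.norm_eq_abs, div_le_iff₀ ha0]
    linarith
  have hne : 1 + (c : ℂ) * Complex.I / a ≠ 0 := by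
    intro h
    have h1 : (c : ℂ) * Complex.I / a = -1 := by linear_combination h
    rw [h1] at hu
    norm_num at hu
  have e : ((a : ℂ) + c * Complex.I) / r = ((a / r : ℝ) : ℂ) * (1 + c * Complex.I / a) := by
    push_cast
    field_simp
  rw [e, Complex.log_ofReal_mul (by positivity) hne, add_sub_cancel_left]
  have h1 := Complex.norm_log_one_add_sub_self_le (z := (c : ℂ) * Complex.I / a) (by linarith)
  have h2 : ‖Complex.log (1 + c * Complex.I / a)‖ ≤
      ‖Complex.log (1 + c * Complex.I / a) - c * Complex.I / a‖ + ‖(c : ℂ) * Complex.I / a‖ := by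
    have := norm_add_le (Complex.log (1 + c * Complex.I / a) - c * Complex.I / a)
      ((c : ℂ) * Complex.I / a)
    rwa [sub_add_cancel] at this
  have h3 : (1 - ‖(c : ℂ) * Complex.I / a‖)⁻¹ ≤ (1 - 759 / 10000 : ℝ)⁻¹ :=
    inv_anti₀ (by norm_num) (by linarith)
  have h4 : ‖(c : ℂ) * Complex.I / a‖ ^ 2 ≤ (759 / 10000) ^ 2 := by gcongr
  have h5 := mul_le_mul h4 h3 (inv_nonneg.2 (by linarith)) (by positivity)
  have h7 : (759 / 10000 : ℝ) ^ 2 * (1 - 759 / 10000)⁻¹ ≤ 2 * (4 / 1000) := by norm_num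
  linarith

theorem abs_poleKernel_re_sub_le {g : ℂ → ℂ} {B C δ ε c : ℝ} {z v : ℂ}
    (T : ℂ → ℂ) (h0 : ‖g (z + B) - T (z + B)‖ ≤ δ)
    (h1 : ‖g (z + B - C * Complex.I) - T (z + B - C * Complex.I)‖ ≤ ε)
    (h2 : ‖g (z + B + C * Complex.I) - T (z + B + C * Complex.I)‖ ≤ ε)
    (hv : poleKernel tiltWeight B C T z = v) (hc : v.re = c) :
    |(poleKernel tiltWeight B C g z).re - c| ≤ δ + 18 / 25 * ε := by
  rw [← hc, ← hv, ← Complex.sub_re]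
  refine (Complex.abs_re_le_norm _).trans ?_
  have e : poleKernel tiltWeight B C g z - poleKernel tiltWeight B C T z =
      (g (z + B) - T (z + B)) +
      tiltWeight * (g (z + B - C * Complex.I) - T (z + B - C * Complex.I)) +
      (starRingEnd ℂ) tiltWeight * (g (z + B + C * Complex.I) - T (z + B + C * Complex.I)) := by
    simp only [poleKernel]; ring
  rw [e]
  refine norm_add₃_le.trans ?_
  rw [norm_mul, norm_mul, Complex.norm_conj]
  have hw := norm_tiltWeight_le
  have q1 := mul_le_mul hw h1 (norm_nonneg _) (by norm_num)
  have q2 := mul_le_mul hw h2 (norm_nonneg _) (by norm_num)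
  linarith

theorem poleKernel_tiltWeight_log_re_large {B C x y : ℝ} (ha : 0 ≤ x + 1 + B) (hC : 0 ≤ C)
    (haC : x + 1 + B + C ≤ 18 / 5) (hy : 39 ≤ y) :
    |(poleKernel tiltWeight B C (fun z => Complex.log ((z + 1) / (2 * Real.pi : ℝ)))
      (x + y * Complex.I)).re - 1 / 2 * Real.log (y / (2 * Real.pi))| ≤
      72 / 10 * (1 / y ^ 2) + 18 / 25 * (72 / 10 * (1 / y ^ 2)) := by
  have hpi : 0 < 2 * Real.pi := by positivity
  have hn : ∀ c : ℝ, |c| ≤ C → ‖((x + 1 + B : ℝ) : ℂ) + c * Complex.I‖ ≤ 18 / 5 := by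
    intro c hc
    refine (norm_add_le _ _).trans ?_
    rw [norm_mul, Complex.norm_I, Complex.norm_real, Complex.norm_real, Real.norm_eq_abs,
      Real.norm_eq_abs, abs_of_nonneg ha]
    linarith
  set L : ℂ := Real.log (y / (2 * Real.pi)) + (Real.pi / 2 : ℝ) * Complex.I with hL
  have key : ∀ (c : ℝ) (z : ℂ), |c| ≤ C → z + 1 = (x + 1 + B : ℝ) + c * Complex.I + y * Complex.I →
      ‖Complex.log ((z + 1) / (2 * Real.pi : ℝ)) -
        (L + (z + 1 - y * Complex.I) / (y * Complex.I))‖ ≤ 72 / 10 * (1 / y ^ 2) := by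
    intro c z hc hz
    have := norm_log_add_mul_I_div_sub_le hpi hy (hn c hc)
    rwa [← hz, ← sub_eq_of_eq_add hz] at this
  refine abs_poleKernel_re_sub_le (fun z => L + (z + 1 - y * Complex.I) / (y * Complex.I))
    (key 0 _ (by simpa using hC) (by push_cast; ring))
    (key (-C) _ (by rw [abs_neg, abs_of_nonneg hC]) (by push_cast; ring))
    (key C _ (by rw [abs_of_nonneg hC]) (by push_cast; ring)) rfl ?_
  have w1 : tiltWeight.re = -1 / 4 := by simp [tiltWeight]
  have w2 : tiltWeight.im = -1 / 4 := by simp [tiltWeight]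
  have e1 : poleKernel tiltWeight B C (fun z => L + (z + 1 - y * Complex.I) / (y * Complex.I))
      (x + y * Complex.I) = (1 / 2 : ℝ) * L +
      ((-(x + 1 + B - C) / (2 * y) : ℝ) : ℂ) * Complex.I := by
    have hyc : (y : ℂ) ≠ 0 := by exact_mod_cast (by linarith : y ≠ 0)
    have hcw : (starRingEnd ℂ) tiltWeight = -(1 - Complex.I) / 4 := by
      rw [tiltWeight, map_div₀, map_ofNat, map_neg, map_add, map_one, Complex.conj_I, sub_eq_add_neg]
    have i1 : ∀ z : ℂ, z / (y * Complex.I) = -(z * Complex.I) / y := by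
      intro z
      rw [div_eq_div_iff (mul_ne_zero hyc Complex.I_ne_zero) hyc]
      linear_combination (z * y) * Complex.I_sq
    simp only [poleKernel, i1]
    rw [hcw, tiltWeight]
    push_cast
    field_simp
    ring_nf
    simp only [Complex.I_pow_three]
    ring
  rw [e1, Complex.add_re, Complex.re_ofReal_mul, Complex.re_ofReal_mul, Complex.I_re, mul_zero,
    add_zero, hL, Complex.add_re, Complex.re_ofReal_mul, Complex.I_re, mul_zero, add_zero,
    Complex.ofReal_re]

theorem poleKernel_tiltWeight_log_re_zero {B C x : ℝ} (ha : 2 ≤ x + 1 + B) (hC : 0 ≤ C)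
    (hC1 : C ≤ 1518 / 10000) :
    |(poleKernel tiltWeight B C (fun z => Complex.log ((z + 1) / (2 * Real.pi : ℝ)))
      x).re - 1 / 2 * Real.log ((x + 1 + B) / (2 * Real.pi))| ≤ 0 + 18 / 25 * (8 / 100) := by
  have hpi : 0 < 2 * Real.pi := by positivity
  set L := Real.log ((x + 1 + B) / (2 * Real.pi)) with hL
  have key : ∀ (c : ℝ) (z : ℂ), |c| ≤ C → z + 1 = (x + 1 + B : ℝ) + c * Complex.I →
      ‖Complex.log ((z + 1) / (2 * Real.pi : ℝ)) - L‖ ≤ 8 / 100 := by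
    intro c z hc hz
    rw [hz]
    exact norm_log_add_mul_I_div_sub_log_le hpi ha (hc.trans hC1)
  have key0 : ‖Complex.log (((x : ℂ) + B + 1) / (2 * Real.pi : ℝ)) - L‖ ≤ 0 := by
    rw [hL, Complex.ofReal_log (div_nonneg (by linarith) hpi.le),
      show (x : ℂ) + B + 1 = (x + 1 + B : ℝ) by push_cast; ring, ← Complex.ofReal_div, sub_self,
      norm_zero]
  refine abs_poleKernel_re_sub_le (fun _ => (L : ℂ)) key0
    (key (-C) _ (by rw [abs_neg, abs_of_nonneg hC]) (by push_cast; ring))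
    (key C _ (by rw [abs_of_nonneg hC]) (by push_cast; ring)) rfl ?_
  have w1 : tiltWeight.re = -1 / 4 := by simp [tiltWeight]
  simp only [poleKernel, Complex.add_re, Complex.re_mul_ofReal, Complex.conj_re,
    Complex.ofReal_re, w1]
  ring

theorem norm_poleKernel_le {g : ℂ → ℂ} {w z : ℂ} {B C ε : ℝ} (h0 : ‖g (z + B)‖ ≤ ε)
    (h1 : ‖g (z + B - C * Complex.I)‖ ≤ ε) (h2 : ‖g (z + B + C * Complex.I)‖ ≤ ε) :
    ‖poleKernel w B C g z‖ ≤ (1 + 2 * ‖w‖) * ε := by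
  refine norm_add₃_le.trans ?_
  rw [norm_mul, norm_mul, Complex.norm_conj]
  have := mul_le_mul_of_nonneg_left h1 (norm_nonneg w)
  have := mul_le_mul_of_nonneg_left h2 (norm_nonneg w)
  linarith

theorem zeroKernel_re (m : ℝ) (w : ℂ) (B C : ℝ) (g : ℂ → ℂ) (z : ℂ) :
    (zeroKernel m w B C g z).re = (poleKernel w B C g z).re -
      27 / 25 * (poleKernel w B C g (z + (97 / 100 * m : ℝ))).re +
      59 / 100 * (poleKernel w B C g (z + (7 / 5 * m : ℝ))).re := by
  have c1 : (27 / 25 : ℂ) = ((27 / 25 : ℝ) : ℂ) := by norm_num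
  have c2 : (59 / 100 : ℂ) = ((59 / 100 : ℝ) : ℂ) := by norm_num
  simp only [zeroKernel, mixKernel, c1, c2, Complex.add_re, Complex.sub_re, Complex.re_ofReal_mul]

theorem poleKernel_poleGamma_re (w : ℂ) (B C : ℝ) (z : ℂ) :
    (poleKernel w B C poleGamma z).re = (poleInv w B C (z - 1)).re +
      (poleKernel w B C (fun z => Complex.log ((z + 1) / (2 * Real.pi : ℝ))) z).re / 2 +
      (poleKernel w B C stirlingError z).re / 2 := by
  have e : poleKernel w B C poleGamma z = poleInv w B C (z - 1) +
      (1 / 2 : ℝ) * poleKernel w B C (fun z => Complex.log ((z + 1) / (2 * Real.pi : ℝ))) z +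
      (1 / 2 : ℝ) * poleKernel w B C stirlingError z := by
    simp only [poleInv, poleKernel, poleGamma]
    push_cast
    ring_nf
  rw [e, Complex.add_re, Complex.add_re, Complex.re_ofReal_mul, Complex.re_ofReal_mul]
  ring

theorem poleKernel_tiltWeight_poleGamma_re_large {l r y : ℝ} (hl0 : 0 < l) (hl : l ≤ 33 / 1000)
    (hr : 0 ≤ r) (hr1 : r ≤ 7 / 5 * (1 - 2 * l)) (hy : 39 ≤ y) :
    |(poleKernel tiltWeight (5 * l) (23 / 5 * l) poleGamma ((1 - l + r : ℝ) + y * Complex.I)).re -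
      (1 / 4 * Real.log (y / (2 * Real.pi)) + (r - 3 / 5 * l) / 2 * (1 / y ^ 2))| ≤
      72 / 10 * (1 / y ^ 2) := by
  have hy0 : 0 < y := by linarith
  have hY : 0 < 1 / y ^ 2 := by positivity
  rw [poleKernel_poleGamma_re]
  have h1 := poleInv_tiltWeight_re_sub (B := 5 * l) (C := 23 / 5 * l) (x := r - l) (y := y)
      (r := 13 / 5) (by rw [abs_of_nonneg (by linarith), abs_of_nonneg (by linarith)]; linarith)
      (by rw [abs_of_pos hy0]; linarith)
  have e1 : ((1 - l + r : ℝ) : ℂ) + y * Complex.I - 1 = (r - l : ℝ) + y * Complex.I := by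
    push_cast; ring
  have e2 : (r - l + 5 * l - 23 / 5 * l) / (2 * y ^ 2) = (r - 3 / 5 * l) / 2 * (1 / y ^ 2) := by
    field_simp; ring
  have hε : 43 / 25 * ((13 / 5) ^ 3 / (|y| ^ 3 * (|y| - 13 / 5))) ≤ 3 / 100 * (1 / y ^ 2) := by
    rw [abs_of_pos hy0]
    have e : 3 / 100 * (1 / y ^ 2) = 43 / 25 * ((13 / 5) ^ 3 /
        (y ^ 3 * (43 / 25 * (13 / 5) ^ 3 * (100 / 3) / y))) := by
      field_simp
    rw [e]
    have h2 : 43 / 25 * (13 / 5) ^ 3 * (100 / 3) / y ≤ y - 13 / 5 := by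
      rw [div_le_iff₀ hy0]; nlinarith
    have h3 : 0 < 43 / 25 * (13 / 5 : ℝ) ^ 3 * (100 / 3) / y := by positivity
    gcongr
  rw [e2] at h1
  have h2 := poleKernel_tiltWeight_log_re_large (B := 5 * l) (C := 23 / 5 * l) (x := 1 - l + r)
    (y := y) (by linarith) (by linarith) (by linarith) hy
  have h3 : |(poleKernel tiltWeight (5 * l) (23 / 5 * l) stirlingError
      ((1 - l + r : ℝ) + y * Complex.I)).re| ≤ 43 / 25 * (102 / 100 * (1 / y ^ 2)) := by
    have key : ∀ (c : ℝ) (z : ℂ), |c| ≤ 1 / 5 → z = (1 - l + r + 5 * l : ℝ) + (y + c : ℝ) * Complex.I →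
        ‖stirlingError z‖ ≤ 102 / 100 * (1 / y ^ 2) := by
      rintro c z hc rfl
      have hc1 := (abs_le.1 hc).1
      have hre : (((1 - l + r + 5 * l : ℝ) : ℂ) + (y + c : ℝ) * Complex.I).re = 1 - l + r + 5 * l := by
        simp only [Complex.add_re, Complex.re_ofReal_mul, Complex.ofReal_re, Complex.I_re, mul_zero,
          add_zero]
      have him : (((1 - l + r + 5 * l : ℝ) : ℂ) + (y + c : ℝ) * Complex.I).im = y + c := by
        simp only [Complex.add_im, Complex.im_ofReal_mul, Complex.ofReal_im, Complex.I_im, mul_one,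
          zero_add]
      have h := norm_stirlingError_le_im (s := ((1 - l + r + 5 * l : ℝ) : ℂ) + (y + c : ℝ) * Complex.I)
        (by rw [hre]; linarith) (by rw [him]; linarith)
      rw [him] at h
      refine h.trans ?_
      rw [mul_one_div, div_le_div_iff₀ (pow_pos (by linarith) 2) (by positivity)]
      nlinarith
    refine (Complex.abs_re_le_norm _).trans ((norm_poleKernel_le
      (key 0 _ (by norm_num) (by push_cast; ring))
      (key (-(23 / 5 * l)) _ (by rw [abs_neg, abs_of_nonneg (by linarith)]; linarith)
        (by push_cast; ring))
      (key (23 / 5 * l) _ (by rw [abs_of_nonneg (by linarith)]; linarith)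
        (by push_cast; ring))).trans ?_)
    have := norm_tiltWeight_le
    gcongr
    linarith
  rw [e1]
  have h1 := abs_le.1 (h1.trans hε)
  have h2 := abs_le.1 h2
  have h3 := abs_le.1 h3
  rw [abs_le]
  constructor <;> linarith

theorem zeroKernel_tiltWeight_poleGamma_re_large {l y : ℝ} (hl0 : 0 < l) (hl : l ≤ 33 / 1000)
    (hy : 39 ≤ y) :
    (zeroKernel (1 - 2 * l) tiltWeight (5 * l) (23 / 5 * l) poleGamma
      ((1 - l : ℝ) + y * Complex.I)).re ≤
      51 / 400 * Real.log (y / (2 * Real.pi)) + 20 * (1 / y ^ 2) := by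
  have hY : 0 < 1 / y ^ 2 := by positivity
  have hlY : 0 ≤ l * (1 / y ^ 2) := by positivity
  have hlY' := mul_le_mul_of_nonneg_right hl hY.le
  have h0 := poleKernel_tiltWeight_poleGamma_re_large hl0 hl le_rfl (by linarith) hy
  have h1 := poleKernel_tiltWeight_poleGamma_re_large (r := 97 / 100 * (1 - 2 * l)) hl0 hl
    (by linarith) (by linarith) hy
  have h2 := poleKernel_tiltWeight_poleGamma_re_large (r := 7 / 5 * (1 - 2 * l)) hl0 hl
    (by linarith) le_rfl hy
  have e : ∀ r : ℝ, ((1 - l : ℝ) : ℂ) + y * Complex.I + r = (1 - l + r : ℝ) + y * Complex.I := by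
    intro r; push_cast; ring
  rw [add_zero] at h0
  rw [zeroKernel_re, e, e]
  have h0 := (abs_le.1 h0).2
  have h1 := (abs_le.1 h1).1
  have h2 := (abs_le.1 h2).2
  linarith

theorem zeroKernel_tiltWeight_poleGamma_re_zero {l : ℝ} (hl0 : 0 < l) (hl : l ≤ 33 / 1000) :
    (zeroKernel (1 - 2 * l) tiltWeight (5 * l) (23 / 5 * l) poleGamma ((1 - l : ℝ) : ℂ)).re ≤
      (poleInv tiltWeight (5 * l) (23 / 5 * l) (-l : ℝ)).re + 7 / 100 := by
  have hpi : 0 < 2 * Real.pi := by positivity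
  have hpi1 := Real.pi_gt_d4
  have hpi2 := Real.pi_lt_d4
  have hS : ∀ r : ℝ, 0 ≤ r → |(poleKernel tiltWeight (5 * l) (23 / 5 * l) stirlingError
      (1 - l + r : ℝ)).re| ≤ 43 / 25 * (1 / 16) := by
    intro r hr
    have key : ∀ (c : ℝ) (z : ℂ), z = (1 - l + r + 5 * l : ℝ) + c * Complex.I →
        ‖stirlingError z‖ ≤ 1 / 16 := by
      rintro c z rfl
      have hre : (((1 - l + r + 5 * l : ℝ) : ℂ) + c * Complex.I).re = 1 - l + r + 5 * l := by
        simp only [Complex.add_re, Complex.re_ofReal_mul, Complex.ofReal_re, Complex.I_re, mul_zero,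
          add_zero]
      have h := norm_stirlingError_le_re (s := ((1 - l + r + 5 * l : ℝ) : ℂ) + c * Complex.I)
        (by rw [hre]; linarith)
      rw [hre] at h
      refine h.trans ?_
      gcongr
      nlinarith
    refine (Complex.abs_re_le_norm _).trans ((norm_poleKernel_le
      (key 0 _ (by push_cast; ring)) (key (-(23 / 5 * l)) _ (by push_cast; ring))
      (key (23 / 5 * l) _ (by push_cast; ring))).trans ?_)
    have := norm_tiltWeight_le
    gcongr
    linarith
  have hL : ∀ r : ℝ, 0 ≤ r → _ := fun r hr =>
    poleKernel_tiltWeight_log_re_zero (B := 5 * l) (C := 23 / 5 * l) (x := 1 - l + r)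
      (by linarith) (by linarith) (by linarith)
  have hI := zeroInv_re_le_poleInv (m := 1 - 2 * l) (w := tiltWeight) (B := 5 * l)
    (C := 23 / 5 * l) (x := -l) (by linarith) (norm_tiltWeight_le.trans (by norm_num)) (by linarith)
  rw [zeroInv_ofReal_re] at hI
  have e : ∀ r : ℝ, ((1 - l : ℝ) : ℂ) + r = (1 - l + r : ℝ) := by intro r; push_cast; ring
  have e1 : ∀ r : ℝ, ((1 - l + r : ℝ) : ℂ) - 1 = (-l + r : ℝ) := by intro r; push_cast; ring
  have e2 : ((1 - l : ℝ) : ℂ) = (1 - l + 0 : ℝ) := by rw [add_zero]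
  rw [zeroKernel_re, e, e, e2, poleKernel_poleGamma_re, poleKernel_poleGamma_re,
    poleKernel_poleGamma_re, e1, e1, e1, add_zero (-l)]
  have s0 := (abs_le.1 (hS 0 le_rfl)).2
  have s1 := (abs_le.1 (hS (97 / 100 * (1 - 2 * l)) (by linarith))).1
  have s2 := (abs_le.1 (hS (7 / 5 * (1 - 2 * l)) (by linarith))).2
  have l0 := (abs_le.1 (hL 0 le_rfl)).2
  have l1 := (abs_le.1 (hL (97 / 100 * (1 - 2 * l)) (by linarith))).1
  have l2 := (abs_le.1 (hL (7 / 5 * (1 - 2 * l)) (by linarith))).2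
  have g0 : Real.log ((1 - l + 0 + 1 + 5 * l) / (2 * Real.pi)) ≤ -(107 / 100) := by
    rw [Real.log_le_iff_le_exp (div_pos (by linarith) hpi), div_le_iff₀ hpi]
    have h : (34 / 100 : ℝ) ≤ Real.exp (-(107 / 100)) := by
      rw [show (-(107 / 100) : ℝ) = -1 + -(7 / 100) by norm_num, Real.exp_add]
      nlinarith [Real.exp_neg_one_gt_d9, Real.add_one_le_exp (-(7 / 100) : ℝ)]
    nlinarith
  have g1 : -(75 / 100) ≤
      Real.log ((1 - l + 97 / 100 * (1 - 2 * l) + 1 + 5 * l) / (2 * Real.pi)) := by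
    rw [Real.le_log_iff_exp_le (div_pos (by linarith) hpi), le_div_iff₀ hpi]
    have h : (2116 / 1000 : ℝ) ≤ Real.exp (75 / 100) := by
      refine le_trans ?_ (Real.sum_le_exp_of_nonneg (by norm_num) 6)
      norm_num [Finset.sum_range_succ, Nat.factorial]
    have h' : Real.exp (-(75 / 100)) * Real.exp (75 / 100) = 1 := by
      rw [← Real.exp_add]; norm_num
    have h'' := Real.exp_pos (-(75 / 100))
    nlinarith
  have g2 : Real.log ((1 - l + 7 / 5 * (1 - 2 * l) + 1 + 5 * l) / (2 * Real.pi)) ≤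
      -(6 / 10) := by
    rw [Real.log_le_iff_le_exp (div_pos (by linarith) hpi), div_le_iff₀ hpi]
    have h : (149 / 100 : ℝ) ≤ Real.exp (4 / 10) := by
      refine le_trans ?_ (Real.sum_le_exp_of_nonneg (by norm_num) 4)
      norm_num [Finset.sum_range_succ, Nat.factorial]
    have h' : (548 / 1000 : ℝ) ≤ Real.exp (-(6 / 10)) := by
      rw [show (-(6 / 10) : ℝ) = -1 + 4 / 10 by norm_num, Real.exp_add]
      nlinarith [Real.exp_neg_one_gt_d9]
    nlinarith
  linarith

theorem poleKernel_zero (B : ℝ) (g : ℂ → ℂ) (z : ℂ) : poleKernel 0 B 0 g z = g (z + B) := by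
  simp [poleKernel]

theorem log_norm_add_mul_I_div {a y r : ℝ} (hr : 0 < r) (hy : 0 < y) :
    Real.log (y / r) ≤ Real.log ‖((a : ℂ) + y * Complex.I) / r‖ ∧
      Real.log ‖((a : ℂ) + y * Complex.I) / r‖ ≤ Real.log (y / r) + a ^ 2 / 2 * (1 / y ^ 2) := by
  have hn : ‖((a : ℂ) + y * Complex.I) / r‖ = √(a ^ 2 + y ^ 2) / r := by
    rw [norm_div, Complex.norm_add_mul_I, Complex.norm_real, Real.norm_of_nonneg hr.le]
  rw [hn]
  constructor
  · apply Real.log_le_log (by positivity)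
    gcongr
    exact Real.le_sqrt_of_sq_le (by nlinarith [sq_nonneg a])
  · have hq : 0 ≤ a ^ 2 / 2 * (1 / y ^ 2) := by positivity
    have h1 : √(a ^ 2 + y ^ 2) ≤ y * (1 + a ^ 2 / 2 * (1 / y ^ 2)) := by
      refine Real.sqrt_le_iff.2 ⟨by positivity, ?_⟩
      have e : (y * (1 + a ^ 2 / 2 * (1 / y ^ 2))) ^ 2 =
          a ^ 2 + y ^ 2 + (y * (a ^ 2 / 2 * (1 / y ^ 2))) ^ 2 := by
        field_simp; ring
      rw [e]
      nlinarith [sq_nonneg (y * (a ^ 2 / 2 * (1 / y ^ 2)))]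
    have h2 : √(a ^ 2 + y ^ 2) / r ≤ y / r * (1 + a ^ 2 / 2 * (1 / y ^ 2)) := by
      rw [div_mul_eq_mul_div]; gcongr
    refine (Real.log_le_log (by positivity) h2).trans ?_
    rw [Real.log_mul (by positivity) (by positivity)]
    have := Real.log_le_sub_one_of_pos (x := 1 + a ^ 2 / 2 * (1 / y ^ 2)) (by positivity)
    linarith

theorem poleGamma_re_large {a y : ℝ} (ha : 0 ≤ a) (hy : 0 < y) :
    1 / 2 * Real.log (y / (2 * Real.pi)) - 1 / 2 * (1 / y ^ 2) ≤
      (poleGamma ((1 + a : ℝ) + y * Complex.I)).re ∧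
    (poleGamma ((1 + a : ℝ) + y * Complex.I)).re ≤ 1 / 2 * Real.log (y / (2 * Real.pi)) +
      (a + (2 + a) ^ 2 / 4 + 1 / 2) * (1 / y ^ 2) := by
  have hpi : 0 < 2 * Real.pi := by positivity
  have e1 : ((1 + a : ℝ) : ℂ) + y * Complex.I - 1 = a + y * Complex.I := by push_cast; ring
  have e2 : (((1 + a : ℝ) : ℂ) + y * Complex.I + 1) / (2 * Real.pi) =
      ((2 + a : ℝ) + y * Complex.I) / (2 * Real.pi : ℝ) := by push_cast; ring
  have hre : (((1 + a : ℝ) : ℂ) + y * Complex.I).re = 1 + a := by simp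
  have him : (((1 + a : ℝ) : ℂ) + y * Complex.I).im = y := by simp
  have hE := norm_stirlingError_le_im (s := ((1 + a : ℝ) : ℂ) + y * Complex.I)
    (by rw [hre]; linarith) (by rw [him]; exact hy.ne')
  rw [him] at hE
  have hE' := abs_le.1 ((Complex.abs_re_le_norm _).trans hE)
  have hlog := log_norm_add_mul_I_div (a := 2 + a) hpi hy
  have hinv : (1 / ((a : ℂ) + y * Complex.I)).re = a / (a ^ 2 + y ^ 2) := by
    rw [one_div, Complex.inv_re, Complex.normSq_add_mul_I]; simp
  have hi0 : 0 ≤ a / (a ^ 2 + y ^ 2) := by positivity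
  have hi1 : a / (a ^ 2 + y ^ 2) ≤ a * (1 / y ^ 2) := by
    rw [mul_one_div]; gcongr; nlinarith [sq_nonneg a]
  have e : (poleGamma (((1 + a : ℝ) : ℂ) + y * Complex.I)).re = a / (a ^ 2 + y ^ 2) +
      Real.log ‖(((2 + a : ℝ) : ℂ) + y * Complex.I) / (2 * Real.pi : ℝ)‖ / 2 +
      (stirlingError (((1 + a : ℝ) : ℂ) + y * Complex.I)).re / 2 := by
    rw [poleGamma, e1, e2, Complex.add_re, Complex.add_re, hinv, Complex.div_ofNat_re,
      Complex.div_ofNat_re, Complex.log_re]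
  rw [e]
  constructor
  · linarith [hlog.1]
  · linarith [hlog.2]

theorem zeroKernel_zero_poleGamma_re_large {B y : ℝ} (hB0 : 0 < B) (hB : B ≤ 37 / 100)
    (hy : 0 < y) :
    (zeroKernel 1 0 B 0 poleGamma (1 + y * Complex.I)).re ≤
      51 / 200 * Real.log (y / (2 * Real.pi)) + 63 / 10 * (1 / y ^ 2) := by
  have hY : 0 < 1 / y ^ 2 := by positivity
  have e : ∀ r : ℝ, (1 : ℂ) + y * Complex.I + r + B = (1 + (r + B) : ℝ) + y * Complex.I := by
    intro r; push_cast; ring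
  have e0 : (1 : ℂ) + y * Complex.I + B = (1 + B : ℝ) + y * Complex.I := by
    push_cast; ring
  rw [zeroKernel_re, poleKernel_zero, poleKernel_zero, poleKernel_zero, e, e, e0]
  have h0 := (poleGamma_re_large (a := B) hB0.le hy).2
  have h1 := (poleGamma_re_large (a := 97 / 100 * 1 + B) (by linarith) hy).1
  have h2 := (poleGamma_re_large (a := 7 / 5 * 1 + B) (by linarith) hy).2
  have c0 : (B + (2 + B) ^ 2 / 4 + 1 / 2) * (1 / y ^ 2) ≤ 2275 / 1000 * (1 / y ^ 2) := by
    gcongr; nlinarith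
  have c2 : (7 / 5 * 1 + B + (2 + (7 / 5 * 1 + B)) ^ 2 / 4 + 1 / 2) * (1 / y ^ 2) ≤
      5824 / 1000 * (1 / y ^ 2) := by
    gcongr; nlinarith
  linarith

theorem poleGamma_ofReal_re {a : ℝ} (ha : 0 ≤ a) :
    |(poleGamma (1 + a : ℝ)).re - (1 / a + Real.log ((2 + a) / (2 * Real.pi)) / 2)| ≤
      1 / (8 * (2 + a) ^ 2) := by
  have hpi : 0 < 2 * Real.pi := by positivity
  have hE := norm_stirlingError_le_re (s := ((1 + a : ℝ) : ℂ)) (by simpa using ha)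
  have e : (poleGamma (1 + a : ℝ)).re - (1 / a + Real.log ((2 + a) / (2 * Real.pi)) / 2) =
      (stirlingError (1 + a : ℝ)).re / 2 := by
    have e1 : ((1 + a : ℝ) : ℂ) - 1 = a := by push_cast; ring
    have e2 : (((1 + a : ℝ) : ℂ) + 1) / (2 * Real.pi) = ((2 + a) / (2 * Real.pi) : ℝ) := by
      push_cast; ring
    rw [poleGamma, e1, e2, ← Complex.ofReal_log (by positivity), Complex.add_re, Complex.add_re,
      Complex.div_ofNat_re, Complex.div_ofNat_re, ← Complex.ofReal_one, ← Complex.ofReal_div,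
      Complex.ofReal_re, Complex.ofReal_re]
    ring
  rw [e, abs_div, abs_two]
  have := (Complex.abs_re_le_norm _).trans hE
  rw [Complex.ofReal_re] at this
  calc _ ≤ 1 / (4 * (1 + a + 1) ^ 2) / 2 := by gcongr
    _ = _ := by
      have : 2 + a ≠ 0 := by positivity
      have : 1 + a + 1 ≠ 0 := by positivity
      field_simp
      ring

theorem zeroKernel_zero_poleGamma_re_one {B : ℝ} (hB0 : 0 < B) (hB : B ≤ 37 / 100) :
    (zeroKernel 1 0 B 0 poleGamma 1).re ≤ 1 / B - 17 / 100 := by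
  have hpi : 0 < 2 * Real.pi := by positivity
  have hpi1 := Real.pi_gt_d4
  have hpi2 := Real.pi_lt_d4
  have e : ∀ r : ℝ, (1 : ℂ) + r + B = (1 + (r + B) : ℝ) := by intro r; push_cast; ring
  have e0 : (1 : ℂ) + B = (1 + B : ℝ) := by push_cast; ring
  rw [zeroKernel_re, poleKernel_zero, poleKernel_zero, poleKernel_zero, e, e, e0]
  have h0 := (abs_le.1 (poleGamma_ofReal_re (a := B) hB0.le)).2
  have h1 := (abs_le.1 (poleGamma_ofReal_re (a := 97 / 100 * 1 + B) (by linarith))).1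
  have h2 := (abs_le.1 (poleGamma_ofReal_re (a := 7 / 5 * 1 + B) (by linarith))).2
  have b0 : 1 / (8 * (2 + B) ^ 2) ≤ 1 / 32 := by
    rw [div_le_div_iff₀ (by positivity) (by positivity)]; nlinarith
  have b1 : 1 / (8 * (2 + (97 / 100 * 1 + B)) ^ 2) ≤ 1 / 70 := by
    rw [div_le_div_iff₀ (by positivity) (by positivity)]; nlinarith
  have b2 : 1 / (8 * (2 + (7 / 5 * 1 + B)) ^ 2) ≤ 1 / 92 := by
    rw [div_le_div_iff₀ (by positivity) (by positivity)]; nlinarith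
  have hI := zeroInv_re_le_poleInv (m := 1) (w := 0) (B := B) (C := 0) (x := 0) (by norm_num)
    (by simp) (by linarith)
  rw [zeroInv_ofReal_re, poleInv_zero_ofReal_re, poleInv_zero_ofReal_re, poleInv_zero_ofReal_re] at hI
  simp only [zero_add] at hI
  have g0 : Real.log ((2 + B) / (2 * Real.pi)) ≤ -(97 / 100) := by
    rw [Real.log_le_iff_le_exp (div_pos (by linarith) hpi), div_le_iff₀ hpi]
    have h : (378 / 1000 : ℝ) ≤ Real.exp (-(97 / 100)) := by
      rw [show (-(97 / 100) : ℝ) = -1 + 3 / 100 by norm_num, Real.exp_add]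
      nlinarith [Real.exp_neg_one_gt_d9, Real.add_one_le_exp (3 / 100 : ℝ)]
    nlinarith
  have g1 : -(75 / 100) ≤ Real.log ((2 + (97 / 100 * 1 + B)) / (2 * Real.pi)) := by
    rw [Real.le_log_iff_exp_le (div_pos (by linarith) hpi), le_div_iff₀ hpi]
    have h : (2116 / 1000 : ℝ) ≤ Real.exp (75 / 100) := by
      refine le_trans ?_ (Real.sum_le_exp_of_nonneg (by norm_num) 6)
      norm_num [Finset.sum_range_succ, Nat.factorial]
    have h' : Real.exp (-(75 / 100)) * Real.exp (75 / 100) = 1 := by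
      rw [← Real.exp_add]; norm_num
    have h'' := Real.exp_pos (-(75 / 100))
    nlinarith
  have g2 : Real.log ((2 + (7 / 5 * 1 + B)) / (2 * Real.pi)) ≤ -(1 / 2) := by
    rw [Real.log_le_iff_le_exp (div_pos (by linarith) hpi), div_le_iff₀ hpi]
    have h : (164 / 100 : ℝ) ≤ Real.exp (1 / 2) := by
      refine le_trans ?_ (Real.sum_le_exp_of_nonneg (by norm_num) 4)
      norm_num [Finset.sum_range_succ, Nat.factorial]
    have h' : (603 / 1000 : ℝ) ≤ Real.exp (-(1 / 2)) := by
      rw [show (-(1 / 2) : ℝ) = -1 + 1 / 2 by norm_num, Real.exp_add]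
      nlinarith [Real.exp_neg_one_gt_d9]
    nlinarith
  linarith

theorem le_log_two_pi : 1835 / 1000 ≤ Real.log (2 * Real.pi) := by
  rw [Real.le_log_iff_exp_le (by positivity)]
  have h : (117936 / 100000 : ℝ) ≤ Real.exp (165 / 1000) := by
    refine le_trans ?_ (Real.sum_le_exp_of_nonneg (by norm_num) 5)
    norm_num [Finset.sum_range_succ, Nat.factorial]
  have e : Real.exp (1835 / 1000) * Real.exp (165 / 1000) = Real.exp 1 * Real.exp 1 := by
    rw [← Real.exp_add, ← Real.exp_add]; norm_num
  have h1 : Real.exp 1 * Real.exp 1 ≤ 7.3891 := by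
    have := Real.exp_one_lt_d9
    have := Real.exp_pos 1
    nlinarith
  have := Real.pi_gt_d4
  have := Real.exp_pos (1835 / 1000)
  nlinarith

theorem le_log_five : 16 / 10 ≤ Real.log 5 := by
  rw [Real.le_log_iff_exp_le (by positivity)]
  have h : (149 / 100 : ℝ) ≤ Real.exp (4 / 10) := by
    refine le_trans ?_ (Real.sum_le_exp_of_nonneg (by norm_num) 4)
    norm_num [Finset.sum_range_succ, Nat.factorial]
  have e : Real.exp (16 / 10) * Real.exp (4 / 10) = Real.exp 1 * Real.exp 1 := by
    rw [← Real.exp_add, ← Real.exp_add]; norm_num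
  have h1 : Real.exp 1 * Real.exp 1 ≤ 7.3891 := by
    have := Real.exp_one_lt_d9
    have := Real.exp_pos 1
    nlinarith
  have := Real.exp_pos (16 / 10)
  nlinarith

theorem log_three_le : Real.log 3 ≤ 11 / 10 := by
  rw [Real.log_le_iff_le_exp (by positivity)]
  refine le_trans ?_ (Real.sum_le_exp_of_nonneg (by norm_num) 6)
  norm_num [Finset.sum_range_succ, Nat.factorial]

theorem trigSum_log_le {t : ℝ} (ht : 0 < t) :
    2.448 * Real.log (1 * t / (2 * Real.pi)) + 1.49 * Real.log (2 * t / (2 * Real.pi)) +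
      0.6 * Real.log (3 * t / (2 * Real.pi)) + 0.125 * Real.log (4 * t / (2 * Real.pi)) ≤
      4.663 * Real.log t - 6.69 := by
  have hpi : 2 * Real.pi ≠ 0 := by positivity
  have e : ∀ k : ℝ, 0 < k → Real.log (k * t / (2 * Real.pi)) =
      Real.log k + Real.log t - Real.log (2 * Real.pi) := by
    intro k hk
    rw [Real.log_div (by positivity) hpi, Real.log_mul hk.ne' ht.ne']
  have h4 : Real.log 4 = 2 * Real.log 2 := by
    rw [show (4 : ℝ) = 2 ^ 2 by norm_num, Real.log_pow]; norm_num
  rw [e 1 one_pos, e 2 two_pos, e 3 (by norm_num), e 4 (by norm_num), Real.log_one, h4]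
  linarith [Real.log_two_lt_d9, log_three_le, le_log_two_pi]

theorem zeroKernel_large_sum_le {f : ℝ → ℝ} {a b t : ℝ} (ht : 0 < t) (ha : 0 ≤ a) (hb : 0 ≤ b)
    (h : ∀ k : ℝ, 1 ≤ k → k ≤ 4 → f k ≤ a * Real.log (k * t / (2 * Real.pi)) + b * (1 / (k * t) ^ 2)) :
    trigSum f ≤ 1.4379 * f 0 + a * (4.663 * Real.log t - 6.69) + 2.8951 * b * (1 / t ^ 2) := by
  have hT := mul_le_mul_of_nonneg_left (trigSum_log_le ht) ha
  have h1 := h 1 (by norm_num) (by norm_num)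
  have h2 := h 2 (by norm_num) (by norm_num)
  have h3 := h 3 (by norm_num) (by norm_num)
  have h4 := h 4 (by norm_num) (by norm_num)
  have e : ∀ k : ℝ, b * (1 / (k * t) ^ 2) = 1 / k ^ 2 * (b * (1 / t ^ 2)) := by
    intro k; rw [mul_pow, ← one_div_mul_one_div]; ring
  rw [e] at h1 h2 h3 h4
  norm_num at h2 h3 h4 hT ⊢
  norm_num at h1
  have hb'' : 0 ≤ b * (t ^ 2)⁻¹ := by positivity
  simp only [trigSum]
  linarith

theorem inv_sub_le_of_zero {ρ : ℂ} {B : ℝ} (h0 : entireXi ρ = 0) (hρ : 4 / 5 ≤ ρ.re)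
    (ht : 5 ≤ ρ.im) (hB0 : 0 < B) (hB : B ≤ 37 / 100) :
    2.448 * (1 / (1 - ρ.re + B) - 62 / 100 * (1 - ρ.re)) ≤
      1.4379 * (1 / B) + 1.1891 * Real.log ρ.im - 1.95 + 18.24 * (1 / ρ.im ^ 2) := by
  have hL : 0 ≤ Real.log ρ.im := Real.log_nonneg (by linarith)
  have hF := poleInv_zero_mul_I_re_nonneg hB0
  have h1 := (re_mem_of_entireXi_eq_zero h0).2
  have hmain := zeroPair_le_trigSum_poleGamma (m := 1) (B := B) (C := 0) (σ := 1) (w := 0)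
    (ρ₀ := ρ) (by norm_num) (by linarith) (by norm_num) (by simp)
    (fun k _ _ z hz => by
      have hz := re_mem_of_entireXi_eq_zero hz
      have hre : ((1 : ℝ) + (k * ρ.im : ℝ) * Complex.I - z).re = 1 - z.re := by
        simp only [Complex.sub_re, Complex.add_re, Complex.re_ofReal_mul, Complex.ofReal_re,
          Complex.I_re, mul_zero, add_zero]
      exact zeroInv_add_re_nonneg hB0 (by linarith) hF (by rw [hre]; linarith)
        (by rw [hre]; linarith))
    h0 (by linarith)
  have hlow := poleInv_re_le_zeroPair (m := 1) (w := 0) (C := 0) (x := 1 - ρ.re) (by norm_num)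
    (by simp) hB0 (by linarith) hF (by linarith) (by linarith)
  rw [poleInv_zero_ofReal_re] at hlow
  have hsum := zeroKernel_large_sum_le (t := ρ.im) (a := 51 / 200) (b := 63 / 10)
    (f := fun k => (zeroKernel 1 0 B 0 poleGamma ((1 : ℝ) + (k * ρ.im : ℝ) * Complex.I)).re)
    (by linarith) (by norm_num) (by norm_num)
    (fun k hk _ => by
      have := zeroKernel_zero_poleGamma_re_large hB0 hB (y := k * ρ.im) (by nlinarith)
      simpa only [Complex.ofReal_one] using this)
  have hz := zeroKernel_zero_poleGamma_re_one hB0 hB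
  have e0 : ((1 : ℝ) : ℂ) + (0 * ρ.im : ℝ) * Complex.I = 1 := by simp
  simp only [e0] at hsum
  have hm := hmain.trans hsum
  simp only [norm_zero, mul_zero, add_zero, mul_one, one_pow, div_one] at hlow
  have hY : 0 ≤ 1 / ρ.im ^ 2 := by positivity
  linarith

theorem inv_sub_le_of_zero_of_mul_le {ρ : ℂ} {P : ℝ} (h0 : entireXi ρ = 0) (ht : 5 ≤ ρ.im)
    (hP : 89 / 10 ≤ P) (h : (1 - ρ.re) * P ≤ 1) :
    0.13357 * P ≤ 1.1891 * Real.log ρ.im - 1.95 + 18.24 * (1 / ρ.im ^ 2) + 1.518 * (1 / P) := by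
  have hP0 : 0 < P := by linarith
  have hx : 1 - ρ.re ≤ 1 / P := by rwa [le_div_iff₀ hP0]
  have hx0 := (re_mem_of_entireXi_eq_zero h0).2
  have hP1 : 1 / P ≤ 10 / 89 := by rw [div_le_div_iff₀ hP0 (by norm_num)]; linarith
  have hm := inv_sub_le_of_zero (B := 3.27 * (1 / P)) h0 (by linarith) ht (by positivity)
    (by linarith)
  have e1 : 1 / (3.27 * (1 / P)) = P / 3.27 := by field_simp
  have e2 : P / 4.27 ≤ 1 / (1 - ρ.re + 3.27 * (1 / P)) := by
    have : 1 - ρ.re + 3.27 * (1 / P) ≤ 4.27 * (1 / P) := by linarith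
    refine le_trans (le_of_eq ?_) (one_div_le_one_div_of_le (add_pos (by linarith) (by positivity)) this)
    field_simp
  rw [e1] at hm
  have hP2 : 0 < 1 / P := by positivity
  generalize 1 / (1 - ρ.re + 3.27 * (1 / P)) = Q at hm e2
  generalize 1 / P = q at *
  norm_num at hm e2 ⊢
  linarith

theorem log_im_of_zero {ρ : ℂ} (h0 : entireXi ρ = 0) (ht : 5 ≤ ρ.im)
    (h : (1 - ρ.re) * (5.573412 * Real.log ρ.im) ≤ 1) : 368 / 100 ≤ Real.log ρ.im := by
  set L := Real.log ρ.im with hL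
  have hL0 : 16 / 10 ≤ L := le_log_five.trans (Real.log_le_log (by norm_num) ht)
  have hm := inv_sub_le_of_zero_of_mul_le h0 ht (by linarith) h
  rw [← hL] at hm
  have a1 : 1 / ρ.im ^ 2 ≤ 1 / 5 ^ 2 := by gcongr
  have a2 : 1 / (5.573412 * L) ≤ 1 / (5.573412 * (16 / 10)) := by gcongr
  have hL1 : 23 / 10 ≤ L := by norm_num at a1 a2 hm ⊢; linarith
  have hexp : (99 / 10 : ℝ) ≤ ρ.im := by
    have : Real.exp (23 / 10) ≤ ρ.im := by
      rwa [← Real.le_log_iff_exp_le (by linarith)]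
    refine le_trans ?_ this
    refine le_trans ?_ (Real.sum_le_exp_of_nonneg (by norm_num) 9)
    norm_num [Finset.sum_range_succ, Nat.factorial]
  have a1 : 1 / ρ.im ^ 2 ≤ 1 / (99 / 10) ^ 2 := by gcongr
  have a2 : 1 / (5.573412 * L) ≤ 1 / (5.573412 * (23 / 10)) := by gcongr
  norm_num at a1 a2 hm ⊢; linarith

theorem one_lt_mul_log_of_zero {ρ : ℂ} (h0 : entireXi ρ = 0) (ht : 5 ≤ ρ.im) :
    1 < (1 - ρ.re) * (20 * Real.log ρ.im) := by
  by_contra! h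
  set L := Real.log ρ.im with hL
  have hL0 : 16 / 10 ≤ L := le_log_five.trans (Real.log_le_log (by norm_num) ht)
  have hm := inv_sub_le_of_zero_of_mul_le h0 ht (by linarith) h
  rw [← hL] at hm
  have a1 : 1 / ρ.im ^ 2 ≤ 1 / 5 ^ 2 := by gcongr
  have a2 : 1 / (20 * L) ≤ 1 / (20 * (16 / 10)) := by gcongr
  norm_num at a1 a2 hm
  linarith

/-- The value at distance `v` of the kernel attached to `tiltWeight`, after rescaling. -/
noncomputable def tiltProfile (v : ℝ) : ℝ := 1 / v - (v - 23 / 5) / (2 * (v ^ 2 + (23 / 5) ^ 2))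

theorem poleInv_tiltWeight_eq_tiltProfile {l v : ℝ} (hl : 0 < l) (hv : 0 < v) :
    (poleInv tiltWeight (5 * l) (23 / 5 * l) ((v - 5) * l : ℝ)).re = tiltProfile v / l := by
  have e : (v - 5) * l + 5 * l = v * l := by ring
  rw [poleInv_tiltWeight_ofReal_re (by rw [e]; positivity), e, tiltProfile]
  field_simp

theorem lt_tiltProfile {p : ℝ} (hp : 1 ≤ p) (hp' : p ≤ 149 / 100) :
    0.59454 * (29 / 18 / p - 11 / 18) <
      5.573412 * (2.448 * tiltProfile (1.0005 * p + 4) - 0.37109) := by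
  have hp0 : 0 < p := by linarith
  obtain ⟨q, rfl⟩ : ∃ q, p = 1 + q := ⟨p - 1, by ring⟩
  have hq : 0 ≤ q := by linarith
  have hq' : q ≤ 49 / 100 := by linarith
  have hv : 0 < 1.0005 * (1 + q) + 4 := by positivity
  have h2 : q ^ 2 ≤ 49 / 100 * q := by nlinarith
  have h3 : q ^ 3 ≤ 49 / 100 * q := by nlinarith
  have h4 : q ^ 4 ≤ 49 / 100 * q := by nlinarith
  rw [tiltProfile, ← sub_pos]
  have e : 5.573412 * (2.448 * (1 / (1.0005 * (1 + q) + 4) - (1.0005 * (1 + q) + 4 - 23 / 5) /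
      (2 * ((1.0005 * (1 + q) + 4) ^ 2 + (23 / 5) ^ 2))) - 0.37109) -
      0.59454 * (29 / 18 / (1 + q) - 11 / 18) =
      ((1 + q) * (5.573412 * (2.448 * (2 * ((1.0005 * (1 + q) + 4) ^ 2 + (23 / 5) ^ 2) -
        (1.0005 * (1 + q) + 4) * (1.0005 * (1 + q) + 4 - 23 / 5)) - 0.37109 *
        ((1.0005 * (1 + q) + 4) * (2 * ((1.0005 * (1 + q) + 4) ^ 2 + (23 / 5) ^ 2))))) -
        0.59454 * (29 / 18 - 11 / 18 * (1 + q)) *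
        ((1.0005 * (1 + q) + 4) * (2 * ((1.0005 * (1 + q) + 4) ^ 2 + (23 / 5) ^ 2)))) /
      ((1 + q) * ((1.0005 * (1 + q) + 4) * (2 * ((1.0005 * (1 + q) + 4) ^ 2 + (23 / 5) ^ 2)))) := by
    field_simp
  rw [e]
  apply div_pos _ (by positivity)
  ring_nf
  linarith

theorem lt_of_lt_tiltProfile {R L l : ℝ} (hR : 5.573412 ≤ R) (hL : 368 / 100 ≤ L) (hl0 : 0 < l)
    (hlRM : l * (R * (L + 9 / 5)) = 1) :
    1.4379 * (tiltProfile 4 / l) + 0.59454 * (L - 1.1) <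
      2.448 * (tiltProfile (1.0005 * ((L + 9 / 5) / L) + 4) / l) := by
  have hL0 : 0 < L := by linarith
  have hM : 0 < L + 9 / 5 := by linarith
  set p := (L + 9 / 5) / L with hp
  have hp1 : 1 ≤ p := by rw [hp, one_le_div hL0]; linarith
  have hp2 : p ≤ 149 / 100 := by rw [hp, div_le_iff₀ hL0]; linarith
  have hprof := lt_tiltProfile hp1 hp2
  have hΦ4' : tiltProfile 4 ≤ 0.258075 := by norm_num [tiltProfile]
  by_contra hineq
  have hq : 29 / 18 / p - 11 / 18 = (L - 1.1) / (L + 9 / 5) := by rw [hp]; field_simp; ring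
  have hlR : l * (L - 1.1) * 5.573412 ≤ (L - 1.1) / (L + 9 / 5) := by
    rw [le_div_iff₀ hM]
    have h1 : l * (5.573412 * (L + 9 / 5)) ≤ 1 := by
      refine le_of_le_of_eq ?_ hlRM
      exact mul_le_mul_of_nonneg_left (mul_le_mul_of_nonneg_right hR hM.le) hl0.le
    have h2 : 0 ≤ L - 1.1 := by norm_num at hL ⊢; linarith
    nlinarith
  have hscale := mul_le_mul_of_nonneg_left (not_lt.1 hineq) hl0.le
  have e1 : l * (2.448 * (tiltProfile (1.0005 * p + 4) / l)) =
      2.448 * tiltProfile (1.0005 * p + 4) := by field_simp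
  have e2 : l * (1.4379 * (tiltProfile 4 / l) + 0.59454 * (L - 1.1)) =
      1.4379 * tiltProfile 4 + 0.59454 * (l * (L - 1.1)) := by field_simp
  rw [e1, e2] at hscale
  rw [hq] at hprof
  norm_num at hscale hprof hlR hΦ4'
  linarith

theorem log_six_le : Real.log 6 ≤ 9 / 5 := by
  rw [show (6 : ℝ) = 2 * 3 by norm_num, Real.log_mul two_ne_zero (by norm_num)]
  linarith [Real.log_two_lt_d9, log_three_le]

theorem entireXi_mirror {z : ℂ} (h : entireXi z = 0) : entireXi (1 - z) = 0 := by
  rwa [entireXi_one_sub]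

/-- An extremal zero for the shape `1 - 1 / (R log |t|)` forces a contradiction. -/
theorem false_of_extremal_zero {R : ℝ} {ρ : ℂ} (hR : 5.573412 ≤ R)
    (hsmall : ∀ z, entireXi z = 0 → z.re ≠ 1 / 2 → 5 ≤ |z.im|)
    (hz : ∀ z, entireXi z = 0 → z.re ≠ 1 / 2 → 1 ≤ (1 - z.re) * (R * Real.log |z.im|))
    (h0 : entireXi ρ = 0) (ht : 39 ≤ ρ.im) (hL : 368 / 100 ≤ Real.log ρ.im)
    (hρ : (1 - ρ.re) * (R * Real.log ρ.im) ≤ 1.0005) : False := by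
  set t := ρ.im with ht'
  set L := Real.log t with hL'
  have ht0 : 0 < t := by linarith
  have hL0 : 0 < L := by linarith
  have hR0 : 0 < R := by linarith
  have hM : 0 < L + 9 / 5 := by linarith
  have hRM : (5.573412 : ℝ) * (548 / 100) ≤ R * (L + 9 / 5) := by gcongr; linarith
  obtain ⟨l, hl⟩ : ∃ l, l = 1 / (R * (L + 9 / 5)) := ⟨_, rfl⟩
  have hl0 : 0 < l := by rw [hl]; positivity
  have hl1 : l ≤ 33 / 1000 := by
    rw [hl, div_le_div_iff₀ (by positivity) (by norm_num)]; linarith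
  have hlRM : l * (R * (L + 9 / 5)) = 1 := by rw [hl]; field_simp
  have hnear : ∀ z, entireXi z = 0 → |z.im| ≤ 6 * t → l ≤ 1 - z.re := by
    intro z hz0 hzt
    by_cases hhalf : z.re = 1 / 2
    · rw [hhalf]; linarith
    have h5 := hsmall z hz0 hhalf
    have hlog : Real.log |z.im| ≤ L + 9 / 5 := by
      have := Real.log_le_log (by linarith) hzt
      rw [Real.log_mul (by norm_num) ht0.ne'] at this
      linarith [log_six_le]
    have hzre := (re_mem_of_entireXi_eq_zero hz0).2
    rw [hl, div_le_iff₀ (by positivity)]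
    refine (hz z hz0 hhalf).trans ?_
    have : 0 ≤ 1 - z.re := by linarith
    gcongr
  have hw := norm_tiltWeight_le
  have hF := poleInv_tiltWeight_mul_I_re_nonneg hl0
  have hδl := hnear ρ h0 (by rw [abs_of_pos (by linarith)]; linarith)
  -- the distance of the extremal zero
  set p := (L + 9 / 5) / L with hp
  have hp1 : 1 ≤ p := by rw [hp, one_le_div hL0]; linarith
  have hp2 : p ≤ 149 / 100 := by rw [hp, div_le_iff₀ hL0]; linarith
  have hδ : 1 - ρ.re ≤ 1.0005 * p * l := by
    have e : 1.0005 * p * l = 1.0005 / (R * L) := by rw [hp, hl]; field_simp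
    rw [e, le_div_iff₀ (by positivity)]; exact hρ
  have hx : 1 - l - ρ.re ≤ (1.0005 * p + 4 - 5) * l := by linarith
  have hxl : (1.0005 * p + 4 - 5) * l ≤ 0.491 * 0.033 := by
    have : 1.0005 * p + 4 - 5 ≤ 0.491 := by linarith
    have h := mul_le_mul this hl1 hl0.le (by norm_num)
    norm_num at h ⊢; exact h
  have hmain := zeroPair_le_trigSum_poleGamma (m := 1 - 2 * l) (B := 5 * l) (C := 23 / 5 * l)
    (σ := 1 - l) (w := tiltWeight) (ρ₀ := ρ) (by linarith) (by linarith) (by ring) (by linarith)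
    (fun k hk0 hk4 z hz0 => by
      have hre : (((1 - l : ℝ) : ℂ) + (k * ρ.im : ℝ) * Complex.I - z).re = 1 - l - z.re := by
        simp only [Complex.sub_re, Complex.add_re, Complex.re_ofReal_mul, Complex.ofReal_re,
          Complex.I_re, mul_zero, add_zero]
      have him : (((1 - l : ℝ) : ℂ) + (k * ρ.im : ℝ) * Complex.I - z).im = k * t - z.im := by
        simp only [Complex.sub_im, Complex.add_im, Complex.im_ofReal_mul, Complex.ofReal_im,
          Complex.I_im, mul_one, zero_add, ht']
      have hzre := re_mem_of_entireXi_eq_zero hz0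
      by_cases hzt : |z.im| ≤ 6 * t
      · have h1 := hnear z hz0 hzt
        have h2 := hnear (1 - z) (entireXi_mirror hz0)
          (by rwa [Complex.sub_im, Complex.one_im, zero_sub, abs_neg])
        rw [Complex.sub_re, Complex.one_re] at h2
        exact zeroInv_add_re_nonneg (by linarith) (by linarith) hF (by rw [hre]; linarith)
          (by rw [hre]; linarith)
      · push Not at hzt
        have hy : 78 ≤ |k * t - z.im| := by
          have h1 := abs_sub_abs_le_abs_sub z.im (k * t)
          rw [abs_of_nonneg (by positivity : 0 ≤ k * t), abs_sub_comm] at h1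
          nlinarith
        have := zeroPair_tiltWeight_nonneg_of_large hl0 hl1 (x := 1 - l - z.re) (y := k * t - z.im)
          (by linarith) (by linarith) hy
        rwa [← hre, ← him, Complex.re_add_im] at this)
    h0 (by linarith)
  have hlow := poleInv_re_le_zeroPair (m := 1 - 2 * l) (w := tiltWeight) (B := 5 * l)
    (C := 23 / 5 * l) (x := 1 - l - ρ.re) (by linarith) (by linarith) (by linarith) (by linarith) hF
    (by linarith) (by linarith)
  have hmono := (poleInv_re_sub (w := tiltWeight) (u := 1 - l - ρ.re)
    (v := (1.0005 * p + 4 - 5) * l) (B := 5 * l) (C := 23 / 5 * l) (by linarith) (by linarith)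
    hx).1
  rw [poleInv_tiltWeight_eq_tiltProfile hl0 (by positivity)] at hmono
  have herr : 62 / 100 * (1 + 2 * ‖tiltWeight‖) * ((1 - l - ρ.re) / (1 - 2 * l) ^ 2) ≤ 0.02 := by
    have h1 : (1 - l - ρ.re) / (1 - 2 * l) ^ 2 ≤ 0.491 * 0.033 / (934 / 1000) ^ 2 := by
      have : 934 / 1000 ≤ 1 - 2 * l := by linarith
      gcongr
      linarith
    have h2 : 62 / 100 * (1 + 2 * ‖tiltWeight‖) ≤ 62 / 100 * (1 + 2 * (9 / 25)) := by gcongr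
    have h3 : 0 ≤ (1 - l - ρ.re) / (1 - 2 * l) ^ 2 := div_nonneg (by linarith) (by positivity)
    have h4 := mul_le_mul h2 h1 h3 (by norm_num)
    norm_num at h4 ⊢; linarith
  have hsum := zeroKernel_large_sum_le (t := t) (a := 51 / 400) (b := 20)
    (f := fun k => (zeroKernel (1 - 2 * l) tiltWeight (5 * l) (23 / 5 * l) poleGamma
      ((1 - l : ℝ) + (k * ρ.im : ℝ) * Complex.I)).re)
    ht0 (by norm_num) (by norm_num)
    (fun k hk _ => zeroKernel_tiltWeight_poleGamma_re_large hl0 hl1 (by nlinarith))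
  have hk0 := zeroKernel_tiltWeight_poleGamma_re_zero hl0 hl1
  have e0 : ((1 - l : ℝ) : ℂ) + (0 * ρ.im : ℝ) * Complex.I = (1 - l : ℝ) := by simp
  simp only [e0] at hsum
  have hΦ4 : (poleInv tiltWeight (5 * l) (23 / 5 * l) (-l : ℝ)).re = tiltProfile 4 / l := by
    rw [← poleInv_tiltWeight_eq_tiltProfile hl0 four_pos, show (4 - 5) * l = -l by ring]
  rw [hΦ4] at hk0
  have hY : 1 / t ^ 2 ≤ 1 / 39 ^ 2 := by gcongr
  have hineq : 2.448 * (tiltProfile (1.0005 * p + 4) / l) ≤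
      1.4379 * (tiltProfile 4 / l) + 0.59454 * (L - 1.1) := by
    norm_num at hY hsum hmain hlow hmono herr hk0 ⊢
    linarith
  exact hineq.not_gt (lt_of_lt_tiltProfile hR hL hl0 hlRM)

theorem logDeriv_riemannZeta_re_le {σ t : ℝ} (hσ : 1 < σ) :
    (logDeriv riemannZeta (σ + t * Complex.I)).re ≤ (-logDeriv riemannZeta σ).re := by
  have h1 := Complex.hasSum_re (hasSum_neg_logDeriv_riemannZeta (z := σ + t * Complex.I)
    (by simpa using hσ))
  have h0 := Complex.hasSum_re (hasSum_neg_logDeriv_riemannZeta (z := σ) (by simpa using hσ))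
  have h := h0.add h1
  have h2 : 0 ≤ (-logDeriv riemannZeta σ).re + (-logDeriv riemannZeta (σ + t * Complex.I)).re := by
    refine h.nonneg fun n => ?_
    have e0 : Complex.exp (-(σ : ℂ) * Real.log n) = (Real.exp (-σ * Real.log n) : ℝ) := by
      push_cast; ring_nf
    have e1 : ‖Complex.exp (-(σ + t * Complex.I : ℂ) * Real.log n)‖ = Real.exp (-σ * Real.log n) := by
      rw [Complex.norm_exp, Complex.re_mul_ofReal]; simp
    have h3 := (abs_le.1 (Complex.abs_re_le_norm
      (Complex.exp (-(σ + t * Complex.I : ℂ) * Real.log n)))).1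
    rw [e1] at h3
    rw [e0, Complex.re_ofReal_mul, Complex.re_ofReal_mul, Complex.ofReal_re, ← mul_add]
    exact mul_nonneg ArithmeticFunction.vonMangoldt_nonneg (by linarith)
  rw [Complex.neg_re (logDeriv riemannZeta (σ + t * Complex.I))] at h2
  linarith

theorem zeroPair_half_nonneg {x y : ℝ} (hx : -(1 / 2) ≤ x) (hx' : x ≤ 1 / 2) :
    0 ≤ zeroPair 0 0 (3 / 2) 0 (x + y * Complex.I) := by
  have e : ∀ z : ℂ, (zeroInv 0 0 (3 / 2) 0 z).re = 51 / 100 * (z + (3 / 2 : ℝ))⁻¹.re := by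
    intro z
    rw [zeroInv, zeroKernel_re]
    simp only [poleKernel_zero, mul_zero, Complex.ofReal_zero, add_zero]
    ring
  rw [zeroPair, Complex.add_re, e, e, Complex.inv_re, Complex.inv_re]
  simp only [Complex.ofReal_zero, zero_sub, Complex.add_re, Complex.neg_re, Complex.ofReal_re,
    Complex.re_ofReal_mul, Complex.I_re, mul_zero, add_zero]
  have h1 := Complex.normSq_nonneg ((x : ℂ) + y * Complex.I + (3 / 2 : ℝ))
  have h2 := Complex.normSq_nonneg (-((x : ℂ) + y * Complex.I) + (3 / 2 : ℝ))
  have h3 : 0 ≤ x + 3 / 2 := by linarith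
  have h4 : 0 ≤ -x + 3 / 2 := by linarith
  positivity

theorem le_zeroPair_half {x : ℝ} (hx : -(1 / 2) ≤ x) (hx' : x ≤ 1 / 2) :
    51 / 100 * (4 / 3) ≤ zeroPair 0 0 (3 / 2) 0 x := by
  have e : ∀ z : ℝ, (zeroInv 0 0 (3 / 2) 0 (z : ℂ)).re = 51 / 100 * (1 / (z + 3 / 2)) := by
    intro z
    rw [zeroInv_ofReal_re]
    simp only [poleInv_zero_ofReal_re, mul_zero, add_zero]
    ring
  rw [zeroPair, Complex.add_re, ← Complex.ofReal_sub, e, e, ← mul_add]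
  gcongr
  have h3 : 0 < x + 3 / 2 := by linarith
  have h4 : 0 < 0 - x + 3 / 2 := by linarith
  rw [div_add_div _ _ h3.ne' h4.ne', div_le_div_iff₀ (by norm_num) (by positivity)]
  nlinarith [sq_nonneg x]

theorem zeroKernel_half (g : ℂ → ℂ) (s : ℂ) :
    (zeroKernel 0 0 (3 / 2) 0 g s).re = 51 / 100 * (g (s + (3 / 2 : ℝ))).re := by
  rw [zeroKernel_re]
  simp only [poleKernel_zero, mul_zero, Complex.ofReal_zero, add_zero]
  ring

theorem log_three_div_two_pi_le : Real.log (3 / (2 * Real.pi)) ≤ -(735 / 1000) := by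
  rw [Real.log_div (by norm_num) (by positivity)]
  linarith [log_three_le, le_log_two_pi]

theorem poleGamma_two_re_le : (poleGamma 2).re ≤ 65 / 100 := by
  have h := (abs_le.1 (poleGamma_ofReal_re (a := 1) zero_le_one)).2
  norm_num at h
  have h1 := log_three_div_two_pi_le
  norm_num at h1
  linarith

theorem poleGamma_two_add_mul_I_re_le {y : ℝ} (hy : |y| ≤ 5) :
    (poleGamma ((2 : ℝ) + y * Complex.I)).re ≤ 65 / 100 := by
  have hy2 : y ^ 2 ≤ 25 := by
    rw [← sq_abs]; nlinarith [abs_nonneg y]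
  have e1 : ((2 : ℝ) : ℂ) + y * Complex.I - 1 = (1 : ℝ) + y * Complex.I := by push_cast; ring
  have hpi : 0 < 2 * Real.pi := by positivity
  have e2 : (((2 : ℝ) : ℂ) + y * Complex.I + 1) / (2 * Real.pi) =
      ((3 : ℝ) + y * Complex.I) / (2 * Real.pi : ℝ) := by push_cast; ring
  have hE := norm_stirlingError_le_re (s := ((2 : ℝ) : ℂ) + y * Complex.I) (by simp)
  have hre : (((2 : ℝ) : ℂ) + y * Complex.I).re = 2 := by simp
  rw [hre] at hE
  have hE' := (abs_le.1 ((Complex.abs_re_le_norm _).trans hE)).2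
  have hlog : Real.log ‖(((3 : ℝ) : ℂ) + y * Complex.I) / (2 * Real.pi : ℝ)‖ ≤
      -(735 / 1000) + y ^ 2 / 18 := by
    have hn : ‖(((3 : ℝ) : ℂ) + y * Complex.I) / (2 * Real.pi : ℝ)‖ ≤
        3 / (2 * Real.pi) * (1 + y ^ 2 / 18) := by
      rw [norm_div, Complex.norm_add_mul_I, Complex.norm_real, Real.norm_of_nonneg hpi.le,
        div_mul_eq_mul_div]
      gcongr
      refine Real.sqrt_le_iff.2 ⟨by positivity, ?_⟩
      nlinarith [sq_nonneg (y ^ 2)]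
    have hn0 : 0 < ‖(((3 : ℝ) : ℂ) + y * Complex.I) / (2 * Real.pi : ℝ)‖ := by
      rw [norm_div, Complex.norm_add_mul_I, Complex.norm_real, Real.norm_of_nonneg hpi.le]
      positivity
    refine (Real.log_le_log hn0 hn).trans ?_
    rw [Real.log_mul (by positivity) (by positivity)]
    have := Real.log_le_sub_one_of_pos (x := 1 + y ^ 2 / 18) (by positivity)
    linarith [log_three_div_two_pi_le]
  have hinv : (1 / (((1 : ℝ) : ℂ) + y * Complex.I)).re = 1 / (1 + y ^ 2) := by
    rw [one_div, Complex.inv_re, Complex.normSq_add_mul_I]; simp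
  have hq : 1 / (1 + y ^ 2) + y ^ 2 / 36 ≤ 1 := by
    have : 1 / (1 + y ^ 2) ≤ 1 - y ^ 2 / 36 := by
      rw [div_le_iff₀ (by positivity)]; nlinarith [sq_nonneg y]
    linarith
  rw [poleGamma, e1, e2, Complex.add_re, Complex.add_re, hinv, Complex.div_ofNat_re,
    Complex.div_ofNat_re, Complex.log_re]
  have h36 : 1 / (4 * ((2 : ℝ) + 1) ^ 2) = 1 / 36 := by norm_num
  rw [h36] at hE'
  linarith

theorem five_le_abs_im_of_zero {ρ : ℂ} (h0 : entireXi ρ = 0) (h2 : ρ.re ≠ 1 / 2) :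
    5 ≤ |ρ.im| := by
  by_contra! hlt
  have hpair : ∀ (y : ℝ) (z : ℂ), entireXi z = 0 →
      0 ≤ zeroPair 0 0 (3 / 2) 0 ((1 / 2 : ℝ) + y * Complex.I - z) := by
    intro y z hz
    have h := re_mem_of_entireXi_eq_zero hz
    have e : ((1 / 2 : ℝ) : ℂ) + y * Complex.I - z =
        (1 / 2 - z.re : ℝ) + (y - z.im : ℝ) * Complex.I := by
      conv_lhs => rw [← Complex.re_add_im z]
      push_cast; ring
    rw [e]
    exact zeroPair_half_nonneg (by linarith) (by linarith)
  have hs : ∀ y : ℝ, (((1 / 2 : ℝ) : ℂ) + y * Complex.I).re = 1 / 2 := by intro y; simp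
  have e2 : ∀ y : ℝ, ((1 / 2 : ℝ) : ℂ) + y * Complex.I + (3 / 2 : ℝ) = (2 : ℝ) + y * Complex.I := by
    intro y; push_cast; ring
  have hX0 := zeroKernel_logDeriv_entireXi_re_nonneg (w := 0) (C := 0) (B := 3 / 2) le_rfl
    (by rw [hs]; norm_num) (by rw [hs]; norm_num) (hpair 0)
  have hX1 := zeroPair_le_zeroKernel_logDeriv_entireXi_re (w := 0) (C := 0) (B := 3 / 2) le_rfl
    (by rw [hs]; norm_num) (by rw [hs]; norm_num) (hpair ρ.im) h0 h2
  have e3 : ((1 / 2 : ℝ) : ℂ) + ρ.im * Complex.I - ρ = (1 / 2 - ρ.re : ℝ) := by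
    apply Complex.ext <;> simp
  have hβ := re_mem_of_entireXi_eq_zero h0
  rw [e3] at hX1
  have hX1 := (le_zeroPair_half (by linarith) (by linarith)).trans hX1
  have hre2 : ∀ y : ℝ, 1 < (((2 : ℝ) : ℂ) + y * Complex.I).re := by intro y; simp
  rw [zeroKernel_half, e2, logDeriv_entireXi (hre2 _), Complex.add_re] at hX0 hX1
  have hz := logDeriv_riemannZeta_re_le (σ := 2) (t := ρ.im) one_lt_two
  have hp := poleGamma_two_add_mul_I_re_le hlt.le
  have hp0 := poleGamma_two_re_le
  rw [Complex.ofReal_zero, zero_mul, add_zero] at hX0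
  rw [Complex.neg_re] at hz
  rw [Complex.ofReal_ofNat] at hX0 hX1 hz hp
  linarith

theorem false_of_zero_of_mul_log_le {ρ₁ : ℂ} (h0 : entireXi ρ₁ = 0) (h2 : ρ₁.re ≠ 1 / 2)
    (h1 : (1 - ρ₁.re) * (5.573412 * Real.log |ρ₁.im|) ≤ 1) : False := by
  have hlog : ∀ z, entireXi z = 0 → z.re ≠ 1 / 2 → 0 < (1 - z.re) * Real.log |z.im| := by
    intro z hz hz2
    have := five_le_abs_im_of_zero hz hz2
    exact mul_pos (by linarith [(re_mem_of_entireXi_eq_zero hz).2]) (Real.log_pos (by linarith))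
  -- a zero may be replaced by its complex conjugate
  have hconj : ∀ z, entireXi z = 0 → ∃ z', entireXi z' = 0 ∧ z'.re = z.re ∧ z'.im = |z.im| := by
    intro z hz
    rcases le_total 0 z.im with h | h
    · exact ⟨z, hz, rfl, (abs_of_nonneg h).symm⟩
    · refine ⟨starRingEnd ℂ z, by rw [entireXi_conj, hz, map_zero], Complex.conj_re z, ?_⟩
      rw [Complex.conj_im, abs_of_nonpos h]
  set S : Set ℝ := {v | ∃ z, entireXi z = 0 ∧ z.re ≠ 1 / 2 ∧
    v = 1 / ((1 - z.re) * Real.log |z.im|)} with hS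
  have hbdd : BddAbove S := by
    refine ⟨20, ?_⟩
    rintro v ⟨z, hz, hz2, rfl⟩
    obtain ⟨z', hz', hre, him⟩ := hconj z hz
    have h := one_lt_mul_log_of_zero hz' (by rw [him]; exact five_le_abs_im_of_zero hz hz2)
    rw [hre, him] at h
    rw [div_le_iff₀ (hlog z hz hz2)]
    linarith
  have hmem : 1 / ((1 - ρ₁.re) * Real.log |ρ₁.im|) ∈ S := ⟨ρ₁, h0, h2, rfl⟩
  have hv₁ : 5.573412 ≤ 1 / ((1 - ρ₁.re) * Real.log |ρ₁.im|) := by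
    rw [le_div_iff₀ (hlog ρ₁ h0 h2)]; linarith
  have hle : ∀ v ∈ S, v ≤ sSup S := fun v hv => le_csSup hbdd hv
  have hR : 5.573412 ≤ sSup S := hv₁.trans (hle _ hmem)
  obtain ⟨v, hv, hv1, hv2⟩ : ∃ v ∈ S, 5.573412 ≤ v ∧ sSup S ≤ 1.0005 * v := by
    obtain ⟨v, hv, hlt⟩ := exists_lt_of_lt_csSup ⟨_, hmem⟩
      (show sSup S / 1.0005 < sSup S from div_lt_self (by linarith) (by norm_num))
    rw [div_lt_iff₀ (by norm_num)] at hlt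
    rcases le_total v (1 / ((1 - ρ₁.re) * Real.log |ρ₁.im|)) with h | h
    · exact ⟨_, hmem, hv₁, by linarith⟩
    · exact ⟨v, hv, hv₁.trans h, by linarith⟩
  obtain ⟨z, hz, hz2, rfl⟩ := hv
  obtain ⟨ρ, hρ, hre, him⟩ := hconj z hz
  have hpos := hlog z hz hz2
  have h5 := five_le_abs_im_of_zero hz hz2
  rw [← hre, ← him] at hv1 hv2 hpos
  rw [← him] at h5
  have hL : 368 / 100 ≤ Real.log ρ.im := by
    refine log_im_of_zero hρ h5 ?_
    rw [le_div_iff₀ hpos] at hv1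
    linarith
  have ht : 39 ≤ ρ.im := by
    rw [Real.le_log_iff_exp_le (by linarith)] at hL
    have h3 : Real.exp 3 = Real.exp 1 ^ 3 := by rw [← Real.exp_nat_mul]; norm_num
    have h4 : (2.718 : ℝ) ^ 3 ≤ Real.exp 1 ^ 3 := by
      gcongr; linarith [Real.exp_one_gt_d9]
    have h6 := Real.sum_le_exp_of_nonneg (x := 68 / 100) (by norm_num) 5
    norm_num [Finset.sum_range_succ, Nat.factorial] at h6
    have h7 : Real.exp (368 / 100) = Real.exp 3 * Real.exp (68 / 100) := by
      rw [← Real.exp_add]; norm_num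
    rw [h7, h3] at hL
    norm_num at h4 h6 hL
    nlinarith
  refine false_of_extremal_zero hR (fun _ => five_le_abs_im_of_zero) (fun w hw hw2 => ?_) hρ ht hL ?_
  · have := hle _ ⟨w, hw, hw2, rfl⟩
    rw [div_le_iff₀ (hlog w hw hw2)] at this
    linarith
  · rw [mul_one_div, le_div_iff₀ hpos] at hv2
    linarith

/-- The Riemann zeta-function has no zeros in the region
`σ > 1 - 1/(5.573412 log |t|)` for `|t| ≥ 2`. -/
theorem zeta_zero_free_region (σ t : ℝ) (ht : 2 ≤ |t|)
    (hσ : 1 - 1 / (5.573412 * Real.log |t|) < σ) :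
    riemannZeta (σ + t * Complex.I) ≠ 0 := by
  intro h0
  have hre : (σ + t * Complex.I : ℂ).re = σ := by simp
  have him : (σ + t * Complex.I : ℂ).im = t := by simp
  have hlog : 0.69 < Real.log |t| := by
    have := Real.log_le_log two_pos ht
    linarith [Real.log_two_gt_d9]
  have hpos : 0 < 5.573412 * Real.log |t| := by linarith
  have hσ1 : σ < 1 := by
    by_contra! h
    exact riemannZeta_ne_zero_of_one_le_re (by rwa [hre]) h0
  have hlt : (1 - σ) * (5.573412 * Real.log |t|) < 1 := by
    rw [← lt_div_iff₀ hpos]; linarith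
  have hσ2 : 1 / 2 < σ := by nlinarith
  have hξ := entireXi_eq_zero_of_riemannZeta_eq_zero (by rw [hre]; linarith) (by rwa [hre]) h0
  exact false_of_zero_of_mul_log_le hξ (by rw [hre]; exact hσ2.ne') (by rw [hre, him]; exact hlt.le)
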